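/- arXiv:1701.01280 — 7 statements merged into one kernel-verified Lean document; each statement's English description precedes it below -/
import Mathlib

section
/- Let n ∈ ℕ, 1 < p, q < ∞, 0 < r < ∞ with p + q ≥ r, let δ ∈ [0,1] ∩ [(r−q)/r, p/r], and let a, b, c ∈ ℝ satisfy δr/p + (1−δ)r/q = 1 and c = δ(a−1) + b(1−δ). If n ≠ p(1−a), then for every f ∈ C_0^∞(ℝ^n \ {0}), ‖|x|^c f‖_{L^r(ℝ^n)} ≤ |p/(n − p(1−a))|^δ · ‖|x|^a ∇f‖_{L^p(ℝ^n)}^δ · ‖|x|^b f‖_{L^q(ℝ^n)}^{1−δ}. -/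
open Real MeasureTheory

lemma aux_cont {n : ℕ} (s : ℝ) (u : EuclideanSpace ℝ (Fin n) → ℝ) (hu : Continuous u)
    (h0 : ∃ ε > (0 : ℝ), ∀ x : EuclideanSpace ℝ (Fin n), ‖x‖ < ε → u x = 0) :
    Continuous (fun x => ‖x‖ ^ s * u x) := by
  obtain ⟨ε, hε, h0⟩ := h0
  rw [continuous_iff_continuousAt]
  intro x
  by_cases hx : x = 0
  · subst hx
    have : (fun x => ‖x‖ ^ s * u x) =ᶠ[nhds 0] fun _ => (0 : ℝ) := by
      filter_upwards [Metric.ball_mem_nhds (0 : EuclideanSpace ℝ (Fin n)) hε] with y hy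
      rw [h0 y (by simpa using hy), mul_zero]
    exact continuousAt_const.congr this.symm
  · exact (continuous_norm.continuousAt.rpow_const (Or.inl (norm_ne_zero_iff.2 hx))).mul
      hu.continuousAt

lemma aux_euler {n : ℕ} (h : EuclideanSpace ℝ (Fin n) → ℝ) (hh : ContDiff ℝ 1 h)
    (hs : HasCompactSupport h) :
    ∫ x, fderiv ℝ h x x = - (n * ∫ x, h x) := by
  have hc' : Continuous (fderiv ℝ h) := hh.continuous_fderiv (by norm_num)
  have hs' : HasCompactSupport (fderiv ℝ h) := hs.fderiv ℝ
  have hint : Integrable h := hh.continuous.integrable_of_hasCompactSupport hs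
  let e : Fin n → EuclideanSpace ℝ (Fin n) := fun i => EuclideanSpace.single i 1
  have hcoord : ∀ i x, fderiv ℝ (fun y : EuclideanSpace ℝ (Fin n) => y i) x (e i) = 1 := by
    intro i x
    have : HasFDerivAt (fun y : EuclideanSpace ℝ (Fin n) => y i)
      (EuclideanSpace.proj i : EuclideanSpace ℝ (Fin n) →L[ℝ] ℝ) x :=
      (EuclideanSpace.proj i : EuclideanSpace ℝ (Fin n) →L[ℝ] ℝ).hasFDerivAt
    rw [this.fderiv]
    simp [e]
  have hI : ∀ i, Integrable (fun x : EuclideanSpace ℝ (Fin n) => x i * fderiv ℝ h x (e i)) := by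
    intro i
    apply Continuous.integrable_of_hasCompactSupport
    · fun_prop
    · apply HasCompactSupport.mul_left
      exact hs'.comp_left (g := fun L : EuclideanSpace ℝ (Fin n) →L[ℝ] ℝ => L (e i)) (by simp)
  have key : ∀ i, ∫ x : EuclideanSpace ℝ (Fin n), x i * fderiv ℝ h x (e i) = - ∫ x, h x := by
    intro i
    rw [integral_mul_fderiv_eq_neg_fderiv_mul_of_integrable]
    · simp only [hcoord, one_mul]
    · simpa only [hcoord, one_mul] using hint
    · exact hI i
    · apply Continuous.integrable_of_hasCompactSupport
      · have := hh.continuous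
        fun_prop
      · exact hs.mul_left
    · intro x _
      fun_prop
    · intro x _
      exact hh.differentiable (by norm_num) x
  have hsum : ∀ x : EuclideanSpace ℝ (Fin n), fderiv ℝ h x x
      = ∑ i, x i * fderiv ℝ h x (e i) := by
    intro x
    have hx : x = ∑ i, x i • e i := by
      ext j
      simp [e, Pi.single_apply]
    conv_lhs => rw [hx, map_sum]
    rw [← hx]
    simp
  simp_rw [hsum]
  rw [integral_finsetSum _ (fun i _ => hI i)]
  simp [key]

lemma aux_hardy (n : ℕ) (p a : ℝ) (hp : 1 < p) (hcrit : (n : ℝ) ≠ p * (1 - a))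
    (f : EuclideanSpace ℝ (Fin n) → ℝ) (hf : ContDiff ℝ (⊤ : ℕ∞) f) (hsupp : HasCompactSupport f)
    (h0 : ∃ ε > (0 : ℝ), ∀ x : EuclideanSpace ℝ (Fin n), ‖x‖ < ε → f x = 0) :
    (∫ x : EuclideanSpace ℝ (Fin n), (‖x‖ ^ (a - 1) * |f x|) ^ p) ^ (1 / p) ≤
      |p / ((n : ℝ) - p * (1 - a))| *
        (∫ x : EuclideanSpace ℝ (Fin n), (‖x‖ ^ a * ‖fderiv ℝ f x‖) ^ p) ^ (1 / p) := by
  have hp0 : 0 < p := by linarith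
  have hf1 : ContDiff ℝ 1 f := hf.of_le (by exact_mod_cast le_top)
  obtain ⟨ε, hε, h0⟩ := h0
  have h0' : ∀ x : EuclideanSpace ℝ (Fin n), ‖x‖ < ε → fderiv ℝ f x = 0 := by
    intro x hx
    have : f =ᶠ[nhds x] fun _ => (0 : ℝ) := by
      filter_upwards [Metric.isOpen_ball.mem_nhds
        (show x ∈ Metric.ball (0 : EuclideanSpace ℝ (Fin n)) ε by simpa using hx)] with y hy
      exact h0 y (by simpa using hy)
    rw [this.fderiv_eq]
    simp
  set u : EuclideanSpace ℝ (Fin n) → ℝ := fun x => ‖x‖ ^ (a - 1) * |f x| with hu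
  set v : EuclideanSpace ℝ (Fin n) → ℝ := fun x => ‖x‖ ^ a * ‖fderiv ℝ f x‖ with hv
  have hu0 : ∀ x, 0 ≤ u x := fun x => by positivity
  have hv0 : ∀ x, 0 ≤ v x := fun x => by positivity
  have huc : Continuous u := aux_cont _ _ hf.continuous.abs
    ⟨ε, hε, fun x hx => by rw [h0 x hx, abs_zero]⟩
  have hvc : Continuous v := aux_cont _ _ (hf1.continuous_fderiv (by norm_num)).norm
    ⟨ε, hε, fun x hx => by rw [h0' x hx, norm_zero]⟩
  have hus : HasCompactSupport u :=
    HasCompactSupport.mul_left (hsupp.comp_left (g := fun t => |t|) (by simp))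
  have hvs : HasCompactSupport v := HasCompactSupport.mul_left (hsupp.fderiv ℝ).norm
  set s : ℝ := p * (a - 1) with hs
  set h : EuclideanSpace ℝ (Fin n) → ℝ := fun x => ‖x‖ ^ s * |f x| ^ p with hh
  have huh : ∀ x, u x ^ p = h x := by
    intro x
    simp only [hu, hh]
    rw [mul_rpow (by positivity) (by positivity), ← rpow_mul (norm_nonneg _), hs, mul_comm p]
  have hfp : ContDiff ℝ 1 (fun x => |f x| ^ p) :=
    (contDiff_norm_rpow (E := ℝ) hp).comp hf1
  have hz : ∀ x : EuclideanSpace ℝ (Fin n), ‖x‖ < ε → h =ᶠ[nhds x] fun _ => (0 : ℝ) := by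
    intro x hx
    filter_upwards [Metric.isOpen_ball.mem_nhds
        (show x ∈ Metric.ball (0 : EuclideanSpace ℝ (Fin n)) ε by simpa using hx)] with y hy
    simp only [hh]
    rw [h0 y (by simpa using hy), abs_zero, zero_rpow hp0.ne', mul_zero]
  have hh1 : ContDiff ℝ 1 h := by
    rw [contDiff_iff_contDiffAt]
    intro x
    by_cases hx : x = 0
    · subst hx
      exact contDiffAt_const.congr_of_eventuallyEq (hz 0 (by simpa using hε))
    · exact ((contDiffAt_norm ℝ hx).rpow_const_of_ne (norm_ne_zero_iff.2 hx)).mul hfp.contDiffAt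
  have hhs : HasCompactSupport h := HasCompactSupport.mul_left
    (hsupp.comp_left (g := fun t => |t| ^ p) (by simp [zero_rpow hp0.ne']))
  have hpt : ∀ x, |fderiv ℝ h x x - s * h x| ≤ p * (u x ^ (p - 1) * v x) := by
    intro x
    by_cases hx : x = 0
    · subst hx
      have : h 0 = 0 := (hz 0 (by simpa using hε)).self_of_nhds
      rw [this]
      simp only [map_zero, mul_zero, sub_zero, abs_zero]
      have := hu0 0
      have := hv0 0
      positivity
    · have hxn : 0 < ‖x‖ := norm_pos_iff.2 hx
      have d1 : HasFDerivAt (fun y : EuclideanSpace ℝ (Fin n) => ‖y‖ ^ s)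
          ((s * ‖x‖ ^ (s - 1)) • fderiv ℝ (fun y : EuclideanSpace ℝ (Fin n) => ‖y‖) x) x :=
        (((contDiffAt_norm ℝ hx (n := 1)).differentiableAt (by norm_num)).hasFDerivAt).rpow_const
          (Or.inl hxn.ne')
      have d2 : HasFDerivAt (fun y => |f y| ^ p)
          ((p * |f x| ^ (p - 2) * f x) • fderiv ℝ f x) x :=
        (hasDerivAt_abs_rpow (f x) hp).comp_hasFDerivAt x
          (hf1.differentiable (by norm_num) x).hasFDerivAt
      have d3 := (d1.mul d2).fderiv
      have e1 : fderiv ℝ (fun y : EuclideanSpace ℝ (Fin n) => ‖y‖) x x = ‖x‖ :=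
        DifferentiableAt.fderiv_norm_self ((contDiffAt_norm ℝ hx (n := 1)).differentiableAt (by norm_num))
      have e2 : ‖x‖ ^ (s - 1) * ‖x‖ = ‖x‖ ^ s := by
        rw [← rpow_add_one hxn.ne']; simp
      have e3 : fderiv ℝ h x x - s * h x
          = ‖x‖ ^ s * (p * |f x| ^ (p - 2) * f x * fderiv ℝ f x x) := by
        have : fderiv ℝ h x = _ := d3
        rw [this]
        simp only [add_apply, smul_apply, smul_eq_mul,
          e1, hh]
        rw [← e2]
        ring
      have e4 : |f x| ^ (p - 2) * |f x| = |f x| ^ (p - 1) := by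
        rw [← rpow_add_one' (abs_nonneg _) (by linarith)]; ring_nf
      have e5 : ‖x‖ ^ s * ‖x‖ = (‖x‖ ^ (a - 1)) ^ (p - 1) * ‖x‖ ^ a := by
        rw [← rpow_mul hxn.le, ← rpow_add hxn, ← rpow_add_one hxn.ne', hs]; ring_nf
      rw [e3]
      simp only [abs_mul, abs_of_pos hp0]
      rw [abs_of_nonneg (rpow_nonneg hxn.le _), abs_of_nonneg (rpow_nonneg (abs_nonneg _) _)]
      have e6 : |fderiv ℝ f x x| ≤ ‖fderiv ℝ f x‖ * ‖x‖ := (fderiv ℝ f x).le_opNorm x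
      calc ‖x‖ ^ s * (p * |f x| ^ (p - 2) * |f x| * |fderiv ℝ f x x|)
          ≤ ‖x‖ ^ s * (p * |f x| ^ (p - 2) * |f x| * (‖fderiv ℝ f x‖ * ‖x‖)) := by gcongr
        _ = p * ((‖x‖ ^ s * ‖x‖) * (|f x| ^ (p - 2) * |f x|) * ‖fderiv ℝ f x‖) := by ring
        _ = p * (u x ^ (p - 1) * v x) := by
          rw [e4, e5]
          simp only [hu, hv]
          rw [mul_rpow (by positivity) (by positivity)]
          ring
  have hu1c : Continuous (fun x => u x ^ (p - 1)) :=
    huc.rpow_const (fun x => Or.inr (by linarith))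
  have hu1s : HasCompactSupport (fun x => u x ^ (p - 1)) :=
    hus.comp_left (g := fun t => t ^ (p - 1)) (zero_rpow (by linarith))
  have hIh : Integrable h := hh1.continuous.integrable_of_hasCompactSupport hhs
  have hc' : Continuous (fderiv ℝ h) := hh1.continuous_fderiv (by norm_num)
  have hId : Integrable (fun x => fderiv ℝ h x x) := by
    apply Continuous.integrable_of_hasCompactSupport
    · fun_prop
    · refine (hhs.fderiv ℝ).mono ?_
      intro x hx h'
      exact hx (by simp [h'])
  have hIuv : Integrable (fun x => u x ^ (p - 1) * v x) :=
    (hu1c.mul hvc).integrable_of_hasCompactSupport hvs.mul_left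
  have hmain : |(n : ℝ) - p * (1 - a)| * ∫ x, h x ≤ p * ∫ x, u x ^ (p - 1) * v x := by
    have hhn : 0 ≤ ∫ x, h x := integral_nonneg fun x => by
      rw [← huh]; exact rpow_nonneg (hu0 x) _
    have E : ∫ x, (fderiv ℝ h x x - s * h x) = - (((n : ℝ) - p * (1 - a)) * ∫ x, h x) := by
      rw [integral_sub hId (hIh.const_mul s), integral_const_mul, aux_euler h hh1 hhs, hs]
      ring
    calc |(n : ℝ) - p * (1 - a)| * ∫ x, h x = |∫ x, (fderiv ℝ h x x - s * h x)| := by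
          rw [E, abs_neg, abs_mul, abs_of_nonneg hhn]
      _ ≤ ∫ x, |fderiv ℝ h x x - s * h x| := abs_integral_le_integral_abs
      _ ≤ ∫ x, p * (u x ^ (p - 1) * v x) :=
          integral_mono (hId.sub (hIh.const_mul s)).abs (hIuv.const_mul p) hpt
      _ = _ := integral_const_mul _ _
  have hconj : (p / (p - 1)).HolderConjugate p := (HolderConjugate.conjExponent hp).symm
  have hhol := integral_mul_le_Lp_mul_Lq_of_nonneg (μ := volume) hconj
    (f := fun x => u x ^ (p - 1)) (g := v)
    (Filter.Eventually.of_forall fun x => rpow_nonneg (hu0 x) _)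
    (Filter.Eventually.of_forall hv0)
    (hu1c.memLp_of_hasCompactSupport hu1s) (hvc.memLp_of_hasCompactSupport hvs)
  have hp1 : p - 1 ≠ 0 := by linarith
  have hup : ∀ x, (u x ^ (p - 1)) ^ (p / (p - 1)) = h x := by
    intro x
    rw [← rpow_mul (hu0 x), mul_div_cancel₀ _ hp1, huh]
  simp only [hup] at hhol
  change (∫ x, u x ^ p) ^ (1 / p) ≤ |p / ((n : ℝ) - p * (1 - a))| * (∫ x, v x ^ p) ^ (1 / p)
  simp only [huh]
  have hhn : 0 ≤ ∫ x, h x := integral_nonneg fun x => by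
    rw [← huh]; exact rpow_nonneg (hu0 x) _
  have hvn : 0 ≤ ∫ x, v x ^ p := integral_nonneg fun x => rpow_nonneg (hv0 x) _
  set I := ∫ x, h x
  set V := (∫ x, v x ^ p) ^ (1 / p) with hV
  have hVn : 0 ≤ V := rpow_nonneg hvn _
  have hd : 0 < |(n : ℝ) - p * (1 - a)| := abs_pos.2 (sub_ne_zero.2 hcrit)
  rcases hhn.eq_or_lt with hI0 | hI0
  · rw [← hI0, zero_rpow (by positivity)]
    positivity
  · rw [abs_div, abs_of_pos hp0, div_mul_eq_mul_div, le_div_iff₀ hd]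
    have hpos : 0 < I ^ (1 / (p / (p - 1))) := rpow_pos_of_pos hI0 _
    have hsplit : I = I ^ (1 / p) * I ^ (1 / (p / (p - 1))) := by
      rw [← rpow_add hI0]
      have : 1 / p + 1 / (p / (p - 1)) = 1 := by field_simp; ring
      rw [this, rpow_one]
    refine le_of_mul_le_mul_right ?_ hpos
    calc I ^ (1 / p) * |(n : ℝ) - p * (1 - a)| * I ^ (1 / (p / (p - 1)))
        = |(n : ℝ) - p * (1 - a)| * (I ^ (1 / p) * I ^ (1 / (p / (p - 1)))) := by ring
      _ = |(n : ℝ) - p * (1 - a)| * I := by rw [← hsplit]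
      _ ≤ p * (I ^ (1 / (p / (p - 1))) * V) :=
          hmain.trans (mul_le_mul_of_nonneg_left hhol hp0.le)
      _ = p * V * I ^ (1 / (p / (p - 1))) := by ring

theorem stmt_3 (n : ℕ) (p q r δ a b c : ℝ)
    (hp : 1 < p) (hq : 1 < q) (hr : 0 < r) (hpqr : r ≤ p + q)
    (hδ0 : 0 ≤ δ) (hδ1 : δ ≤ 1) (hδ2 : (r - q) / r ≤ δ) (hδ3 : δ ≤ p / r)
    (h1 : δ * r / p + (1 - δ) * r / q = 1) (hc : c = δ * (a - 1) + b * (1 - δ))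
    (hcrit : (n : ℝ) ≠ p * (1 - a))
    (f : EuclideanSpace ℝ (Fin n) → ℝ) (hf : ContDiff ℝ (⊤ : ℕ∞) f) (hsupp : HasCompactSupport f)
    (h0 : ∃ ε > (0 : ℝ), ∀ x : EuclideanSpace ℝ (Fin n), ‖x‖ < ε → f x = 0) :
    (∫ x : EuclideanSpace ℝ (Fin n), (‖x‖ ^ c * |f x|) ^ r) ^ (1 / r) ≤
      |p / ((n : ℝ) - p * (1 - a))| ^ δ *
        ((∫ x : EuclideanSpace ℝ (Fin n), (‖x‖ ^ a * ‖fderiv ℝ f x‖) ^ p) ^ (1 / p)) ^ δ *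
        ((∫ x : EuclideanSpace ℝ (Fin n), (‖x‖ ^ b * |f x|) ^ q) ^ (1 / q)) ^ (1 - δ) := by
  have hp0 : 0 < p := by linarith
  have hq0 : 0 < q := by linarith
  have hardy := aux_hardy n p a hp hcrit f hf hsupp h0
  have hVn : 0 ≤ (∫ x : EuclideanSpace ℝ (Fin n), (‖x‖ ^ a * ‖fderiv ℝ f x‖) ^ p) ^ (1 / p) :=
    rpow_nonneg (integral_nonneg fun x => by positivity) _
  have hUn : 0 ≤ ∫ x : EuclideanSpace ℝ (Fin n), (‖x‖ ^ (a - 1) * |f x|) ^ p :=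
    integral_nonneg fun x => by positivity
  have hZn : 0 ≤ ∫ x : EuclideanSpace ℝ (Fin n), (‖x‖ ^ b * |f x|) ^ q :=
    integral_nonneg fun x => by positivity
  have hLn : 0 ≤ ∫ x : EuclideanSpace ℝ (Fin n), (‖x‖ ^ c * |f x|) ^ r :=
    integral_nonneg fun x => by positivity
  rw [← mul_rpow (abs_nonneg _) hVn]
  suffices H : (∫ x : EuclideanSpace ℝ (Fin n), (‖x‖ ^ c * |f x|) ^ r) ^ (1 / r) ≤
      ((∫ x : EuclideanSpace ℝ (Fin n), (‖x‖ ^ (a - 1) * |f x|) ^ p) ^ (1 / p)) ^ δ *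
        ((∫ x : EuclideanSpace ℝ (Fin n), (‖x‖ ^ b * |f x|) ^ q) ^ (1 / q)) ^ (1 - δ) by
    refine H.trans ?_
    gcongr
  rcases hδ0.eq_or_lt with hd | hd
  · subst hd
    have : r = q := by
      have h3 : r / q = 1 := by simpa using h1
      rwa [div_eq_one_iff_eq hq0.ne'] at h3
    subst this
    have : c = b := by rw [hc]; ring
    subst this
    simp
  rcases hδ1.eq_or_lt with hd' | hd'
  · subst hd'
    have : r = p := by
      have h3 : r / p = 1 := by simpa using h1
      rwa [div_eq_one_iff_eq hp0.ne'] at h3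
    subst this
    have : c = a - 1 := by rw [hc]; ring
    subst this
    simp
  have hd1 : 0 < 1 - δ := by linarith
  obtain ⟨ε, hε, h0⟩ := h0
  have habs : ∃ ε > (0 : ℝ), ∀ x : EuclideanSpace ℝ (Fin n), ‖x‖ < ε → |f x| = 0 :=
    ⟨ε, hε, fun x hx => by rw [h0 x hx, abs_zero]⟩
  have hS : ∀ t e : ℝ, 0 < e → Continuous (fun x => (‖x‖ ^ t * |f x|) ^ e) ∧
      HasCompactSupport (fun x => (‖x‖ ^ t * |f x|) ^ e) := by
    intro t e he
    refine ⟨(aux_cont t _ hf.continuous.abs habs).rpow_const (fun x => Or.inr he.le), ?_⟩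
    refine hsupp.mono ?_
    intro x hx h'
    exact hx (by simp [h', zero_rpow he.ne'])
  have hA : 0 < δ * r := by positivity
  have hB : 0 < (1 - δ) * r := by positivity
  have hconj : (p / (δ * r)).HolderConjugate (q / ((1 - δ) * r)) := by
    rw [Real.holderConjugate_iff]
    have h2 : 0 < (1 - δ) * r / q := by positivity
    constructor
    · rw [one_lt_div hA]
      have : δ * r / p < 1 := by linarith
      rwa [div_lt_one hp0] at this
    · rw [inv_div, inv_div]
      exact h1
  have hhol := integral_mul_le_Lp_mul_Lq_of_nonneg (μ := volume) hconj
    (f := fun x : EuclideanSpace ℝ (Fin n) => (‖x‖ ^ (a - 1) * |f x|) ^ (δ * r))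
    (g := fun x : EuclideanSpace ℝ (Fin n) => (‖x‖ ^ b * |f x|) ^ ((1 - δ) * r))
    (Filter.Eventually.of_forall fun x => by positivity)
    (Filter.Eventually.of_forall fun x => by positivity)
    ((hS _ _ hA).1.memLp_of_hasCompactSupport (hS _ _ hA).2)
    ((hS _ _ hB).1.memLp_of_hasCompactSupport (hS _ _ hB).2)
  have i1 : ∀ x : EuclideanSpace ℝ (Fin n),
      ((‖x‖ ^ (a - 1) * |f x|) ^ (δ * r)) ^ (p / (δ * r)) = (‖x‖ ^ (a - 1) * |f x|) ^ p := by
    intro x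
    rw [← rpow_mul (by positivity), mul_div_cancel₀ _ hA.ne']
  have i2 : ∀ x : EuclideanSpace ℝ (Fin n),
      ((‖x‖ ^ b * |f x|) ^ ((1 - δ) * r)) ^ (q / ((1 - δ) * r)) = (‖x‖ ^ b * |f x|) ^ q := by
    intro x
    rw [← rpow_mul (by positivity), mul_div_cancel₀ _ hB.ne']
  have i3 : ∀ x : EuclideanSpace ℝ (Fin n),
      (‖x‖ ^ (a - 1) * |f x|) ^ (δ * r) * (‖x‖ ^ b * |f x|) ^ ((1 - δ) * r)
        = (‖x‖ ^ c * |f x|) ^ r := by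
    intro x
    by_cases hx : ‖x‖ < ε
    · rw [h0 x hx]
      simp [zero_rpow hA.ne', zero_rpow hr.ne']
    · have hxn : 0 < ‖x‖ := by linarith
      rw [rpow_mul (by positivity), rpow_mul (by positivity),
        ← mul_rpow (by positivity) (by positivity)]
      congr 1
      rw [mul_rpow (by positivity) (by positivity), mul_rpow (by positivity) (by positivity),
        ← rpow_mul hxn.le, ← rpow_mul hxn.le, mul_mul_mul_comm, ← rpow_add hxn,
        ← rpow_add' (abs_nonneg _) (by simp), hc]
      simp only [add_sub_cancel, rpow_one]
      ring_nf
  simp only [i1, i2, i3] at hhol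
  refine (rpow_le_rpow hLn hhol (by positivity)).trans_eq ?_
  rw [mul_rpow (by positivity) (by positivity)]
  simp only [← rpow_mul hUn, ← rpow_mul hZn]
  congr 2 <;> field_simp
end

section
/- Let n ≥ 3, 2 ≤ p < n, and −∞ < α < (n−p)/p. Set δ₁ = n − p − αp − (n + pb)/p and δ₂ = n − p − αp − bp/(p−1) for an arbitrary b ∈ ℝ, and C_p = c_p · |(n(p−1) − pb)/p²|^p with c_p = min_{0<t≤1/2}((1−t)^p − t^p + pt^{p−1}). Then for every f ∈ C_0^∞(ℝ^n \ {0}), ∫_{ℝ^n} |∇f|^p/|x|^{αp} dx − ((n−p−αp)/p)^p ∫_{ℝ^n} |f|^p/|x|^{(α+1)p} dx ≥ C_p · (∫_{ℝ^n} |f|^p |x|^{δ₁} dx)^p / (∫_{ℝ^n} |f|^p |x|^{δ₂} dx)^{p−1}. -/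
open Real MeasureTheory Set

noncomputable def cpH (p : ℝ) : ℝ :=
  sInf ((fun t : ℝ => (1 - t) ^ p - t ^ p + p * t ^ (p - 1)) '' Ioc (0 : ℝ) (1 / 2))

lemma tangH {x y q : ℝ} (hx : 0 < x) (hy : 0 ≤ y) (hq : 1 ≤ q) :
    x ^ q + q * x ^ (q - 1) * (y - x) ≤ y ^ q := by
  have hs : -1 ≤ y / x - 1 := by
    have : 0 ≤ y / x := by positivity
    linarith
  have h := one_add_mul_self_le_rpow_one_add hs hq
  have h1 : 1 + (y / x - 1) = y / x := by ring
  rw [h1, div_rpow hy hx.le, le_div_iff₀ (by positivity)] at h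
  rw [rpow_sub_one hx.ne']
  refine le_trans (le_of_eq ?_) h
  field_simp

lemma elemA {p : ℝ} (hp : 2 ≤ p) {s : ℝ} (hs : 0 ≤ s) :
    1 ≤ (1 + s) ^ p - s ^ p - p * s ^ (p - 1) := by
  have hmono : MonotoneOn (fun s : ℝ => (1 + s) ^ p - s ^ p - p * s ^ (p - 1)) (Ici 0) := by
    refine monotoneOn_of_hasDerivWithinAt_nonneg (convex_Ici 0)
      (f' := fun s => 1 * p * (1 + s) ^ (p - 1) - p * s ^ (p - 1)
        - p * ((p - 1) * s ^ (p - 1 - 1))) ?_ ?_ ?_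
    · refine ContinuousOn.sub (ContinuousOn.sub ?_ ?_) ?_
      · exact (by fun_prop : ContinuousOn (fun s : ℝ => 1 + s) _).rpow_const
          (fun x _ => Or.inr (by linarith))
      · exact continuousOn_id.rpow_const (fun x _ => Or.inr (by linarith))
      · exact (continuousOn_id.rpow_const (fun x _ => Or.inr (by linarith))).const_mul _
    · intro x hx
      rw [interior_Ici, mem_Ioi] at hx
      refine HasDerivAt.hasDerivWithinAt ?_
      refine HasDerivAt.sub (HasDerivAt.sub ?_ ?_) ?_
      · exact ((hasDerivAt_id x).const_add 1).rpow_const (Or.inr (by linarith))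
      · exact hasDerivAt_rpow_const (Or.inr (by linarith))
      · exact (hasDerivAt_rpow_const (Or.inl hx.ne')).const_mul p
    · intro x hx
      rw [interior_Ici, mem_Ioi] at hx
      have := tangH (x := x) (y := 1 + x) (q := p - 1) hx (by linarith) (by linarith)
      nlinarith
  have := hmono (mem_Ici.2 le_rfl) (mem_Ici.2 hs) hs
  simp only [add_zero, one_rpow] at this
  rw [zero_rpow (by linarith), zero_rpow (by linarith)] at this
  linarith

lemma elemB {p : ℝ} (hp : 2 ≤ p) {s : ℝ} (hs : 1 ≤ s) :
    1 ≤ (s - 1) ^ p - s ^ p + p * s ^ (p - 1) := by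
  have hmono : MonotoneOn (fun s : ℝ => (s - 1) ^ p - s ^ p + p * s ^ (p - 1)) (Ici 1) := by
    refine monotoneOn_of_hasDerivWithinAt_nonneg (convex_Ici 1)
      (f' := fun s => 1 * p * (s - 1) ^ (p - 1) - p * s ^ (p - 1)
        + p * ((p - 1) * s ^ (p - 1 - 1))) ?_ ?_ ?_
    · refine ContinuousOn.add (ContinuousOn.sub ?_ ?_) ?_
      · exact (by fun_prop : ContinuousOn (fun s : ℝ => s - 1) _).rpow_const
          (fun x _ => Or.inr (by linarith))
      · exact continuousOn_id.rpow_const (fun x _ => Or.inr (by linarith))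
      · exact (continuousOn_id.rpow_const (fun x _ => Or.inr (by linarith))).const_mul _
    · intro x hx
      rw [interior_Ici, mem_Ioi] at hx
      refine HasDerivAt.hasDerivWithinAt ?_
      refine HasDerivAt.add (HasDerivAt.sub ?_ ?_) ?_
      · exact ((hasDerivAt_id x).sub_const 1).rpow_const (Or.inr (by linarith))
      · exact hasDerivAt_rpow_const (Or.inr (by linarith))
      · exact (hasDerivAt_rpow_const (Or.inl (by linarith))).const_mul p
    · intro x hx
      rw [interior_Ici, mem_Ioi] at hx
      have := tangH (x := x) (y := x - 1) (q := p - 1) (by linarith) (by linarith) (by linarith)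
      nlinarith
  have := hmono (mem_Ici.2 le_rfl) (mem_Ici.2 hs) hs
  simp only [sub_self, one_rpow] at this
  rw [zero_rpow (by linarith)] at this
  linarith

lemma elemC {p : ℝ} (hp : 2 ≤ p) {s : ℝ} (hs : 1 / 2 ≤ s) (hs1 : s ≤ 1) :
    (1 - 1 / 2 : ℝ) ^ p - (1 / 2 : ℝ) ^ p + p * (1 / 2 : ℝ) ^ (p - 1)
      ≤ (1 - s) ^ p - s ^ p + p * s ^ (p - 1) := by
  have hmono : MonotoneOn (fun s : ℝ => (1 - s) ^ p - s ^ p + p * s ^ (p - 1))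
      (Icc (1 / 2) 1) := by
    refine monotoneOn_of_hasDerivWithinAt_nonneg (convex_Icc _ _)
      (f' := fun s => -1 * p * (1 - s) ^ (p - 1) - p * s ^ (p - 1)
        + p * ((p - 1) * s ^ (p - 1 - 1))) ?_ ?_ ?_
    · refine ContinuousOn.add (ContinuousOn.sub ?_ ?_) ?_
      · exact (by fun_prop : ContinuousOn (fun s : ℝ => 1 - s) _).rpow_const
          (fun x _ => Or.inr (by linarith))
      · exact continuousOn_id.rpow_const (fun x _ => Or.inr (by linarith))
      · exact (continuousOn_id.rpow_const (fun x _ => Or.inr (by linarith))).const_mul _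
    · intro x hx
      rw [interior_Icc, mem_Ioo] at hx
      refine HasDerivAt.hasDerivWithinAt ?_
      refine HasDerivAt.add (HasDerivAt.sub ?_ ?_) ?_
      · exact ((hasDerivAt_id x).const_sub 1).rpow_const (Or.inr (by linarith))
      · exact hasDerivAt_rpow_const (Or.inr (by linarith))
      · exact (hasDerivAt_rpow_const (Or.inl (by linarith))).const_mul p
    · intro x hx
      rw [interior_Icc, mem_Ioo] at hx
      have hx0 : 0 < x := by linarith
      have hx1 : 0 < 1 - x := by linarith
      have e1 : x ^ (p - 1) = x ^ (p - 1 - 1) * x := by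
        rw [rpow_sub_one hx0.ne' (p - 1)]; field_simp
      have e2 : (1 - x) ^ (p - 1) = (1 - x) ^ (p - 1 - 1) * (1 - x) := by
        rw [rpow_sub_one hx1.ne' (p - 1)]; field_simp
      have e3 : (1 - x) ^ (p - 1 - 1) ≤ x ^ (p - 1 - 1) :=
        rpow_le_rpow hx1.le (by linarith) (by linarith)
      have e4 : 0 ≤ x ^ (p - 1 - 1) := by positivity
      rw [e1, e2]
      have : 0 ≤ (p - 1) * x ^ (p - 1 - 1) - x ^ (p - 1 - 1) * x
          - (1 - x) ^ (p - 1 - 1) * (1 - x) := by nlinarith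
      nlinarith
  exact hmono ⟨le_rfl, by norm_num⟩ ⟨hs, hs1⟩ hs

lemma nonnegH {p : ℝ} (hp : 2 ≤ p) {t : ℝ} (ht : t ∈ Ioc (0 : ℝ) (1 / 2)) :
    0 ≤ (1 - t) ^ p - t ^ p + p * t ^ (p - 1) := by
  have h1 : t ^ p ≤ (1 - t) ^ p := rpow_le_rpow ht.1.le (by linarith [ht.2]) (by linarith)
  have h2 : 0 ≤ t ^ (p - 1) := rpow_nonneg ht.1.le _
  nlinarith

lemma cpH_nonneg {p : ℝ} (hp : 2 ≤ p) : 0 ≤ cpH p := by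
  apply Real.sInf_nonneg
  rintro _ ⟨t, ht, rfl⟩
  exact nonnegH hp ht

lemma cpH_le {p : ℝ} (hp : 2 ≤ p) {t : ℝ} (ht : t ∈ Ioc (0 : ℝ) (1 / 2)) :
    cpH p ≤ (1 - t) ^ p - t ^ p + p * t ^ (p - 1) := by
  refine csInf_le ⟨0, ?_⟩ ⟨t, ht, rfl⟩
  rintro _ ⟨t, ht, rfl⟩
  exact nonnegH hp ht

lemma cpH_le_half {p : ℝ} (hp : 2 ≤ p) {s : ℝ} (hs : 1 / 2 ≤ s) (hs1 : s ≤ 1) :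
    cpH p ≤ (1 - s) ^ p - s ^ p + p * s ^ (p - 1) :=
  (cpH_le hp ⟨by norm_num, le_rfl⟩).trans (elemC hp hs hs1)

lemma cpH_le_one {p : ℝ} (hp : 2 ≤ p) : cpH p ≤ 1 := by
  refine (cpH_le hp (t := 1 / 2) ⟨by norm_num, le_rfl⟩).trans ?_
  have h := tangH (x := 1) (y := 2) (q := p - 1) (by norm_num) (by norm_num) (by linarith)
  simp only [one_rpow] at h
  have h2 : p ≤ (2 : ℝ) ^ (p - 1) := by linarith
  have h3 : (1 / 2 : ℝ) ^ (p - 1) = ((2 : ℝ) ^ (p - 1))⁻¹ := by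
    rw [one_div, inv_rpow (by norm_num)]
  have h4 : (1 - 1 / 2 : ℝ) = 1 / 2 := by norm_num
  rw [h4, h3, sub_self, zero_add, ← div_eq_mul_inv]
  exact div_le_one_of_le₀ h2 (by positivity)

lemma phiH {p : ℝ} (hp : 2 ≤ p) (t : ℝ) :
    cpH p ≤ |t - 1| ^ p - |t| ^ p + p * (|t| ^ (p - 2) * t) := by
  rcases lt_trichotomy t 0 with h | h | h
  · have := elemA hp (s := -t) (by linarith)
    have e : (-t) ^ (p - 1) = (-t) ^ (p - 2) * (-t) := by
      rw [show p - 1 = p - 2 + 1 by ring, rpow_add_one (by linarith)]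
    rw [abs_of_neg h, abs_of_neg (by linarith : t - 1 < 0)]
    rw [e] at this
    have e2 : -(t - 1) = 1 + -t := by ring
    rw [e2]
    linarith [cpH_le_one hp]
  · subst h
    simp only [zero_sub, abs_neg, abs_one, one_rpow, abs_zero, mul_zero]
    rw [zero_rpow (by linarith)]
    linarith [cpH_le_one hp]
  · have e : |t| ^ (p - 2) * t = t ^ (p - 1) := by
      rw [abs_of_pos h, show p - 1 = p - 2 + 1 by ring, rpow_add_one (by linarith)]
    rw [e, abs_of_pos h]
    rcases le_total t 1 with h1 | h1
    · rw [abs_sub_comm, abs_of_nonneg (by linarith : 0 ≤ 1 - t)]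
      rcases le_total t (1 / 2) with h2 | h2
      · exact cpH_le hp ⟨h, h2⟩
      · exact cpH_le_half hp h2 h1
    · rw [abs_of_nonneg (by linarith : 0 ≤ t - 1)]
      exact (cpH_le_one hp).trans (elemB hp h1)

lemma keyH {p : ℝ} (hp : 2 ≤ p) (a b : ℝ) :
    |a| ^ p - p * (|a| ^ (p - 2) * a * b) + cpH p * |b| ^ p ≤ |a - b| ^ p := by
  by_cases hb : b = 0
  · subst hb
    simp [zero_rpow (by linarith : p ≠ 0)]
  have h := phiH hp (a / b)
  have hb' : 0 < |b| := abs_pos.2 hb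
  have e1 : |a / b - 1| = |a - b| / |b| := by rw [← abs_div]; congr 1; field_simp
  rw [e1, abs_div, div_rpow (abs_nonneg _) hb'.le, div_rpow (abs_nonneg _) hb'.le,
    div_rpow (abs_nonneg _) hb'.le] at h
  have e2 : |b| ^ p = |b| ^ (p - 2) * b ^ 2 := by
    rw [← sq_abs b, ← rpow_natCast, ← rpow_add hb']; congr 1; push_cast; ring
  have hB : 0 < |b| ^ p := by positivity
  have hB2 : 0 < |b| ^ (p - 2) := by positivity
  have h' := mul_le_mul_of_nonneg_right h hB.le
  have e3 : (|a - b| ^ p / |b| ^ p - |a| ^ p / |b| ^ p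
      + p * (|a| ^ (p - 2) / |b| ^ (p - 2) * (a / b))) * |b| ^ p
      = |a - b| ^ p - |a| ^ p + p * (|a| ^ (p - 2) * a * b) := by
    have : p * (|a| ^ (p - 2) / |b| ^ (p - 2) * (a / b)) * |b| ^ p
        = p * (|a| ^ (p - 2) * a * b) := by
      rw [e2]; field_simp
    rw [add_mul, this]
    field_simp
  rw [e3] at h'
  linarith

section helpers

variable {n : ℕ} {f : EuclideanSpace ℝ (Fin n) → ℝ}

lemma contH (h0 : (0 : EuclideanSpace ℝ (Fin n)) ∉ tsupport f)
    {u : EuclideanSpace ℝ (Fin n) → ℝ} (hu : Continuous u)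
    (hz : ∀ x, x ∉ tsupport f → u x = 0) (w : ℝ) :
    Continuous (fun x => u x * ‖x‖ ^ w) := by
  rw [continuous_iff_continuousAt]
  intro x
  by_cases hx : x = 0
  · subst hx
    have hev : (fun x => u x * ‖x‖ ^ w) =ᶠ[nhds 0] fun _ => (0 : ℝ) := by
      filter_upwards [(isClosed_tsupport f).isOpen_compl.mem_nhds h0] with y hy
      rw [hz y hy, zero_mul]
    exact continuousAt_const.congr hev.symm
  · exact hu.continuousAt.mul
      (continuous_norm.continuousAt.rpow_const (Or.inl (norm_ne_zero_iff.2 hx)))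

lemma cptH (hs : HasCompactSupport f)
    {u : EuclideanSpace ℝ (Fin n) → ℝ}
    (hz : ∀ x, x ∉ tsupport f → u x = 0) (w : ℝ) :
    HasCompactSupport (fun x => u x * ‖x‖ ^ w) :=
  HasCompactSupport.intro hs.isCompact (fun x hx => by simp [hz x hx])

lemma intH (hs : HasCompactSupport f) (h0 : (0 : EuclideanSpace ℝ (Fin n)) ∉ tsupport f)
    {u : EuclideanSpace ℝ (Fin n) → ℝ} (hu : Continuous u)
    (hz : ∀ x, x ∉ tsupport f → u x = 0) (w : ℝ) :
    Integrable (fun x => u x * ‖x‖ ^ w) :=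
  (contH h0 hu hz w).integrable_of_hasCompactSupport (cptH hs hz w)

lemma divH {h : EuclideanSpace ℝ (Fin n) → ℝ} (hc : ContDiff ℝ 1 h) (hs : HasCompactSupport h) :
    ∫ x, fderiv ℝ h x x = -(n : ℝ) * ∫ x, h x := by
  have hd : Continuous (fderiv ℝ h) := hc.continuous_fderiv one_ne_zero
  have hint : ∀ i : Fin n, Integrable (fun x : EuclideanSpace ℝ (Fin n) =>
      x i * fderiv ℝ h x (EuclideanSpace.single i (1 : ℝ))) := by
    intro i
    refine Continuous.integrable_of_hasCompactSupport ?_ ?_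
    · exact (EuclideanSpace.proj i : EuclideanSpace ℝ (Fin n) →L[ℝ] ℝ).continuous.mul
        (hd.clm_apply continuous_const)
    · refine HasCompactSupport.intro hs.isCompact (fun x hx => ?_)
      simp [fderiv_of_notMem_tsupport ℝ hx]
  have hi : ∀ i : Fin n, ∫ x : EuclideanSpace ℝ (Fin n),
      x i * fderiv ℝ h x (EuclideanSpace.single i (1 : ℝ)) = - ∫ x, h x := by
    intro i
    have hfd : ∀ x : EuclideanSpace ℝ (Fin n),
        fderiv ℝ (fun x : EuclideanSpace ℝ (Fin n) => x i) x (EuclideanSpace.single i (1 : ℝ))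
          = 1 := by
      intro x
      have : HasFDerivAt (fun x : EuclideanSpace ℝ (Fin n) => x i)
          (EuclideanSpace.proj i : EuclideanSpace ℝ (Fin n) →L[ℝ] ℝ) x :=
        (EuclideanSpace.proj i : EuclideanSpace ℝ (Fin n) →L[ℝ] ℝ).hasFDerivAt
      rw [this.fderiv]
      simp
    have := integral_mul_fderiv_eq_neg_fderiv_mul_of_integrable (μ := volume)
      (f := fun x : EuclideanSpace ℝ (Fin n) => x i) (g := h)
      (v := EuclideanSpace.single i (1 : ℝ)) ?_ (hint i) ?_ ?_ ?_
    · rw [this]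
      simp only [hfd, one_mul]
    · simp only [hfd, one_mul]
      exact hc.continuous.integrable_of_hasCompactSupport hs
    · refine Continuous.integrable_of_hasCompactSupport ?_ hs.mul_left
      exact (EuclideanSpace.proj i : EuclideanSpace ℝ (Fin n) →L[ℝ] ℝ).continuous.mul
        hc.continuous
    · intro x _
      exact (EuclideanSpace.proj i : EuclideanSpace ℝ (Fin n) →L[ℝ] ℝ).differentiableAt
    · intro x _
      exact (hc.differentiable one_ne_zero) x
  have hsum : ∀ x : EuclideanSpace ℝ (Fin n), fderiv ℝ h x x
      = ∑ i, x i * fderiv ℝ h x (EuclideanSpace.single i (1 : ℝ)) := by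
    intro x
    have hx : x = ∑ i, x i • EuclideanSpace.single i (1 : ℝ) := by
      have := (EuclideanSpace.basisFun (Fin n) ℝ).sum_repr x
      simpa using this.symm
    have h2 := congrArg (fderiv ℝ h x) hx
    rw [map_sum] at h2
    simpa using h2
  simp_rw [hsum]
  rw [integral_finsetSum _ (fun i _ => hint i)]
  simp [hi]

lemma ibpH {p : ℝ} (hp : 2 ≤ p) (hf : ContDiff ℝ 1 f) (hs : HasCompactSupport f)
    (h0 : (0 : EuclideanSpace ℝ (Fin n)) ∉ tsupport f) (H w : ℝ) :
    ∫ x, (|f x| ^ (p - 2) * f x * (fderiv ℝ f x x + H * f x)) * ‖x‖ ^ w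
      = (H - (n + w) / p) * ∫ x, |f x| ^ p * ‖x‖ ^ w := by
  have hfz : ∀ x, x ∉ tsupport f → f x = 0 := fun x hx => image_eq_zero_of_notMem_tsupport hx
  have hp0 : p ≠ 0 := by linarith
  have hz : ∀ x, x ∉ tsupport f → |f x| ^ p = 0 := fun x hx => by
    simp [hfz x hx, zero_rpow hp0]
  have hcf : ContDiff ℝ 1 (fun x => |f x| ^ p) := by
    have := hf.norm_rpow (p := p) (by linarith)
    simpa using this
  have hcd : Continuous (fun x => fderiv ℝ f x x) :=
    (hf.continuous_fderiv one_ne_zero).clm_apply continuous_id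
  have hcp2 : Continuous (fun x => |f x| ^ (p - 2)) :=
    hf.continuous.abs.rpow_const (fun x => Or.inr (by linarith))
  have hne : ∀ x, x ∈ tsupport f → x ≠ 0 := fun x hx h => h0 (h ▸ hx)
  have hC : ContDiff ℝ 1 (fun x => |f x| ^ p * ‖x‖ ^ w) := by
    rw [contDiff_iff_contDiffAt]
    intro x
    by_cases hx : x ∈ tsupport f
    · refine hcf.contDiffAt.mul ?_
      exact (contDiffAt_norm ℝ (hne x hx)).rpow_const_of_ne (norm_ne_zero_iff.2 (hne x hx))
    · have hev : (fun x => |f x| ^ p * ‖x‖ ^ w) =ᶠ[nhds x] fun _ => (0 : ℝ) := by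
        filter_upwards [(isClosed_tsupport f).isOpen_compl.mem_nhds hx] with y hy
        rw [hz y hy, zero_mul]
      exact contDiffAt_const.congr_of_eventuallyEq hev
  have hdiv := divH hC (cptH hs hz w)
  have hval : ∀ x, fderiv ℝ (fun x => |f x| ^ p * ‖x‖ ^ w) x x
      = p * ((|f x| ^ (p - 2) * f x * fderiv ℝ f x x) * ‖x‖ ^ w)
        + w * (|f x| ^ p * ‖x‖ ^ w) := by
    intro x
    by_cases hx : x ∈ tsupport f
    · have hx0 := norm_ne_zero_iff.2 (hne x hx)
      have hxp : 0 < ‖x‖ := norm_pos_iff.2 (hne x hx)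
      have d1 : HasFDerivAt (fun x => |f x| ^ p)
          ((p * |f x| ^ (p - 2) * f x) • fderiv ℝ f x) x :=
        (hasDerivAt_abs_rpow (f x) (by linarith)).comp_hasFDerivAt x
          ((hf.differentiable one_ne_zero) x).hasFDerivAt
      have dn : DifferentiableAt ℝ (fun x : EuclideanSpace ℝ (Fin n) => ‖x‖) x :=
        (contDiffAt_norm ℝ (n := 1) (hne x hx)).differentiableAt one_ne_zero
      have d2 : HasFDerivAt (fun x : EuclideanSpace ℝ (Fin n) => ‖x‖ ^ w)
          ((w * ‖x‖ ^ (w - 1)) • fderiv ℝ (fun x : EuclideanSpace ℝ (Fin n) => ‖x‖) x) x :=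
        (Real.hasDerivAt_rpow_const (Or.inl hx0)).comp_hasFDerivAt x dn.hasFDerivAt
      have d3 : HasFDerivAt (fun x => |f x| ^ p * ‖x‖ ^ w) _ x := d1.mul d2
      rw [d3.fderiv]
      have := dn.fderiv_norm_self
      simp only [ContinuousLinearMap.add_apply, ContinuousLinearMap.smul_apply, smul_eq_mul, this]
      rw [rpow_sub_one hx0]
      field_simp
      ring
    · have : x ∉ tsupport (fun x => |f x| ^ p * ‖x‖ ^ w) := by
        intro h
        refine hx (closure_mono ?_ h)
        intro y hy hfy
        exact hy (by simp [hfy, zero_rpow hp0])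
      rw [fderiv_of_notMem_tsupport ℝ this]
      simp [hfz x hx, zero_rpow hp0]
  have i1 : Integrable (fun x => (|f x| ^ (p - 2) * f x * fderiv ℝ f x x) * ‖x‖ ^ w) :=
    intH hs h0 ((hcp2.mul hf.continuous).mul hcd) (fun x hx => by simp [hfz x hx]) w
  have i2 : Integrable (fun x => |f x| ^ p * ‖x‖ ^ w) := intH hs h0 hcf.continuous hz w
  simp_rw [hval] at hdiv
  rw [integral_add (i1.const_mul _) (i2.const_mul _), integral_const_mul, integral_const_mul]
    at hdiv
  have hsq : ∀ x, |f x| ^ (p - 2) * f x * f x = |f x| ^ p := by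
    intro x
    by_cases hx : f x = 0
    · simp [hx, zero_rpow hp0]
    · rw [mul_assoc, ← sq, ← sq_abs, ← rpow_natCast, ← rpow_add (abs_pos.2 hx)]
      congr 1; push_cast; ring
  have hpt : ∀ x, (|f x| ^ (p - 2) * f x * (fderiv ℝ f x x + H * f x)) * ‖x‖ ^ w
      = (|f x| ^ (p - 2) * f x * fderiv ℝ f x x) * ‖x‖ ^ w + H * (|f x| ^ p * ‖x‖ ^ w) := by
    intro x
    rw [← hsq x]; ring
  simp_rw [hpt]
  rw [integral_add i1 (i2.const_mul _), integral_const_mul]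
  field_simp
  linarith

lemma coreH {p α H w : ℝ} (hp : 2 ≤ p) (hf : ContDiff ℝ 1 f) (hs : HasCompactSupport f)
    (h0 : (0 : EuclideanSpace ℝ (Fin n)) ∉ tsupport f) (hH : 0 < H) (hw : w = -((α + 1) * p))
    (hHw : H = (n + w) / p) :
    H ^ p * (∫ x, |f x| ^ p * ‖x‖ ^ w)
      + cpH p * (∫ x, |fderiv ℝ f x x + H * f x| ^ p * ‖x‖ ^ w)
      ≤ ∫ x, ‖fderiv ℝ f x‖ ^ p * ‖x‖ ^ (-(α * p)) := by
  have hfz : ∀ x, x ∉ tsupport f → f x = 0 := fun x hx => image_eq_zero_of_notMem_tsupport hx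
  have hdz : ∀ x, x ∉ tsupport f → fderiv ℝ f x = 0 := fun x hx => fderiv_of_notMem_tsupport ℝ hx
  have hp0 : p ≠ 0 := by linarith
  have hcd0 := hf.continuous_fderiv one_ne_zero
  have hcd : Continuous (fun x => fderiv ℝ f x x) := hcd0.clm_apply continuous_id
  have hcG : Continuous (fun x => fderiv ℝ f x x + H * f x) :=
    hcd.add (continuous_const.mul hf.continuous)
  have hcp2 : Continuous (fun x => |f x| ^ (p - 2)) :=
    hf.continuous.abs.rpow_const (fun x => Or.inr (by linarith))
  have i1 : Integrable (fun x => |f x| ^ p * ‖x‖ ^ w) :=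
    intH hs h0 (hf.continuous.abs.rpow_const (fun x => Or.inr (by linarith)))
      (fun x hx => by simp [hfz x hx, zero_rpow hp0]) w
  have i2 : Integrable
      (fun x => (|f x| ^ (p - 2) * f x * (fderiv ℝ f x x + H * f x)) * ‖x‖ ^ w) :=
    intH hs h0 ((hcp2.mul hf.continuous).mul hcG) (fun x hx => by simp [hfz x hx]) w
  have i3 : Integrable (fun x => |fderiv ℝ f x x + H * f x| ^ p * ‖x‖ ^ w) :=
    intH hs h0 (hcG.abs.rpow_const (fun x => Or.inr (by linarith)))
      (fun x hx => by simp [hfz x hx, hdz x hx, zero_rpow hp0]) w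
  have i4 : Integrable (fun x => ‖fderiv ℝ f x‖ ^ p * ‖x‖ ^ (-(α * p))) :=
    intH hs h0 (hcd0.norm.rpow_const (fun x => Or.inr (by linarith)))
      (fun x hx => by simp [hdz x hx, zero_rpow hp0]) _
  have hcross := ibpH hp hf hs h0 H w
  rw [← hHw, sub_self, zero_mul] at hcross
  have hpt : ∀ x, H ^ p * (|f x| ^ p * ‖x‖ ^ w)
      + cpH p * (|fderiv ℝ f x x + H * f x| ^ p * ‖x‖ ^ w)
      - p * (H ^ (p - 2) * H) *
        ((|f x| ^ (p - 2) * f x * (fderiv ℝ f x x + H * f x)) * ‖x‖ ^ w)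
      ≤ ‖fderiv ℝ f x‖ ^ p * ‖x‖ ^ (-(α * p)) := by
    intro x
    by_cases hx : x ∈ tsupport f
    · have hx0 : 0 < ‖x‖ := norm_pos_iff.2 (fun h => h0 (h ▸ hx))
      have hk := keyH hp (H * f x) (fderiv ℝ f x x + H * f x)
      rw [abs_mul, abs_of_pos hH, mul_rpow hH.le (abs_nonneg _),
        mul_rpow hH.le (abs_nonneg _)] at hk
      have e1 : H * f x - (fderiv ℝ f x x + H * f x) = -(fderiv ℝ f x x) := by ring
      rw [e1, abs_neg] at hk
      have hle : |fderiv ℝ f x x| ^ p ≤ ‖fderiv ℝ f x‖ ^ p * ‖x‖ ^ p := by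
        rw [← mul_rpow (norm_nonneg _) (norm_nonneg _)]
        exact rpow_le_rpow (abs_nonneg _) ((fderiv ℝ f x).le_opNorm x) (by linarith)
      have e2 : ‖x‖ ^ (-(α * p)) = ‖x‖ ^ p * ‖x‖ ^ w := by
        rw [← rpow_add hx0, hw]; congr 1; ring
      rw [e2, ← mul_assoc (‖fderiv ℝ f x‖ ^ p)]
      have := mul_le_mul_of_nonneg_right (hk.trans hle) (rpow_nonneg hx0.le w)
      refine le_trans (le_of_eq ?_) this
      ring
    · simp [hfz x hx, hdz x hx, zero_rpow hp0]
  have := integral_mono (((i1.const_mul _).add (i3.const_mul _)).sub (i2.const_mul _)) i4 hpt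
  rw [integral_sub' ((i1.const_mul _).add (i3.const_mul _)) (i2.const_mul _),
    integral_add' (i1.const_mul _) (i3.const_mul _), integral_const_mul, integral_const_mul,
    integral_const_mul, hcross, mul_zero, sub_zero] at this
  exact this

lemma holderH {p H w δ₁ δ₂ : ℝ} (hp : 2 ≤ p) (hf : ContDiff ℝ 1 f) (hs : HasCompactSupport f)
    (h0 : (0 : EuclideanSpace ℝ (Fin n)) ∉ tsupport f)
    (hδ : (δ₁ - w / p) * p = δ₂ * (p - 1)) :
    |H - (n + δ₁) / p| ^ p * (∫ x, |f x| ^ p * ‖x‖ ^ δ₁) ^ p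
      ≤ (∫ x, |fderiv ℝ f x x + H * f x| ^ p * ‖x‖ ^ w)
        * (∫ x, |f x| ^ p * ‖x‖ ^ δ₂) ^ (p - 1) := by
  have hfz : ∀ x, x ∉ tsupport f → f x = 0 := fun x hx => image_eq_zero_of_notMem_tsupport hx
  have hdz : ∀ x, x ∉ tsupport f → fderiv ℝ f x = 0 := fun x hx => fderiv_of_notMem_tsupport ℝ hx
  have hp0 : p ≠ 0 := by linarith
  have hp1 : p - 1 ≠ 0 := by linarith
  have hcd0 := hf.continuous_fderiv one_ne_zero
  have hcd : Continuous (fun x => fderiv ℝ f x x) := hcd0.clm_apply continuous_id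
  have hcG : Continuous (fun x => fderiv ℝ f x x + H * f x) :=
    hcd.add (continuous_const.mul hf.continuous)
  have hcp1 : Continuous (fun x => |f x| ^ (p - 1)) :=
    hf.continuous.abs.rpow_const (fun x => Or.inr (by linarith))
  have hA : 0 ≤ ∫ x, |fderiv ℝ f x x + H * f x| ^ p * ‖x‖ ^ w :=
    integral_nonneg (fun x => by positivity)
  have hB : 0 ≤ ∫ x, |f x| ^ p * ‖x‖ ^ δ₂ := integral_nonneg (fun x => by positivity)
  have hD : 0 ≤ ∫ x, |f x| ^ p * ‖x‖ ^ δ₁ := integral_nonneg (fun x => by positivity)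
  have hpq : p.HolderConjugate (p / (p - 1)) := Real.HolderConjugate.conjExponent (by linarith)
  have z1 : ∀ x, x ∉ tsupport f → |fderiv ℝ f x x + H * f x| = 0 := fun x hx => by
    simp [hfz x hx, hdz x hx]
  have z2 : ∀ x, x ∉ tsupport f → |f x| ^ (p - 1) = 0 := fun x hx => by
    simp [hfz x hx, zero_rpow hp1]
  have hhol := integral_mul_le_Lp_mul_Lq_of_nonneg (μ := volume) hpq
    (f := fun x => |fderiv ℝ f x x + H * f x| * ‖x‖ ^ (w / p))
    (g := fun x => |f x| ^ (p - 1) * ‖x‖ ^ (δ₁ - w / p))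
    (Filter.Eventually.of_forall (fun x => by simp only [Pi.zero_apply]; positivity))
    (Filter.Eventually.of_forall (fun x => by simp only [Pi.zero_apply]; positivity))
    ((contH h0 hcG.abs z1 _).memLp_of_hasCompactSupport (cptH hs z1 _))
    ((contH h0 hcp1 z2 _).memLp_of_hasCompactSupport (cptH hs z2 _))
  have e1 : ∀ x : EuclideanSpace ℝ (Fin n), (|fderiv ℝ f x x + H * f x| * ‖x‖ ^ (w / p)) ^ p
      = |fderiv ℝ f x x + H * f x| ^ p * ‖x‖ ^ w := by
    intro x
    rw [mul_rpow (abs_nonneg _) (by positivity), ← rpow_mul (norm_nonneg _)]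
    congr 2; field_simp
  have e2 : ∀ x : EuclideanSpace ℝ (Fin n),
      (|f x| ^ (p - 1) * ‖x‖ ^ (δ₁ - w / p)) ^ (p / (p - 1)) = |f x| ^ p * ‖x‖ ^ δ₂ := by
    intro x
    rw [mul_rpow (by positivity) (by positivity), ← rpow_mul (norm_nonneg _),
      ← rpow_mul (abs_nonneg _)]
    congr 2
    · field_simp
    · rw [← mul_div_assoc, hδ]; field_simp
  simp_rw [e1, e2] at hhol
  have e3 : ∀ x : EuclideanSpace ℝ (Fin n),
      ‖(|f x| ^ (p - 2) * f x * (fderiv ℝ f x x + H * f x)) * ‖x‖ ^ δ₁‖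
      = |fderiv ℝ f x x + H * f x| * ‖x‖ ^ (w / p)
          * (|f x| ^ (p - 1) * ‖x‖ ^ (δ₁ - w / p)) := by
    intro x
    by_cases hx : x ∈ tsupport f
    · have hx0 : 0 < ‖x‖ := norm_pos_iff.2 (fun h => h0 (h ▸ hx))
      have e4 : ‖x‖ ^ δ₁ = ‖x‖ ^ (w / p) * ‖x‖ ^ (δ₁ - w / p) := by
        rw [← rpow_add hx0]; congr 1; ring
      have e5 : |f x| ^ (p - 1) = |f x| ^ (p - 2) * |f x| := by
        by_cases hfx : f x = 0
        · simp [hfx, zero_rpow hp1]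
        · rw [show p - 1 = p - 2 + 1 by ring, rpow_add_one (abs_ne_zero.2 hfx)]
      rw [norm_eq_abs, abs_mul, abs_mul, abs_mul, abs_of_nonneg (rpow_nonneg (abs_nonneg _) _),
        abs_of_nonneg (rpow_nonneg hx0.le _), e4, e5]
      ring
    · simp [hfz x hx, zero_rpow hp1]
  have hn := norm_integral_le_integral_norm (μ := volume)
    (fun x => (|f x| ^ (p - 2) * f x * (fderiv ℝ f x x + H * f x)) * ‖x‖ ^ δ₁)
  simp_rw [e3] at hn
  rw [ibpH hp hf hs h0 H δ₁, norm_eq_abs, abs_mul, abs_of_nonneg hD] at hn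
  have hfin := rpow_le_rpow (by positivity) (hn.trans hhol) (by linarith : 0 ≤ p)
  rw [mul_rpow (abs_nonneg _) hD, mul_rpow (by positivity) (by positivity), ← rpow_mul hA,
    ← rpow_mul hB] at hfin
  have a1 : 1 / p * p = 1 := by field_simp
  have a2 : 1 / (p / (p - 1)) * p = p - 1 := by field_simp
  rwa [a1, a2, rpow_one] at hfin

end helpers

theorem stmt_7 (n : ℕ) (hn : 3 ≤ n) (p α b δ₁ δ₂ : ℝ) (hp2 : 2 ≤ p) (hpn : p < n)
    (hα : α < ((n : ℝ) - p) / p)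
    (hδ₁ : δ₁ = (n : ℝ) - p - α * p - ((n : ℝ) + p * b) / p)
    (hδ₂ : δ₂ = (n : ℝ) - p - α * p - b * p / (p - 1))
    (f : EuclideanSpace ℝ (Fin n) → ℝ) (hf : ContDiff ℝ (⊤ : ℕ∞) f) (hsupp : HasCompactSupport f)
    (h0 : ∃ ε > (0 : ℝ), ∀ x : EuclideanSpace ℝ (Fin n), ‖x‖ < ε → f x = 0) :
    (∫ x : EuclideanSpace ℝ (Fin n), ‖fderiv ℝ f x‖ ^ p / ‖x‖ ^ (α * p)) -
        (((n : ℝ) - p - α * p) / p) ^ p *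
          ∫ x : EuclideanSpace ℝ (Fin n), |f x| ^ p / ‖x‖ ^ ((α + 1) * p) ≥
      (sInf ((fun t : ℝ => (1 - t) ^ p - t ^ p + p * t ^ (p - 1)) '' Ioc (0 : ℝ) (1 / 2)) *
          |((n : ℝ) * (p - 1) - p * b) / p ^ (2 : ℕ)| ^ p) *
        (∫ x : EuclideanSpace ℝ (Fin n), |f x| ^ p * ‖x‖ ^ δ₁) ^ p /
        (∫ x : EuclideanSpace ℝ (Fin n), |f x| ^ p * ‖x‖ ^ δ₂) ^ (p - 1) := by
  have hp0 : 0 < p := by linarith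
  have hp1 : p - 1 ≠ 0 := by linarith
  have h0' : (0 : EuclideanSpace ℝ (Fin n)) ∉ tsupport f := by
    obtain ⟨ε, hε, h⟩ := h0
    rw [notMem_tsupport_iff_eventuallyEq]
    filter_upwards [Metric.ball_mem_nhds (0 : EuclideanSpace ℝ (Fin n)) hε] with x hx
    exact h x (by simpa using hx)
  have hf1 : ContDiff ℝ 1 f := hf.of_le (by exact_mod_cast le_top)
  have hH : 0 < ((n : ℝ) - p - α * p) / p := by
    rw [lt_div_iff₀ hp0] at hα
    exact div_pos (by linarith) hp0
  have hcore := coreH (α := α) (w := -((α + 1) * p)) hp2 hf1 hsupp h0' hH rfl (by ring)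
  have hhol := holderH (H := ((n : ℝ) - p - α * p) / p) (w := -((α + 1) * p))
    (δ₁ := δ₁) (δ₂ := δ₂) hp2 hf1 hsupp h0' (by
      rw [hδ₁, hδ₂]; field_simp; ring)
  have hK : ((n : ℝ) - p - α * p) / p - ((n : ℝ) + δ₁) / p
      = -(((n : ℝ) * (p - 1) - p * b) / p ^ (2 : ℕ)) := by
    rw [hδ₁]; field_simp; ring
  rw [hK, abs_neg] at hhol
  have hA : 0 ≤ ∫ x, |fderiv ℝ f x x + ((n : ℝ) - p - α * p) / p * f x| ^ p
      * ‖x‖ ^ (-((α + 1) * p)) := integral_nonneg (fun x => by positivity)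
  have hB : 0 ≤ ∫ x, |f x| ^ p * ‖x‖ ^ δ₂ := integral_nonneg (fun x => by positivity)
  have hc := cpH_nonneg hp2
  have hr : ∀ (x : EuclideanSpace ℝ (Fin n)) (a c : ℝ), a / ‖x‖ ^ c = a * ‖x‖ ^ (-c) := by
    intro x a c
    rw [rpow_neg (norm_nonneg _), div_eq_mul_inv]
  simp_rw [hr]
  change _ ≥ (cpH p * _) * _ / _
  refine le_trans ?_ (le_sub_iff_add_le'.2 hcore)
  rw [mul_assoc, mul_div_assoc]
  refine mul_le_mul_of_nonneg_left ?_ hc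
  exact div_le_of_le_mul₀ (rpow_nonneg hB _) hA hhol
end

section
/- Let n ≥ 1, 1 < γ < ∞, and max{1, γ−1} < p < ∞. Then for every f ∈ C_0^∞(ℝ^n \ {0}) and every R > 0, ‖(f − f_R)/(|x|^{n/p} |log(R/|x|)|^{γ/p})‖_{L^p(ℝ^n)} ≤ (p/(γ−1)) · ‖(x/|x| · ∇f)/(|x|^{(n−p)/p} |log(R/|x|)|^{(γ−p)/p})‖_{L^p(ℝ^n)}, where f_R(x) = f(R x/|x|). -/
open Real MeasureTheory

section Aux
open Set ENNReal

lemma lint_Ioo_rpow {σ t : ℝ} (hσ : 0 < σ) (ht : 0 < t) :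
    ∫⁻ s in Ioo 0 t, ENNReal.ofReal (s ^ (σ - 1)) = ENNReal.ofReal (t ^ σ / σ) := by
  have hi : IntervalIntegrable (fun s : ℝ => s ^ (σ - 1)) volume 0 t :=
    intervalIntegral.intervalIntegrable_rpow' (by linarith)
  rw [Measure.restrict_congr_set Ioo_ae_eq_Ioc, ← ofReal_integral_eq_lintegral_ofReal hi.1,
    ← intervalIntegral.integral_of_le ht.le, integral_rpow (Or.inl (by linarith))]
  · simp [hσ.ne']
  · filter_upwards [ae_restrict_mem measurableSet_Ioc] with y hy
    exact rpow_nonneg hy.1.le _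

lemma lint_Ioi_rpow {σ s : ℝ} (hσ : 0 < σ) (hs : 0 < s) :
    ∫⁻ t in Ioi s, ENNReal.ofReal (t ^ (-σ - 1)) = ENNReal.ofReal (s ^ (-σ) / σ) := by
  rw [← ofReal_integral_eq_lintegral_ofReal (integrableOn_Ioi_rpow_of_lt (by linarith) hs),
    integral_Ioi_rpow_of_lt (by linarith) hs]
  · simp [neg_div, div_neg]
  · filter_upwards [ae_restrict_mem measurableSet_Ioi] with y hy
    exact rpow_nonneg (hs.trans hy).le _

lemma hardy_step {p σ t : ℝ} (hp : 1 < p) (hσ : 0 < σ) (ht : 0 < t) (k : ℝ → ℝ≥0∞)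
    (hk : Measurable k) :
    (∫⁻ s in Ioo 0 t, k s) ^ p ≤
      (∫⁻ s in Ioo 0 t, k s ^ p * ENNReal.ofReal (s ^ ((1 - σ) * (p - 1)))) *
        ENNReal.ofReal ((t ^ σ / σ) ^ (p - 1)) := by
  have hp0 : 0 < p := by linarith
  have hpq : p.HolderConjugate (p / (p - 1)) := Real.HolderConjugate.conjExponent hp
  set a : ℝ := (1 - σ) * (p - 1) / p with ha
  have key := ENNReal.lintegral_mul_le_Lp_mul_Lq (volume.restrict (Ioo 0 t)) hpq
    (f := fun s => k s * ENNReal.ofReal (s ^ a)) (g := fun s => ENNReal.ofReal (s ^ (-a)))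
    (by fun_prop) (by fun_prop)
  have e1 : ∫⁻ s in Ioo 0 t, k s = ∫⁻ s in Ioo 0 t,
      ((fun s => k s * ENNReal.ofReal (s ^ a)) * (fun s => ENNReal.ofReal (s ^ (-a)))) s := by
    refine setLIntegral_congr_fun measurableSet_Ioo fun s hs => ?_
    have := hs.1
    simp only [Pi.mul_apply]
    rw [mul_assoc, ← ENNReal.ofReal_mul (by positivity), ← rpow_add hs.1]
    simp
  have e2 : ∫⁻ s in Ioo 0 t, (k s * ENNReal.ofReal (s ^ a)) ^ p =
      ∫⁻ s in Ioo 0 t, k s ^ p * ENNReal.ofReal (s ^ ((1 - σ) * (p - 1))) := by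
    refine setLIntegral_congr_fun measurableSet_Ioo fun s hs => ?_
    have := hs.1
    rw [ENNReal.mul_rpow_of_nonneg _ _ hp0.le, ENNReal.ofReal_rpow_of_nonneg (by positivity) hp0.le,
      ← rpow_mul this.le]
    congr 3
    rw [ha]; field_simp
  have e3 : ∫⁻ s in Ioo 0 t, (ENNReal.ofReal (s ^ (-a))) ^ (p / (p - 1)) =
      ENNReal.ofReal (t ^ σ / σ) := by
    rw [← lint_Ioo_rpow hσ ht]
    refine setLIntegral_congr_fun measurableSet_Ioo fun s hs => ?_
    have := hs.1
    rw [ENNReal.ofReal_rpow_of_nonneg (by positivity) (by have := hpq.symm.pos; exact this.le),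
      ← rpow_mul this.le]
    congr 2
    have : p - 1 ≠ 0 := by linarith
    rw [ha]; field_simp; ring
  rw [← e1, e2, e3] at key
  refine (ENNReal.rpow_le_rpow key hp0.le).trans ?_
  rw [ENNReal.mul_rpow_of_nonneg _ _ hp0.le, ← ENNReal.rpow_mul, ← ENNReal.rpow_mul,
    one_div_mul_cancel hp0.ne', ENNReal.rpow_one,
    ENNReal.ofReal_rpow_of_nonneg (by positivity) (by have : 0 < p - 1 := by linarith
                                                      positivity)]
  apply le_of_eq
  congr 3
  field_simp

lemma hardy {p γ : ℝ} (hp : 1 < p) (hγ : 1 < γ) (k : ℝ → ℝ≥0∞) (hk : Measurable k) :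
    ∫⁻ t in Ioi 0, (∫⁻ s in Ioo 0 t, k s) ^ p * ENNReal.ofReal (t ^ (-γ)) ≤
      ENNReal.ofReal ((p / (γ - 1)) ^ p) *
        ∫⁻ s in Ioi 0, k s ^ p * ENNReal.ofReal (s ^ (p - γ)) := by
  have hp0 : 0 < p := by linarith
  set σ := (γ - 1) / p with hσd
  have hσ : 0 < σ := div_pos (by linarith) hp0
  have hσp : σ * p = γ - 1 := by rw [hσd]; field_simp
  set w : ℝ → ℝ≥0∞ := fun s => k s ^ p * ENNReal.ofReal (s ^ ((1 - σ) * (p - 1))) with hw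
  have hwm : Measurable w := by fun_prop
  set v : ℝ → ℝ≥0∞ := fun t => ENNReal.ofReal (σ⁻¹ ^ (p - 1)) * ENNReal.ofReal (t ^ (-σ - 1)) with hv
  have hvm : Measurable v := by fun_prop
  calc _ ≤ ∫⁻ t in Ioi 0, (∫⁻ s in Ioo 0 t, w s) * v t := by
        refine setLIntegral_mono' measurableSet_Ioi fun t ht => ?_
        have ht : 0 < t := ht
        refine (mul_le_mul_left (hardy_step hp hσ ht k hk) _).trans ?_
        rw [mul_assoc, ← ENNReal.ofReal_mul (by positivity)]
        simp only [hv]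
        rw [← ENNReal.ofReal_mul (by positivity)]
        apply le_of_eq
        congr 2
        rw [div_eq_mul_inv, mul_rpow (by positivity) (by positivity), ← rpow_mul ht.le, mul_right_comm,
          ← rpow_add ht, mul_comm]
        congr 2
        linarith
    _ = ∫⁻ t in Ioi 0, ∫⁻ s in Ioi 0, {z : ℝ × ℝ | z.2 < z.1}.indicator (fun z => w z.2 * v z.1) (t, s) := by
        refine setLIntegral_congr_fun measurableSet_Ioi fun t ht => ?_
        calc _ = ∫⁻ s in Ioo 0 t, w s * v t := by rw [lintegral_mul_const _ hwm]
          _ = ∫⁻ s in Ioi 0, (Iio t).indicator (fun s => w s * v t) s := by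
              rw [lintegral_indicator measurableSet_Iio, Measure.restrict_restrict measurableSet_Iio,
                inter_comm, Ioi_inter_Iio]
          _ = _ := rfl
    _ = ∫⁻ s in Ioi 0, ∫⁻ t in Ioi 0, {z : ℝ × ℝ | z.2 < z.1}.indicator (fun z => w z.2 * v z.1) (t, s) := by
        apply lintegral_lintegral_swap
        exact (Measurable.indicator (by fun_prop) (measurableSet_lt (by fun_prop) (by fun_prop))).aemeasurable
    _ = ∫⁻ s in Ioi 0, ENNReal.ofReal ((p / (γ - 1)) ^ p) * (k s ^ p * ENNReal.ofReal (s ^ (p - γ))) := by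
        refine setLIntegral_congr_fun measurableSet_Ioi fun s hs => ?_
        have hs : 0 < s := hs
        calc _ = ∫⁻ t in Ioi 0, (Ioi s).indicator (fun t => w s * v t) t := by
                rfl
          _ = ∫⁻ t in Ioi s, w s * v t := by
                rw [lintegral_indicator measurableSet_Ioi, Measure.restrict_restrict measurableSet_Ioi,
                  Ioi_inter_Ioi, sup_of_le_left hs.le]
          _ = _ := by
            rw [lintegral_const_mul _ hvm]
            simp only [hv, hw]
            rw [lintegral_const_mul _ (by fun_prop), lint_Ioi_rpow hσ hs, mul_assoc,
              mul_left_comm _ (k s ^ p), ← ENNReal.ofReal_mul (by positivity),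
              ← ENNReal.ofReal_mul (by positivity)]
            rw [← ENNReal.ofReal_mul (by positivity)]
            congr 2
            have : p / (γ - 1) = σ⁻¹ := by rw [hσd, inv_div]
            rw [this, div_eq_mul_inv, show p - γ = (1 - σ) * (p - 1) + -σ by linarith, rpow_add hs]
            have : σ⁻¹ ^ p = σ⁻¹ ^ (p - 1) * σ⁻¹ := by
              rw [← rpow_add_one (by positivity)]; simp
            rw [this]; ring
    _ = _ := by rw [lintegral_const_mul _ (by fun_prop)]

lemma hardy_fun {p γ : ℝ} (hp : 1 < p) (hγ : 1 < γ) (h h' : ℝ → ℝ) (hc : Continuous h')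
    (hd : ∀ x, HasDerivAt h (h' x) x) (h0 : h 0 = 0) :
    ∫⁻ t in Ioi 0, ‖h t‖ₑ ^ p * ENNReal.ofReal (|t| ^ (-γ)) ≤
      ENNReal.ofReal ((p / (γ - 1)) ^ p) *
        ∫⁻ s in Ioi 0, ‖h' s‖ₑ ^ p * ENNReal.ofReal (|s| ^ (p - γ)) := by
  have key := hardy hp hγ (fun s => ‖h' s‖ₑ) (by fun_prop)
  have e : ∫⁻ s in Ioi 0, ‖h' s‖ₑ ^ p * ENNReal.ofReal (|s| ^ (p - γ)) =
      ∫⁻ s in Ioi 0, ‖h' s‖ₑ ^ p * ENNReal.ofReal (s ^ (p - γ)) := by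
    refine setLIntegral_congr_fun measurableSet_Ioi fun s hs => ?_
    have hs : 0 < s := hs
    simp only [abs_of_pos hs]
  rw [e]
  refine le_trans ?_ key
  refine setLIntegral_mono' measurableSet_Ioi fun t ht => ?_
  have ht : 0 < t := ht
  rw [abs_of_pos ht]
  gcongr
  have : h t = ∫ s in Ioo 0 t, h' s := by
    rw [← integral_Ioc_eq_integral_Ioo, ← intervalIntegral.integral_of_le ht.le,
      intervalIntegral.integral_eq_sub_of_hasDerivAt (fun x _ => hd x) (hc.intervalIntegrable _ _), h0,
      sub_zero]
  rw [this]
  exact enorm_integral_le_lintegral_enorm _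

lemma lint_split (F : ℝ → ℝ≥0∞) :
    ∫⁻ t, F t = (∫⁻ t in Ioi 0, F t) + ∫⁻ t in Ioi 0, F (-t) := by
  have h1 : ∫⁻ t in Ioi 0, F (-t) = ∫⁻ t in Iio 0, F t := by
    have := (Measure.measurePreserving_neg (volume : Measure ℝ)).setLIntegral_comp_preimage_emb
      (MeasurableEquiv.neg ℝ).measurableEmbedding F (Iio 0)
    simpa using this
  rw [h1, ← lintegral_add_compl F (measurableSet_Ioi (a := (0:ℝ))), compl_Ioi,
    Measure.restrict_congr_set Iio_ae_eq_Iic]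

lemma hardy_two {p γ : ℝ} (hp : 1 < p) (hγ : 1 < γ) (h h' : ℝ → ℝ) (hc : Continuous h')
    (hd : ∀ x, HasDerivAt h (h' x) x) (h0 : h 0 = 0) :
    ∫⁻ t, ‖h t‖ₑ ^ p * ENNReal.ofReal (|t| ^ (-γ)) ≤
      ENNReal.ofReal ((p / (γ - 1)) ^ p) *
        ∫⁻ s, ‖h' s‖ₑ ^ p * ENNReal.ofReal (|s| ^ (p - γ)) := by
  have k1 := hardy_fun hp hγ h h' hc hd h0
  have k2 := hardy_fun hp hγ (fun t => h (-t)) (fun t => - h' (-t)) (by fun_prop)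
    (fun x => by
      have := (hd (-x)).comp x (hasDerivAt_neg x)
      simpa [Function.comp_def] using this) (by simpa using h0)
  rw [lint_split, lint_split (fun s => ‖h' s‖ₑ ^ p * _), mul_add]
  simp only [enorm_neg, abs_neg] at k2 ⊢
  exact add_le_add k1 k2

lemma lint_exp {R : ℝ} (hR : 0 < R) (F : ℝ → ℝ≥0∞) :
    ∫⁻ r in Ioi 0, F r = ∫⁻ t, ENNReal.ofReal (R * rexp t) * F (R * rexp t) := by
  have himg : (fun t => R * rexp t) '' univ = Ioi 0 := by
    ext r
    simp only [image_univ, mem_range, mem_Ioi]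
    constructor
    · rintro ⟨t, rfl⟩; positivity
    · intro hr
      refine ⟨log (r / R), ?_⟩
      rw [exp_log (by positivity)]; field_simp
  have := lintegral_image_eq_lintegral_abs_deriv_mul (s := univ) (f := fun t => R * rexp t)
    (f' := fun t => R * rexp t) MeasurableSet.univ
    (fun x _ => ((Real.hasDerivAt_exp x).const_mul R).hasDerivWithinAt)
    (fun x _ y _ hxy => by
      have : rexp x = rexp y := mul_left_cancel₀ hR.ne' hxy
      exact exp_injective this) F
  rw [himg] at this
  rw [this, Measure.restrict_univ]
  refine lintegral_congr fun t => ?_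
  rw [abs_of_pos (by positivity)]

abbrev Eu (n : ℕ) := EuclideanSpace ℝ (Fin n)

lemma lint_polar {n : ℕ} (hn : 1 ≤ n) {R : ℝ} (hR : 0 < R)
    (G : Eu n → ℝ≥0∞) (hG : Measurable G) :
    ∫⁻ x, G x = ∫⁻ ω : Metric.sphere (0 : Eu n) 1,
      (∫⁻ t : ℝ, ENNReal.ofReal ((R * rexp t) ^ n) * G ((R * rexp t) • (ω : Eu n)))
      ∂(volume : Measure (Eu n)).toSphere := by
  have : Nontrivial (Eu n) := by
    have : Nonempty (Fin n) := ⟨⟨0, hn⟩⟩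
    infer_instance
  have hmp := (volume : Measure (Eu n)).measurePreserving_homeomorphUnitSphereProd
  have hdim : Module.finrank ℝ (Eu n) = n := by simp [Eu]
  calc ∫⁻ x, G x = ∫⁻ x : ({(0 : Eu n)}ᶜ : Set (Eu n)), G x.1 ∂((volume : Measure (Eu n)).comap Subtype.val) := by
        rw [lintegral_subtype_comap (measurableSet_singleton _).compl, restrict_compl_singleton]
    _ = ∫⁻ z : Metric.sphere (0 : Eu n) 1 × Ioi (0:ℝ), G (z.2.1 • z.1.1)
          ∂(volume : Measure (Eu n)).toSphere.prod (.volumeIoiPow (Module.finrank ℝ (Eu n) - 1)) := by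
        rw [← hmp.lintegral_comp_emb (Homeomorph.measurableEmbedding _)]
        refine lintegral_congr fun x => ?_
        have hx : ‖x.1‖ ≠ 0 := norm_ne_zero_iff.2 x.2
        simp [smul_smul, hx]
    _ = ∫⁻ ω : Metric.sphere (0 : Eu n) 1, ∫⁻ r : Ioi (0:ℝ), G (r.1 • ω.1)
          ∂(Measure.volumeIoiPow (Module.finrank ℝ (Eu n) - 1)) ∂(volume : Measure (Eu n)).toSphere := by
        rw [lintegral_prod]
        exact (hG.comp (by fun_prop)).aemeasurable
    _ = _ := by
        refine lintegral_congr fun ω => ?_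
        have hGm : Measurable fun r : ℝ => G (r • (ω : Eu n)) := hG.comp (by fun_prop)
        rw [Measure.volumeIoiPow, lintegral_withDensity_eq_lintegral_mul _ (by fun_prop)
          (show Measurable fun r : Ioi (0:ℝ) => G (r.1 • (ω : Eu n)) from
            hGm.comp measurable_subtype_coe)]
        simp only [Pi.mul_apply]
        rw [lintegral_subtype_comap measurableSet_Ioi
          (fun r : ℝ => ENNReal.ofReal (r ^ (Module.finrank ℝ (Eu n) - 1)) * G (r • (ω : Eu n))),
          lint_exp hR]
        refine lintegral_congr fun t => ?_
        rw [← mul_assoc, ← ENNReal.ofReal_mul (by positivity), hdim, mul_pow_sub_one (by omega)]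

lemma ae_ne_zero' : ∀ᵐ t : ℝ, t ≠ 0 := by
  simp [ae_iff]

lemma alg_aux {A r τ p α β : ℝ} (n : ℕ) (hA : 0 ≤ A) (hr : 0 < r) (hτ : 0 < τ) (hp : 0 < p) :
    r ^ n * (A / (r ^ (α / p) * τ ^ (β / p))) ^ p = (A * r ^ (((n : ℝ) - α) / p)) ^ p * τ ^ (-β) := by
  rw [div_rpow hA (by positivity), mul_rpow (by positivity) (by positivity),
    mul_rpow hA (by positivity), ← rpow_mul hr.le, ← rpow_mul hτ.le, ← rpow_mul hr.le,
    div_mul_cancel₀ _ hp.ne', div_mul_cancel₀ _ hp.ne', div_mul_cancel₀ _ hp.ne', rpow_neg hτ.le,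
    rpow_sub hr, Real.rpow_natCast]
  field_simp

lemma main_aux (n : ℕ) (hn : 1 ≤ n) (γ p R : ℝ) (hγ : 1 < γ) (hp1 : 1 < p) (hpγ : γ - 1 < p)
    (hR : 0 < R)
    (f : Eu n → ℝ) (hf : ContDiff ℝ (⊤ : ℕ∞) f) (hsupp : HasCompactSupport f)
    (h0 : ∃ ε > (0 : ℝ), ∀ x : Eu n, ‖x‖ < ε → f x = 0)
    (L Q : Eu n → ℝ)
    (hL : L = fun x => (|f x - f ((R / ‖x‖) • x)| /
          (‖x‖ ^ ((n : ℝ) / p) * |Real.log (R / ‖x‖)| ^ (γ / p))) ^ p)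
    (hQ : Q = fun x => (|fderiv ℝ f x (‖x‖⁻¹ • x)| /
            (‖x‖ ^ (((n : ℝ) - p) / p) * |Real.log (R / ‖x‖)| ^ ((γ - p) / p))) ^ p) :
    Measurable L ∧ Measurable Q ∧ ∫⁻ x, ENNReal.ofReal (Q x) ≠ ⊤ ∧
    ∫⁻ x, ENNReal.ofReal (L x) ≤ ENNReal.ofReal ((p / (γ - 1)) ^ p) * ∫⁻ x, ENNReal.ofReal (Q x) := by
  have hp0 : 0 < p := by linarith
  have hfc : Continuous f := hf.continuous
  have hfd : Continuous (fderiv ℝ f) := hf.continuous_fderiv (by simp)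
  have hdiff : Differentiable ℝ f := hf.differentiable (by simp)
  have hmL : Measurable L := by
    rw [hL]
    have : Measurable fun x : Eu n => f ((R / ‖x‖) • x) := hfc.measurable.comp (by fun_prop)
    have := hfc.measurable
    fun_prop
  have hmQ : Measurable Q := by
    rw [hQ]
    have : Measurable fun x : Eu n => fderiv ℝ f x (‖x‖⁻¹ • x) := by
      have : (fun x : Eu n => fderiv ℝ f x (‖x‖⁻¹ • x)) = fun x => ‖x‖⁻¹ * fderiv ℝ f x x := by
        ext x; simp
      rw [this]
      have : Continuous fun x => fderiv ℝ f x x := hfd.clm_apply continuous_id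
      have := this.measurable
      fun_prop
    fun_prop
  set Φ : Eu n → ℝ := fun x => fderiv ℝ f x x with hΦ
  have hΦc : Continuous Φ := hfd.clm_apply continuous_id
  set h : Metric.sphere (0 : Eu n) 1 → ℝ → ℝ := fun ω t => f ((R * rexp t) • ω.1) - f (R • ω.1) with hh
  set h' : Metric.sphere (0 : Eu n) 1 → ℝ → ℝ := fun ω t => Φ ((R * rexp t) • ω.1) with hh'
  have hc : ∀ ω, Continuous (h' ω) := fun ω => hΦc.comp (by fun_prop)
  have hd : ∀ ω x, HasDerivAt (h ω) (h' ω x) x := by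
    intro ω x
    have h1 : HasDerivAt (fun t => (R * rexp t) • ω.1) ((R * rexp x) • ω.1) x :=
      ((Real.hasDerivAt_exp x).const_mul R).smul_const ω.1
    exact ((hdiff _).hasFDerivAt.comp_hasDerivAt x h1).sub_const _
  have hnorm : ∀ (ω : Metric.sphere (0 : Eu n) 1) (t : ℝ), ‖(R * rexp t) • ω.1‖ = R * rexp t := by
    intro ω t
    have : ‖ω.1‖ = 1 := by simpa using ω.2
    rw [norm_smul, this, mul_one, Real.norm_of_nonneg (by positivity)]
  have hlog : ∀ t : ℝ, |Real.log (R / (R * rexp t))| = |t| := by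
    intro t
    rw [show R / (R * rexp t) = rexp (-t) by rw [Real.exp_neg]; field_simp, Real.log_exp, abs_neg]
  have eL : ∫⁻ x, ENNReal.ofReal (L x) = ∫⁻ ω : Metric.sphere (0 : Eu n) 1,
      (∫⁻ t : ℝ, ‖h ω t‖ₑ ^ p * ENNReal.ofReal (|t| ^ (-γ)))
      ∂(volume : Measure (Eu n)).toSphere := by
    rw [lint_polar hn hR _ (by fun_prop)]
    refine lintegral_congr fun ω => ?_
    refine lintegral_congr_ae ?_
    filter_upwards [ae_ne_zero'] with t ht
    have ht' : 0 < |t| := abs_pos.2 ht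
    simp only [hL]
    rw [hnorm, hlog, ← ENNReal.ofReal_mul (by positivity), alg_aux n (abs_nonneg _) (by positivity) ht' hp0,
      smul_smul, div_mul_cancel₀ _ (by positivity), ENNReal.ofReal_mul (by positivity), enorm_eq_ofReal_abs,
      ENNReal.ofReal_rpow_of_nonneg (abs_nonneg _) hp0.le]
    simp [hh]
  have eQ : ∫⁻ x, ENNReal.ofReal (Q x) = ∫⁻ ω : Metric.sphere (0 : Eu n) 1,
      (∫⁻ t : ℝ, ‖h' ω t‖ₑ ^ p * ENNReal.ofReal (|t| ^ (p - γ)))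
      ∂(volume : Measure (Eu n)).toSphere := by
    rw [lint_polar hn hR _ (by fun_prop)]
    refine lintegral_congr fun ω => ?_
    refine lintegral_congr_ae ?_
    filter_upwards [ae_ne_zero'] with t ht
    have ht' : 0 < |t| := abs_pos.2 ht
    have hr : 0 < R * rexp t := by positivity
    simp only [hQ]
    rw [hnorm, hlog, ← ENNReal.ofReal_mul (by positivity), alg_aux n (abs_nonneg _) (by positivity) ht' hp0,
      ENNReal.ofReal_mul (by positivity), enorm_eq_ofReal_abs,
      ENNReal.ofReal_rpow_of_nonneg (abs_nonneg _) hp0.le, neg_sub, _root_.sub_sub_cancel, div_self hp0.ne',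
      Real.rpow_one]
    congr 3
    simp only [hh', hΦ, map_smul, smul_eq_mul, abs_mul, abs_inv, abs_of_pos hr]
    field_simp
  refine ⟨hmL, hmQ, ?_, ?_⟩
  · obtain ⟨ε, hε, hε0⟩ := h0
    have hΦs : HasCompactSupport Φ := by
      refine (hsupp.fderiv (𝕜 := ℝ)).mono fun x hx => ?_
      contrapose! hx
      simp only [Function.mem_support, not_not] at hx ⊢
      simp [hΦ, hx]
    obtain ⟨M, hM⟩ := hΦs.exists_bound_of_continuous hΦc
    obtain ⟨K, hK0, hK⟩ : ∃ K > (0:ℝ), ∀ x, K < ‖x‖ → Φ x = 0 := by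
      obtain ⟨K, hK0, hK⟩ := hΦs.isCompact.isBounded.exists_pos_norm_le
      refine ⟨K, hK0, fun x hx => ?_⟩
      by_contra hne
      exact absurd (hK x (subset_tsupport _ hne)) (not_le.2 hx)
    have hΦ0 : ∀ x, ‖x‖ < ε → Φ x = 0 := by
      intro x hx
      have : f =ᶠ[nhds x] fun _ => 0 := by
        have : {y : Eu n | ‖y‖ < ε} ∈ nhds x := (isOpen_lt continuous_norm continuous_const).mem_nhds hx
        filter_upwards [this] with y hy using hε0 y hy
      simp [hΦ, this.fderiv_eq]
    set A := max (-(Real.log (ε / R))) (Real.log (K / R)) with hA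
    have hsup : ∀ ω t, A < |t| → h' ω t = 0 := by
      intro ω t ht
      rcases lt_abs.1 ht with h1 | h1
      · apply hK
        rw [hnorm]
        have : Real.log (K / R) < t := lt_of_le_of_lt (le_max_right _ _) h1
        rw [Real.log_lt_iff_lt_exp (by positivity), div_lt_iff₀ hR] at this
        linarith
      · apply hΦ0
        rw [hnorm]
        have : -(Real.log (ε / R)) < -t := lt_of_le_of_lt (le_max_left _ _) h1
        have : t < Real.log (ε / R) := by linarith
        rw [Real.lt_log_iff_exp_lt (by positivity), lt_div_iff₀ hR] at this
        linarith
    set B := max A 1 with hB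
    have hB0 : 0 < B := by positivity
    set C : ℝ≥0∞ := 2 * (ENNReal.ofReal M ^ p * ENNReal.ofReal (B ^ (p - γ + 1) / (p - γ + 1))) with hC
    have hCt : C ≠ ⊤ := by
      rw [hC]
      exact ENNReal.mul_ne_top (by simp) (ENNReal.mul_ne_top
        (ENNReal.rpow_ne_top_of_nonneg hp0.le ENNReal.ofReal_ne_top) ENNReal.ofReal_ne_top)
    have hbd : ∀ ω, ∫⁻ t : ℝ, ‖h' ω t‖ₑ ^ p * ENNReal.ofReal (|t| ^ (p - γ)) ≤ C := by
      intro ω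
      have one : ∀ e : ℝ → ℝ, (∀ t, |e t| = |t|) →
          ∫⁻ t in Ioi 0, ‖h' ω (e t)‖ₑ ^ p * ENNReal.ofReal (|e t| ^ (p - γ)) ≤
          ENNReal.ofReal M ^ p * ENNReal.ofReal (B ^ (p - γ + 1) / (p - γ + 1)) := by
        intro e he
        rw [← lint_Ioo_rpow (by linarith) hB0, ← lintegral_const_mul _ (by fun_prop)]
        rw [Measure.restrict_congr_set Ioo_ae_eq_Ioc, ← Ioi_inter_Iic, inter_comm,
          ← Measure.restrict_restrict measurableSet_Iic, ← lintegral_indicator measurableSet_Iic]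
        refine setLIntegral_mono' measurableSet_Ioi fun t ht => ?_
        have ht : 0 < t := ht
        by_cases htB : t ≤ B
        · rw [indicator_of_mem (by exact htB), he, abs_of_pos ht, add_sub_cancel_right,
            enorm_eq_ofReal_abs]
          gcongr
          exact hM _
        · rw [hsup ω (e t) (by
            rw [he, abs_of_pos ht]
            exact lt_of_le_of_lt (le_max_left _ _) (not_le.1 htB))]
          simp [hp0]
      rw [lint_split, hC, two_mul]
      exact add_le_add (one id (fun t => rfl)) (one (fun t => -t) abs_neg)
    rw [eQ]
    refine ne_top_of_le_ne_top ?_ (lintegral_mono hbd)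
    rw [lintegral_const]
    exact ENNReal.mul_ne_top hCt (measure_ne_top _ _)
  · rw [eL, eQ, ← lintegral_const_mul' _ _ ENNReal.ofReal_ne_top]
    exact lintegral_mono fun ω => hardy_two hp1 hγ (h ω) (h' ω) (hc ω) (hd ω) (by simp [hh])

end Aux

theorem stmt_9 (n : ℕ) (hn : 1 ≤ n) (γ p R : ℝ) (hγ : 1 < γ) (hp : max 1 (γ - 1) < p)
    (hR : 0 < R)
    (f : EuclideanSpace ℝ (Fin n) → ℝ) (hf : ContDiff ℝ (⊤ : ℕ∞) f) (hsupp : HasCompactSupport f)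
    (h0 : ∃ ε > (0 : ℝ), ∀ x : EuclideanSpace ℝ (Fin n), ‖x‖ < ε → f x = 0) :
    (∫ x : EuclideanSpace ℝ (Fin n),
        (|f x - f ((R / ‖x‖) • x)| /
          (‖x‖ ^ ((n : ℝ) / p) * |Real.log (R / ‖x‖)| ^ (γ / p))) ^ p) ^ (1 / p) ≤
      (p / (γ - 1)) *
        (∫ x : EuclideanSpace ℝ (Fin n),
          (|fderiv ℝ f x (‖x‖⁻¹ • x)| /
            (‖x‖ ^ (((n : ℝ) - p) / p) * |Real.log (R / ‖x‖)| ^ ((γ - p) / p))) ^ p) ^ (1 / p) := by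
  have hp1 : 1 < p := lt_of_le_of_lt (le_max_left _ _) hp
  have hpγ : γ - 1 < p := lt_of_le_of_lt (le_max_right _ _) hp
  have hp0 : 0 < p := by linarith
  have hγ1 : 0 < γ - 1 := by linarith
  obtain ⟨hmL, hmQ, hfin, hle⟩ := main_aux n hn γ p R hγ hp1 hpγ hR f hf hsupp h0 _ _ rfl rfl
  rw [integral_eq_lintegral_of_nonneg_ae (Filter.Eventually.of_forall fun x => by positivity)
      hmL.aestronglyMeasurable,
    integral_eq_lintegral_of_nonneg_ae (Filter.Eventually.of_forall fun x => by positivity)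
      hmQ.aestronglyMeasurable]
  have h2 := ENNReal.toReal_mono (ENNReal.mul_ne_top ENNReal.ofReal_ne_top hfin) hle
  rw [ENNReal.toReal_mul, ENNReal.toReal_ofReal (by positivity)] at h2
  refine (Real.rpow_le_rpow ENNReal.toReal_nonneg h2 (by positivity)).trans ?_
  rw [Real.mul_rpow (by positivity) ENNReal.toReal_nonneg, ← Real.rpow_mul (by positivity),
    mul_one_div_cancel hp0.ne', Real.rpow_one]
end

section
/- Let 1 < γ < ∞ and max{1, γ−1} < p < ∞, and let 1 < p̃, q̃ with 1/p̃ + 1/q̃ = 1/2 where p̃ = p. Then for every R > 0 and every f ∈ C_0^∞(ℝ^n \ {0}), ‖(x/|x|·∇f)/(|x|^{(n−p)/p}|log(R/|x|)|^{(γ−p)/p})‖_{L^p(ℝ^n)} · ‖f‖_{L^q(ℝ^n)} ≥ ((γ−1)/p) · ‖f(f − f_R)/(|x|^{n/p}|log(R/|x|)|^{γ/p})‖_{L^2(ℝ^n)}, where q > 1 satisfies 1/p + 1/q = 1/2 and f_R(x) = f(R x/|x|). -/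
open Real MeasureTheory

lemma aux_P1 {s k : ℝ} (hs : 0 < s) (hk : 0 < k) :
    ∫⁻ t in Set.Ioo 0 s, ENNReal.ofReal (t ^ (k - 1)) = ENNReal.ofReal (s ^ k / k) := by
  rw [Measure.restrict_congr_set Ioo_ae_eq_Ioc]
  rw [← ofReal_integral_eq_lintegral_ofReal
    ((intervalIntegral.intervalIntegrable_rpow' (by linarith : -1 < k - 1)).1)]
  · rw [← intervalIntegral.integral_of_le hs.le, integral_rpow (Or.inl (by linarith))]
    simp [Real.zero_rpow hk.ne']
  · filter_upwards [ae_restrict_mem measurableSet_Ioc] with y hy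
    exact Real.rpow_nonneg hy.1.le _

lemma aux_P2 {t k : ℝ} (ht : 0 < t) (hk : 0 < k) :
    ∫⁻ s in Set.Ioi t, ENNReal.ofReal (s ^ (-k - 1)) = ENNReal.ofReal (t ^ (-k) / k) := by
  rw [← ofReal_integral_eq_lintegral_ofReal
    (integrableOn_Ioi_rpow_of_lt (by linarith) ht)]
  · rw [integral_Ioi_rpow_of_lt (by linarith) ht]
    congr 1
    rw [sub_add_cancel, div_neg, neg_div, neg_neg]
  · filter_upwards [ae_restrict_mem measurableSet_Ioi] with y hy
    exact Real.rpow_nonneg (ht.trans hy).le _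

lemma aux_tonelli {c h : ℝ → ENNReal} (hc : Measurable c) (hh : Measurable h) :
    ∫⁻ s in Set.Ioi (0 : ℝ), c s * ∫⁻ t in Set.Ioo 0 s, h t =
      ∫⁻ t in Set.Ioi (0 : ℝ), h t * ∫⁻ s in Set.Ioi t, c s := by
  have hm : MeasurableSet {z : ℝ × ℝ | z.2 < z.1} := measurableSet_lt measurable_snd measurable_fst
  have h1 : ∀ s ∈ Set.Ioi (0 : ℝ), c s * ∫⁻ t in Set.Ioo 0 s, h t =
      ∫⁻ t in Set.Ioi (0 : ℝ), {z : ℝ × ℝ | z.2 < z.1}.indicator (fun z => c z.1 * h z.2) (s, t) := by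
    intro s hs
    rw [← lintegral_const_mul _ hh, ← Set.Ioi_inter_Iio, Set.inter_comm,
      ← Measure.restrict_restrict measurableSet_Iio, ← lintegral_indicator measurableSet_Iio]
    rfl
  have h2 : ∀ t ∈ Set.Ioi (0 : ℝ), h t * ∫⁻ s in Set.Ioi t, c s =
      ∫⁻ s in Set.Ioi (0 : ℝ), {z : ℝ × ℝ | z.2 < z.1}.indicator (fun z => c z.1 * h z.2) (s, t) := by
    intro t ht
    have : Set.Ioi t = Set.Ioi t ∩ Set.Ioi 0 := by
      exact (Set.inter_eq_left.2 (Set.Ioi_subset_Ioi (le_of_lt ht))).symm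
    rw [← lintegral_const_mul _ hc, this, 
      ← Measure.restrict_restrict measurableSet_Ioi, ← lintegral_indicator measurableSet_Ioi]
    congr 1
    ext s
    simp only [Set.indicator, Set.mem_Ioi, Set.mem_ofPred_eq, mul_comm]
  rw [setLIntegral_congr_fun measurableSet_Ioi h1, setLIntegral_congr_fun measurableSet_Ioi h2]
  apply lintegral_lintegral_swap
  apply Measurable.aemeasurable
  exact Measurable.indicator (by fun_prop) hm

lemma aux_hardy_s10 {p γ : ℝ} (hp : 1 < p) (hγ : 1 < γ) {w : ℝ → ENNReal} (hw : Measurable w) :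
    ∫⁻ s in Set.Ioi (0 : ℝ), (∫⁻ t in Set.Ioo 0 s, w t) ^ p * ENNReal.ofReal (s ^ (-γ)) ≤
      ENNReal.ofReal (((γ - 1) / p) ^ (-p)) *
        ∫⁻ s in Set.Ioi (0 : ℝ), (w s) ^ p * ENNReal.ofReal (s ^ (p - γ)) := by
  obtain ⟨k, hkdef⟩ : ∃ k, k = (γ - 1) / p := ⟨_, rfl⟩
  have hp0 : 0 < p := by linarith
  have hk : 0 < k := by rw [hkdef]; apply div_pos <;> linarith
  have hkp : k * p = γ - 1 := by rw [hkdef]; field_simp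
  rw [← hkdef]
  obtain ⟨a, ha⟩ : ∃ a, a = (1 - k) * (p - 1) / p := ⟨_, rfl⟩
  have hap : a * p = (1 - k) * (p - 1) := by rw [ha]; field_simp
  have hconj : p.HolderConjugate (p / (p - 1)) := Real.HolderConjugate.conjExponent hp
  have haq : a * (p / (p - 1)) = 1 - k := by
    have : p - 1 ≠ 0 := by linarith
    rw [ha]; field_simp
  have step1 : ∀ s ∈ Set.Ioi (0 : ℝ),
      (∫⁻ t in Set.Ioo 0 s, w t) ^ p * ENNReal.ofReal (s ^ (-γ)) ≤
      (ENNReal.ofReal (k ^ (1 - p)) * ENNReal.ofReal (s ^ (-k - 1))) *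
        ∫⁻ t in Set.Ioo 0 s, (w t) ^ p * ENNReal.ofReal (t ^ (a * p)) := by
    intro s hs
    have hs : 0 < s := hs
    have e1 : ∫⁻ t in Set.Ioo 0 s, w t = ∫⁻ t in Set.Ioo 0 s,
        ((fun t => w t * ENNReal.ofReal (t ^ a)) * (fun t => ENNReal.ofReal (t ^ (-a)))) t := by
      apply setLIntegral_congr_fun measurableSet_Ioo
      intro t ht
      simp only [Pi.mul_apply]
      rw [mul_assoc, ← ENNReal.ofReal_mul (Real.rpow_nonneg ht.1.le _), ← Real.rpow_add ht.1]
      simp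
    have e2 := ENNReal.lintegral_mul_le_Lp_mul_Lq (volume.restrict (Set.Ioo 0 s)) hconj
      (f := fun t => w t * ENNReal.ofReal (t ^ a)) (g := fun t => ENNReal.ofReal (t ^ (-a)))
      (by fun_prop) (by fun_prop)
    rw [← e1] at e2
    have e3 : ∫⁻ t in Set.Ioo 0 s, (w t * ENNReal.ofReal (t ^ a)) ^ p =
        ∫⁻ t in Set.Ioo 0 s, (w t) ^ p * ENNReal.ofReal (t ^ (a * p)) := by
      apply setLIntegral_congr_fun measurableSet_Ioo
      intro t ht
      simp only
      rw [ENNReal.mul_rpow_of_nonneg _ _ hp0.le,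
        ENNReal.ofReal_rpow_of_pos (Real.rpow_pos_of_pos ht.1 _), ← Real.rpow_mul ht.1.le]
    have e4 : ∫⁻ t in Set.Ioo 0 s, (ENNReal.ofReal (t ^ (-a))) ^ (p / (p - 1)) =
        ENNReal.ofReal (s ^ k / k) := by
      rw [← aux_P1 hs hk]
      apply setLIntegral_congr_fun measurableSet_Ioo
      intro t ht
      simp only
      rw [ENNReal.ofReal_rpow_of_pos (Real.rpow_pos_of_pos ht.1 _), ← Real.rpow_mul ht.1.le,
        neg_mul, haq, neg_sub]
    rw [e3, e4] at e2
    have e5 := ENNReal.rpow_le_rpow e2 hp0.le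
    rw [ENNReal.mul_rpow_of_nonneg _ _ hp0.le, ← ENNReal.rpow_mul, ← ENNReal.rpow_mul,
      one_div_mul_cancel hp0.ne', ENNReal.rpow_one] at e5
    have e6 : 1 / (p / (p - 1)) * p = p - 1 := by field_simp
    rw [e6, ENNReal.ofReal_rpow_of_pos (by positivity)] at e5
    refine (mul_le_mul_left e5 _).trans (le_of_eq ?_)
    rw [mul_assoc, mul_comm, ← ENNReal.ofReal_mul (by positivity),
      ← ENNReal.ofReal_mul (by positivity)]
    congr 2
    rw [Real.div_rpow (by positivity) hk.le, ← Real.rpow_mul hs.le, div_eq_mul_inv,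
      ← Real.rpow_neg hk.le, neg_sub, mul_right_comm, ← Real.rpow_add hs, mul_comm]
    congr 2
    linarith [hkp]
  calc _ ≤ ∫⁻ s in Set.Ioi (0 : ℝ), (ENNReal.ofReal (k ^ (1 - p)) * ENNReal.ofReal (s ^ (-k - 1))) *
        ∫⁻ t in Set.Ioo 0 s, (w t) ^ p * ENNReal.ofReal (t ^ (a * p)) :=
        setLIntegral_mono' measurableSet_Ioi step1
    _ = ∫⁻ t in Set.Ioi (0 : ℝ), ((w t) ^ p * ENNReal.ofReal (t ^ (a * p))) *
        ∫⁻ s in Set.Ioi t, (ENNReal.ofReal (k ^ (1 - p)) * ENNReal.ofReal (s ^ (-k - 1))) :=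
        aux_tonelli (by fun_prop) (by fun_prop)
    _ = ∫⁻ t in Set.Ioi (0 : ℝ), ENNReal.ofReal (k ^ (-p)) * 
          ((w t) ^ p * ENNReal.ofReal (t ^ (p - γ))) := by
        apply setLIntegral_congr_fun measurableSet_Ioi
        intro t ht
        have ht : 0 < t := ht
        simp only
        rw [lintegral_const_mul _ (by fun_prop), aux_P2 ht hk, mul_assoc, mul_left_comm _ (w t ^ p),
          ← ENNReal.ofReal_mul (by positivity), ← ENNReal.ofReal_mul (by positivity),
          ← ENNReal.ofReal_mul (by positivity)]
        congr 2
        have : p - γ = a * p + (-k) := by rw [hap]; linarith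
        rw [this, Real.rpow_add ht]
        have : k ^ (1 - p) = k * k ^ (-p) := by
          rw [sub_eq_add_neg, Real.rpow_add hk, Real.rpow_one]
        rw [this]; field_simp
    _ = _ := lintegral_const_mul _ (by fun_prop)

lemma aux_hardyC1 {p γ : ℝ} (hp : 1 < p) (hγ : 1 < γ) {u u' : ℝ → ℝ}
    (hu : ∀ s, HasDerivAt u (u' s) s) (hc : Continuous u') :
    ∫⁻ s in Set.Ioi (0 : ℝ), ENNReal.ofReal (|u s - u 0| ^ p * |s| ^ (-γ)) ≤
      ENNReal.ofReal (((γ - 1) / p) ^ (-p)) *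
        ∫⁻ s in Set.Ioi (0 : ℝ), ENNReal.ofReal (|u' s| ^ p * |s| ^ (p - γ)) := by
  have hp0 : 0 < p := by linarith
  have := aux_hardy_s10 hp hγ (w := fun s => ENNReal.ofReal |u' s|) (by fun_prop)
  have h2 : ∫⁻ s in Set.Ioi (0 : ℝ), ENNReal.ofReal (|u' s| ^ p * |s| ^ (p - γ)) =
      ∫⁻ s in Set.Ioi (0 : ℝ), (ENNReal.ofReal |u' s|) ^ p * ENNReal.ofReal (s ^ (p - γ)) := by
    apply setLIntegral_congr_fun measurableSet_Ioi
    intro s hs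
    simp only
    rw [ENNReal.ofReal_mul (by positivity), ENNReal.ofReal_rpow_of_nonneg (by positivity) hp0.le,
      abs_of_pos (show 0 < s from hs)]
  rw [h2]
  refine le_trans (setLIntegral_mono' measurableSet_Ioi ?_) this
  intro s hs
  have hs : 0 < s := hs
  rw [ENNReal.ofReal_mul (by positivity), ← ENNReal.ofReal_rpow_of_nonneg (by positivity) hp0.le,
      abs_of_pos hs]
  gcongr
  rw [Measure.restrict_congr_set Ioo_ae_eq_Ioc, ← ofReal_integral_eq_lintegral_ofReal
    ((hc.abs.intervalIntegrable 0 s).1) (Filter.Eventually.of_forall fun _ => abs_nonneg _),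
    ← intervalIntegral.integral_of_le hs.le]
  apply ENNReal.ofReal_le_ofReal
  rw [← intervalIntegral.integral_eq_sub_of_hasDerivAt (fun x _ => hu x) (hc.intervalIntegrable _ _)]
  exact intervalIntegral.abs_integral_le_integral_abs hs.le

lemma aux_split (F : ℝ → ENNReal) :
    ∫⁻ s, F s = (∫⁻ s in Set.Ioi (0 : ℝ), F s) + ∫⁻ s in Set.Ioi (0 : ℝ), F (-s) := by
  rw [← lintegral_add_compl F (measurableSet_Ioi (a := (0 : ℝ)))]
  congr 1
  rw [Set.compl_Ioi, Measure.restrict_congr_set Iio_ae_eq_Iic.symm]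
  have := lintegral_image_eq_lintegral_abs_deriv_mul (measurableSet_Ioi (a := (0 : ℝ)))
    (f := fun x => -x) (f' := fun _ => -1) (fun x _ => hasDerivWithinAt_neg _ _)
    neg_injective.injOn F
  simpa using this

lemma aux_hardyFull {p γ : ℝ} (hp : 1 < p) (hγ : 1 < γ) {u u' : ℝ → ℝ}
    (hu : ∀ s, HasDerivAt u (u' s) s) (hc : Continuous u') :
    ∫⁻ s, ENNReal.ofReal (|u s - u 0| ^ p * |s| ^ (-γ)) ≤
      ENNReal.ofReal (((γ - 1) / p) ^ (-p)) *
        ∫⁻ s, ENNReal.ofReal (|u' s| ^ p * |s| ^ (p - γ)) := by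
  rw [aux_split, aux_split (fun s => ENNReal.ofReal (|u' s| ^ p * |s| ^ (p - γ))), mul_add]
  have h1 := aux_hardyC1 hp hγ hu hc
  have h2 := aux_hardyC1 hp hγ (u := fun s => u (-s)) (u' := fun s => - u' (-s))
    (fun s => by
      have h := (hu (-s)).comp s (hasDerivAt_neg s)
      rw [mul_neg_one] at h
      exact h) (by fun_prop)
  simp only [abs_neg, neg_zero] at h2 ⊢
  exact add_le_add h1 h2

lemma aux_cov {R : ℝ} (hR : 0 < R) (G : ℝ → ENNReal) :
    ∫⁻ r in Set.Ioi (0 : ℝ), G r = ∫⁻ s, ENNReal.ofReal (R * exp s) * G (R * exp s) := by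
  have := lintegral_image_eq_lintegral_abs_deriv_mul MeasurableSet.univ
    (f := fun x => R * exp x) (f' := fun x => R * exp x)
    (fun x _ => ((Real.hasDerivAt_exp x).const_mul R).hasDerivWithinAt)
    (fun x _ y _ h => by simpa [hR.ne'] using h) G
  have h2 : (fun x => R * exp x) '' Set.univ = Set.Ioi 0 := by
    ext y
    simp only [Set.image_univ, Set.mem_range, Set.mem_Ioi]
    constructor
    · rintro ⟨x, rfl⟩; positivity
    · intro hy; exact ⟨log (y / R), by rw [exp_log (by positivity)]; field_simp⟩
  rw [h2] at this
  rw [this, Measure.restrict_univ]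
  congr 1; ext s; rw [abs_of_pos (by positivity)]

open Metric Measure in
lemma aux_polar {n : ℕ} (hn : n ≠ 0) {G : EuclideanSpace ℝ (Fin n) → ENNReal} (hG : Measurable G) :
    ∫⁻ x, G x = ∫⁻ ω : sphere (0 : EuclideanSpace ℝ (Fin n)) 1,
      (∫⁻ r in Set.Ioi (0 : ℝ), ENNReal.ofReal (r ^ (n - 1)) * G (r • (ω : EuclideanSpace ℝ (Fin n))))
       ∂(volume : Measure (EuclideanSpace ℝ (Fin n))).toSphere := by
  have : Nonempty (Fin n) := ⟨⟨0, by omega⟩⟩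
  have hmp := (volume : Measure (EuclideanSpace ℝ (Fin n))).measurePreserving_homeomorphUnitSphereProd
  have h1 : ∫⁻ x, G x = ∫⁻ x : ({0}ᶜ : Set (EuclideanSpace ℝ (Fin n))), G x
      ∂(volume.comap Subtype.val) := by
    rw [lintegral_subtype_comap (measurableSet_singleton _).compl, restrict_compl_singleton]
  have h2 := hmp.symm (homeomorphUnitSphereProd _).toMeasurableEquiv
  have h3 := h2.lintegral_comp (f := fun x => G x.1) (by fun_prop)
  have hm : Measurable (fun a => G ((homeomorphUnitSphereProd
      (EuclideanSpace ℝ (Fin n))).toMeasurableEquiv.symm a).1) :=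
    hG.comp (measurable_subtype_coe.comp (MeasurableEquiv.measurable _))
  rw [h1, ← h3, lintegral_prod _ hm.aemeasurable]
  congr 1; ext ω
  have hm' : Measurable (fun y => G ((homeomorphUnitSphereProd
      (EuclideanSpace ℝ (Fin n))).toMeasurableEquiv.symm (ω, y)).1) :=
    hm.comp measurable_prodMk_left
  rw [volumeIoiPow, lintegral_withDensity_eq_lintegral_mul _ (by fun_prop) hm']
  rw [← lintegral_subtype_comap measurableSet_Ioi]
  congr 1; ext r
  simp

lemma aux_polar2 {n : ℕ} (hn : n ≠ 0) {R : ℝ} (hR : 0 < R)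
    {G : EuclideanSpace ℝ (Fin n) → ENNReal} (hG : Measurable G) :
    ∫⁻ x, G x = ∫⁻ ω : Metric.sphere (0 : EuclideanSpace ℝ (Fin n)) 1,
      (∫⁻ s : ℝ, ENNReal.ofReal ((R * exp s) ^ n) *
        G ((R * exp s) • (ω : EuclideanSpace ℝ (Fin n))))
       ∂(volume : Measure (EuclideanSpace ℝ (Fin n))).toSphere := by
  rw [aux_polar hn hG]
  congr 1; ext ω
  rw [aux_cov hR]
  congr 1; ext s
  rw [← mul_assoc, ← ENNReal.ofReal_mul (by positivity), mul_pow_sub_one hn]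

lemma aux_alg {n : ℕ} {r p A c d t : ℝ} (hr : 0 < r) (hA : 0 ≤ A) (hp : 0 < p) (ht : 0 ≤ t) :
    r ^ n * (A / (r ^ (c / p) * t ^ (d / p))) ^ p = A ^ p * r ^ ((n : ℝ) - c) * t ^ (-d) := by
  rw [Real.div_rpow hA (by positivity), Real.mul_rpow (by positivity) (by positivity),
    ← Real.rpow_mul hr.le, ← Real.rpow_mul ht, div_mul_cancel₀ _ hp.ne', div_mul_cancel₀ _ hp.ne',
    Real.rpow_sub hr, Real.rpow_natCast, Real.rpow_neg ht]
  rw [div_eq_mul_inv, mul_inv]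
  ring

lemma aux_intfin {a T : ℝ} (ha : -1 < a) (hT : 0 < T) (K : ℝ) :
    ∫⁻ s : ℝ, (Set.Ioo (-T) T).indicator (fun s => ENNReal.ofReal (K * |s| ^ a)) s < ⊤ := by
  have h : ∫⁻ s in Set.Ioi (0 : ℝ), (Set.Ioo (-T) T).indicator
      (fun s => ENNReal.ofReal (K * |s| ^ a)) s < ⊤ := by
    rw [lintegral_indicator measurableSet_Ioo, Measure.restrict_restrict measurableSet_Ioo]
    have : Set.Ioo (-T) T ∩ Set.Ioi 0 = Set.Ioo 0 T := by
      ext x; simp only [Set.mem_inter_iff, Set.mem_Ioo, Set.mem_Ioi]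
      constructor
      · rintro ⟨⟨_, h⟩, h'⟩; exact ⟨h', h⟩
      · rintro ⟨h, h'⟩; exact ⟨⟨by linarith, h'⟩, h⟩
    rw [this]
    have h1 : ∫⁻ s in Set.Ioo 0 T, ENNReal.ofReal (K * |s| ^ a) =
        ∫⁻ s in Set.Ioo 0 T, ENNReal.ofReal K * ENNReal.ofReal (s ^ (a + 1 - 1)) := by
      apply setLIntegral_congr_fun measurableSet_Ioo
      intro s hs
      simp only
      rw [abs_of_pos hs.1, ENNReal.ofReal_mul' (Real.rpow_nonneg hs.1.le _), add_sub_cancel_right]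
    rw [h1, lintegral_const_mul _ (by fun_prop), aux_P1 hT (by linarith)]
    exact ENNReal.mul_lt_top ENNReal.ofReal_lt_top ENNReal.ofReal_lt_top
  rw [aux_split]
  refine ENNReal.add_lt_top.2 ⟨h, ?_⟩
  convert h using 3 with s
  simp only [Set.indicator, Set.mem_Ioo, abs_neg, neg_lt_neg_iff, neg_lt]
  simp only [and_comm]

section
variable {n : ℕ} {γ p R : ℝ} {f : EuclideanSpace ℝ (Fin n) → ℝ}

lemma aux_meas (hf : ContDiff ℝ (⊤ : ℕ∞) f) :
    Measurable (fun x : EuclideanSpace ℝ (Fin n) => fderiv ℝ f x (‖x‖⁻¹ • x)) := by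
  have h1 : Continuous (fderiv ℝ f) := hf.continuous_fderiv (by simp)
  have h2 : Continuous (fun z : (EuclideanSpace ℝ (Fin n) →L[ℝ] ℝ) × EuclideanSpace ℝ (Fin n) =>
    z.1 z.2) := by fun_prop
  exact h2.measurable.comp (h1.measurable.prodMk (by fun_prop))

lemma aux_A (hn : n ≠ 0) (hR : 0 < R) (hp : 1 < p)
    (hf : ContDiff ℝ (⊤ : ℕ∞) f) :
    ∫⁻ x : EuclideanSpace ℝ (Fin n), ENNReal.ofReal ((|fderiv ℝ f x (‖x‖⁻¹ • x)| /
          (‖x‖ ^ (((n : ℝ) - p) / p) * |Real.log (R / ‖x‖)| ^ ((γ - p) / p))) ^ p) =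
     ∫⁻ ω : Metric.sphere (0 : EuclideanSpace ℝ (Fin n)) 1, (∫⁻ s : ℝ,
       ENNReal.ofReal (|fderiv ℝ f ((R * exp s) • (ω : EuclideanSpace ℝ (Fin n))) ω * (R * exp s)| ^ p
        * |s| ^ (p - γ))) ∂(volume : Measure (EuclideanSpace ℝ (Fin n))).toSphere := by
  have hm := aux_meas hf
  rw [aux_polar2 hn hR (by fun_prop)]
  congr 1; ext ω
  congr 1; ext s
  have hr : 0 < R * exp s := by positivity
  have hω : ‖(ω : EuclideanSpace ℝ (Fin n))‖ = 1 := by simp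
  have hx : ‖(R * exp s) • (ω : EuclideanSpace ℝ (Fin n))‖ = R * exp s := by
    rw [norm_smul, hω, mul_one, Real.norm_of_nonneg hr.le]
  have hlog : Real.log (R / (R * exp s)) = -s := by
    rw [div_mul_cancel_left₀ hR.ne', ← Real.exp_neg, Real.log_exp]
  rw [hx, hlog, inv_smul_smul₀ hr.ne', ← ENNReal.ofReal_mul (by positivity),
    aux_alg hr (abs_nonneg _) (by linarith) (abs_nonneg _), abs_neg, sub_sub_cancel, neg_sub, abs_mul,
    Real.mul_rpow (abs_nonneg _) (abs_nonneg _), abs_of_pos hr]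

lemma aux_C (hn : n ≠ 0) (hR : 0 < R) (hp : 1 < p)
    (hf : ContDiff ℝ (⊤ : ℕ∞) f) :
    ∫⁻ x : EuclideanSpace ℝ (Fin n), ENNReal.ofReal ((|f x - f ((R / ‖x‖) • x)| /
          (‖x‖ ^ ((n : ℝ) / p) * |Real.log (R / ‖x‖)| ^ (γ / p))) ^ p) =
     ∫⁻ ω : Metric.sphere (0 : EuclideanSpace ℝ (Fin n)) 1, (∫⁻ s : ℝ,
       ENNReal.ofReal (|f ((R * exp s) • (ω : EuclideanSpace ℝ (Fin n))) - f ((R * exp 0) • (ω : EuclideanSpace ℝ (Fin n)))| ^ p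
        * |s| ^ (-γ))) ∂(volume : Measure (EuclideanSpace ℝ (Fin n))).toSphere := by
  have hm : Measurable f := hf.continuous.measurable
  have hm2 : Measurable (fun x : EuclideanSpace ℝ (Fin n) => f ((R / ‖x‖) • x)) :=
    hm.comp (by fun_prop)
  rw [aux_polar2 hn hR (by fun_prop)]
  congr 1; ext ω
  congr 1; ext s
  have hr : 0 < R * exp s := by positivity
  have hω : ‖(ω : EuclideanSpace ℝ (Fin n))‖ = 1 := by simp
  have hx : ‖(R * exp s) • (ω : EuclideanSpace ℝ (Fin n))‖ = R * exp s := by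
    rw [norm_smul, hω, mul_one, Real.norm_of_nonneg hr.le]
  have hlog : Real.log (R / (R * exp s)) = -s := by
    rw [div_mul_cancel_left₀ hR.ne', ← Real.exp_neg, Real.log_exp]
  rw [hx, hlog, smul_smul, div_mul_cancel₀ _ hr.ne', ← ENNReal.ofReal_mul (by positivity),
    aux_alg hr (abs_nonneg _) (by linarith) (abs_nonneg _), abs_neg, sub_self, Real.rpow_zero,
    mul_one, Real.exp_zero, mul_one]

lemma aux_CA (hn : n ≠ 0) (hR : 0 < R) (hp : 1 < p) (hγ : 1 < γ)
    (hf : ContDiff ℝ (⊤ : ℕ∞) f) :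
    ∫⁻ x : EuclideanSpace ℝ (Fin n), ENNReal.ofReal ((|f x - f ((R / ‖x‖) • x)| /
          (‖x‖ ^ ((n : ℝ) / p) * |Real.log (R / ‖x‖)| ^ (γ / p))) ^ p) ≤
    ENNReal.ofReal (((γ - 1) / p) ^ (-p)) *
    ∫⁻ x : EuclideanSpace ℝ (Fin n), ENNReal.ofReal ((|fderiv ℝ f x (‖x‖⁻¹ • x)| /
          (‖x‖ ^ (((n : ℝ) - p) / p) * |Real.log (R / ‖x‖)| ^ ((γ - p) / p))) ^ p) := by
  rw [aux_C hn hR hp hf, aux_A hn hR hp hf, ← lintegral_const_mul' _ _ ENNReal.ofReal_ne_top]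
  apply lintegral_mono
  intro ω
  have h1 : Continuous (fderiv ℝ f) := hf.continuous_fderiv (by simp)
  apply aux_hardyFull hp hγ (u := fun s => f ((R * exp s) • (ω : EuclideanSpace ℝ (Fin n))))
    (u' := fun s => fderiv ℝ f ((R * exp s) • (ω : EuclideanSpace ℝ (Fin n))) ω * (R * exp s))
  · intro s
    have hd : HasFDerivAt f (fderiv ℝ f ((R * exp s) • (ω : EuclideanSpace ℝ (Fin n))))
      ((R * exp s) • (ω : EuclideanSpace ℝ (Fin n))) :=
      ((hf.differentiable (by simp)) _).hasFDerivAt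
    have h2 := hd.comp_hasDerivAt s
      (((Real.hasDerivAt_exp s).const_mul R).smul_const (ω : EuclideanSpace ℝ (Fin n)))
    rw [map_smul, smul_eq_mul, mul_comm] at h2
    exact h2
  · fun_prop

lemma aux_Afin (hn : n ≠ 0) (hR : 0 < R) (hp : 1 < p) (hpγ : γ - 1 < p)
    (hf : ContDiff ℝ (⊤ : ℕ∞) f) (hsupp : HasCompactSupport f)
    (h0 : ∃ ε > (0 : ℝ), ∀ x : EuclideanSpace ℝ (Fin n), ‖x‖ < ε → f x = 0) :
    ∫⁻ x : EuclideanSpace ℝ (Fin n), ENNReal.ofReal ((|fderiv ℝ f x (‖x‖⁻¹ • x)| /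
          (‖x‖ ^ (((n : ℝ) - p) / p) * |Real.log (R / ‖x‖)| ^ ((γ - p) / p))) ^ p) < ⊤ := by
  obtain ⟨ε, hε, h0⟩ := h0
  have h1 : Continuous (fderiv ℝ f) := hf.continuous_fderiv (by simp)
  have hcs := hsupp.fderiv ℝ
  obtain ⟨C, hC⟩ := h1.bounded_above_of_compact_support hcs
  obtain ⟨M, hM⟩ := hcs.isCompact.isBounded.exists_norm_le
  have hz : ∀ x, ‖x‖ < ε → fderiv ℝ f x = 0 := by
    intro x hx
    have : f =ᶠ[nhds x] fun _ => 0 := by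
      filter_upwards [(isOpen_lt continuous_norm continuous_const).mem_nhds hx] with y hy
      exact h0 y hy
    rw [this.fderiv_eq]; simp
  have hC0 : 0 ≤ C := (norm_nonneg _).trans (hC 0)
  rw [aux_A hn hR hp hf]
  set T := max |Real.log (ε / R)| |Real.log (M / R)| + 1 with hT
  have hT0 : 0 < T := by positivity
  have key : ∀ (ω : Metric.sphere (0 : EuclideanSpace ℝ (Fin n)) 1) (s : ℝ),
      ENNReal.ofReal (|fderiv ℝ f ((R * exp s) • (ω : EuclideanSpace ℝ (Fin n))) ω * (R * exp s)| ^ p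
        * |s| ^ (p - γ)) ≤ (Set.Ioo (-T) T).indicator
          (fun s => ENNReal.ofReal ((C * M) ^ p * |s| ^ (p - γ))) s := by
    intro ω s
    have hr : 0 < R * exp s := by positivity
    have hω : ‖(ω : EuclideanSpace ℝ (Fin n))‖ = 1 := by simp
    have hx : ‖(R * exp s) • (ω : EuclideanSpace ℝ (Fin n))‖ = R * exp s := by
      rw [norm_smul, hω, mul_one, Real.norm_of_nonneg hr.le]
    by_cases hzero : fderiv ℝ f ((R * exp s) • (ω : EuclideanSpace ℝ (Fin n))) = 0
    · simp [hzero, Real.zero_rpow (by linarith : p ≠ 0)]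
    · have hl : ε ≤ R * exp s := by
        by_contra h
        exact hzero (hz _ (by rw [hx]; linarith))
      have hu : R * exp s ≤ M := by
        rw [← hx]; exact hM _ (subset_tsupport _ hzero)
      have hMpos : 0 < M := hr.trans_le hu
      have hl' : Real.log (ε / R) ≤ s := by
        rw [Real.log_le_iff_le_exp (by positivity), div_le_iff₀ hR]; linarith
      have hu' : s ≤ Real.log (M / R) := by
        rw [Real.le_log_iff_exp_le (by positivity), le_div_iff₀ hR]; linarith
      have hmem : s ∈ Set.Ioo (-T) T := by
        constructor
        · linarith [neg_abs_le (Real.log (ε / R)), le_max_left |Real.log (ε / R)| |Real.log (M / R)|]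
        · linarith [le_abs_self (Real.log (M / R)), le_max_right |Real.log (ε / R)| |Real.log (M / R)|]
      rw [Set.indicator_of_mem hmem]
      apply ENNReal.ofReal_le_ofReal
      gcongr
      rw [abs_mul, abs_of_pos hr]
      gcongr
      have := (fderiv ℝ f ((R * exp s) • (ω : EuclideanSpace ℝ (Fin n)))).le_opNorm ω
      rw [hω, mul_one] at this
      exact this.trans (hC _)
  refine lt_of_le_of_lt (lintegral_mono fun ω => lintegral_mono fun s => key ω s) ?_
  rw [lintegral_const]
  exact ENNReal.mul_lt_top (aux_intfin (by linarith) hT0 _) (measure_lt_top _ _)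

end

theorem stmt_10 (n : ℕ) (γ p q R : ℝ) (hγ : 1 < γ) (hp : max 1 (γ - 1) < p)
    (hq : 1 < q) (hpq : 1 / p + 1 / q = 1 / 2) (hR : 0 < R)
    (f : EuclideanSpace ℝ (Fin n) → ℝ) (hf : ContDiff ℝ (⊤ : ℕ∞) f) (hsupp : HasCompactSupport f)
    (h0 : ∃ ε > (0 : ℝ), ∀ x : EuclideanSpace ℝ (Fin n), ‖x‖ < ε → f x = 0) :
    (∫ x : EuclideanSpace ℝ (Fin n),
        (|fderiv ℝ f x (‖x‖⁻¹ • x)| /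
          (‖x‖ ^ (((n : ℝ) - p) / p) * |Real.log (R / ‖x‖)| ^ ((γ - p) / p))) ^ p) ^ (1 / p) *
      (∫ x : EuclideanSpace ℝ (Fin n), |f x| ^ q) ^ (1 / q) ≥
      ((γ - 1) / p) *
        (∫ x : EuclideanSpace ℝ (Fin n),
          (|f x * (f x - f ((R / ‖x‖) • x))| /
            (‖x‖ ^ ((n : ℝ) / p) * |Real.log (R / ‖x‖)| ^ (γ / p))) ^ (2 : ℝ)) ^ (1 / 2 : ℝ) := by
  obtain ⟨hp1, hpγ⟩ := max_lt_iff.1 hp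
  have hp0 : 0 < p := by linarith
  have hq0 : 0 < q := by linarith
  rcases eq_or_ne n 0 with hn | hn
  · subst hn
    obtain ⟨ε, hε, h0⟩ := h0
    have hz : ∀ x, f x = 0 := fun x => h0 x (by rw [Subsingleton.elim x 0]; simpa using hε)
    have hz' : f = fun _ => 0 := funext hz
    have hp' : p⁻¹ ≠ 0 := by positivity
    have hp'' : p ≠ 0 := by positivity
    simp [hz', Real.zero_rpow]
    positivity
  set k := (γ - 1) / p with hkdef
  have hk : 0 < k := div_pos (by linarith) hp0
  have hCA := aux_CA (γ := γ) hn hR hp1 hγ hf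
  have hAf := aux_Afin (γ := γ) hn hR hp1 hpγ hf hsupp h0
  have hm := aux_meas hf
  have hmf : Measurable f := hf.continuous.measurable
  have hm2 : Measurable (fun x : EuclideanSpace ℝ (Fin n) => f ((R / ‖x‖) • x)) :=
    hmf.comp (by fun_prop)
  have hBf : ∫⁻ x : EuclideanSpace ℝ (Fin n), ENNReal.ofReal (|f x| ^ q) < ⊤ := by
    have hi : Integrable (fun x : EuclideanSpace ℝ (Fin n) => |f x| ^ q) := by
      apply Continuous.integrable_of_hasCompactSupport
      · exact hf.continuous.abs.rpow_const (fun _ => Or.inr hq0.le)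
      · exact hsupp.comp_left (g := fun y => |y| ^ q) (by simp [Real.zero_rpow hq0.ne'])
    exact hi.lintegral_lt_top
  have hH := ENNReal.lintegral_Lp_mul_le_Lq_mul_Lr (p := 2) (q := q) (r := p) (by norm_num)
    (by
      have : 0 < 1 / p := by positivity
      have h3 : 1 / q < 1 / 2 := by linarith
      exact (one_div_lt_one_div hq0 (by norm_num)).1 h3) (by linarith)
    (volume : Measure (EuclideanSpace ℝ (Fin n)))
    (f := fun x => ENNReal.ofReal |f x|)
    (g := fun x => ENNReal.ofReal (|f x - f ((R / ‖x‖) • x)| /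
          (‖x‖ ^ ((n : ℝ) / p) * |Real.log (R / ‖x‖)| ^ (γ / p))))
    (by fun_prop) (by fun_prop)
  have hg0 : ∀ x : EuclideanSpace ℝ (Fin n), 0 ≤ |f x - f ((R / ‖x‖) • x)| /
          (‖x‖ ^ ((n : ℝ) / p) * |Real.log (R / ‖x‖)| ^ (γ / p)) := fun x => by positivity
  simp only [Pi.mul_apply, ← ENNReal.ofReal_mul (abs_nonneg _), ← mul_div_assoc, ← abs_mul] at hH
  have r1 : ∀ x : EuclideanSpace ℝ (Fin n), ENNReal.ofReal (|f x - f ((R / ‖x‖) • x)| /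
          (‖x‖ ^ ((n : ℝ) / p) * |Real.log (R / ‖x‖)| ^ (γ / p))) ^ p =
      ENNReal.ofReal ((|f x - f ((R / ‖x‖) • x)| /
          (‖x‖ ^ ((n : ℝ) / p) * |Real.log (R / ‖x‖)| ^ (γ / p))) ^ p) :=
    fun x => ENNReal.ofReal_rpow_of_nonneg (hg0 x) hp0.le
  have r2 : ∀ x : EuclideanSpace ℝ (Fin n), ENNReal.ofReal |f x| ^ q = ENNReal.ofReal (|f x| ^ q) :=
    fun x => ENNReal.ofReal_rpow_of_nonneg (abs_nonneg _) hq0.le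
  have r3 : ∀ x : EuclideanSpace ℝ (Fin n), ENNReal.ofReal (|f x * (f x - f ((R / ‖x‖) • x))| /
          (‖x‖ ^ ((n : ℝ) / p) * |Real.log (R / ‖x‖)| ^ (γ / p))) ^ (2 : ℝ) =
      ENNReal.ofReal ((|f x * (f x - f ((R / ‖x‖) • x))| /
          (‖x‖ ^ ((n : ℝ) / p) * |Real.log (R / ‖x‖)| ^ (γ / p))) ^ (2 : ℝ)) :=
    fun x => ENNReal.ofReal_rpow_of_nonneg (by positivity) (by norm_num)
  simp only [r1, r2, r3] at hH
  rw [integral_eq_lintegral_of_nonneg_ae (Filter.Eventually.of_forall fun x => by positivity)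
      (by apply Measurable.aestronglyMeasurable; fun_prop),
    integral_eq_lintegral_of_nonneg_ae (Filter.Eventually.of_forall fun x => by positivity)
      (by apply Measurable.aestronglyMeasurable; fun_prop),
    integral_eq_lintegral_of_nonneg_ae (Filter.Eventually.of_forall fun x => by positivity)
      (by apply Measurable.aestronglyMeasurable; fun_prop)]
  have hH2 := hH.trans (mul_le_mul_right (ENNReal.rpow_le_rpow hCA (by positivity : 0 ≤ 1 / p)) _)
  rw [ENNReal.mul_rpow_of_nonneg _ _ (by positivity : 0 ≤ 1 / p),
    ENNReal.ofReal_rpow_of_pos (by positivity), ← Real.rpow_mul hk.le, neg_mul,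
    mul_one_div_cancel hp0.ne', Real.rpow_neg_one] at hH2
  have hH3 := ENNReal.toReal_mono (ENNReal.mul_ne_top
    (ENNReal.rpow_ne_top_of_nonneg (by positivity) hBf.ne) (ENNReal.mul_ne_top ENNReal.ofReal_ne_top
    (ENNReal.rpow_ne_top_of_nonneg (by positivity) hAf.ne))) hH2
  rw [ENNReal.toReal_mul, ENNReal.toReal_mul, ← ENNReal.toReal_rpow, ← ENNReal.toReal_rpow,
    ← ENNReal.toReal_rpow, ENNReal.toReal_ofReal (by positivity)] at hH3
  refine (mul_le_mul_of_nonneg_left hH3 hk.le).trans (le_of_eq ?_)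
  field_simp
end

section
/- Let n ≥ 1 and 1 < p < ∞. Then for every f ∈ C_0^∞(ℝ^n \ {0}) and every R > 0, ‖(f − f_R)/(|x|^{n/p} log(R/|x|))‖_{L^p(ℝ^n)} ≤ (p/(p−1)) · ‖(x/|x| · ∇f)/|x|^{(n−p)/p}‖_{L^p(ℝ^n)}, where f_R(x) = f(R x/|x|). -/
open Real MeasureTheory

/-- Polar coordinates with `r = R * exp t`. -/
lemma polar_exp (n : ℕ) (hn : 1 ≤ n) (R : ℝ) (hR : 0 < R)
    (F : EuclideanSpace ℝ (Fin n) → ENNReal) (hF : Measurable F) :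
    ∫⁻ x, F x = ∫⁻ w : Metric.sphere (0 : EuclideanSpace ℝ (Fin n)) 1,
      (∫⁻ t : ℝ, ENNReal.ofReal ((R * Real.exp t) ^ n) * F ((R * Real.exp t) • w.1))
        ∂(volume : Measure (EuclideanSpace ℝ (Fin n))).toSphere := by
  have : Nonempty (Fin n) := ⟨⟨0, hn⟩⟩
  have hfr : Module.finrank ℝ (EuclideanSpace ℝ (Fin n)) = n := by simp
  have h1 : ∫⁻ x, F x = ∫⁻ x : ({0}ᶜ : Set (EuclideanSpace ℝ (Fin n))), F x
      ∂(Measure.comap Subtype.val volume) := by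
    rw [lintegral_subtype_comap (measurableSet_singleton _).compl F,
      restrict_compl_singleton]
  have hmp := (volume : Measure (EuclideanSpace ℝ (Fin n))).measurePreserving_homeomorphUnitSphereProd
  have h2 : ∫⁻ x : ({0}ᶜ : Set (EuclideanSpace ℝ (Fin n))), F x ∂(Measure.comap Subtype.val volume)
      = ∫⁻ z, F (z.2.1 • z.1.1) ∂((volume : Measure (EuclideanSpace ℝ (Fin n))).toSphere.prod
          (Measure.volumeIoiPow (n - 1))) := by
    rw [hfr] at hmp
    have := hmp.lintegral_comp_emb (Homeomorph.measurableEmbedding _)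
      (fun z => F (z.2.1 • z.1.1))
    rw [← this]
    refine lintegral_congr fun x => ?_
    congr 1
    have hx : ‖x.1‖ ≠ 0 := norm_ne_zero_iff.2 x.2
    simp [smul_smul, hx]
  have hm : Measurable (fun z : Metric.sphere (0 : EuclideanSpace ℝ (Fin n)) 1 × Set.Ioi (0:ℝ) =>
      F (z.2.1 • z.1.1)) := by
    apply hF.comp
    fun_prop
  rw [h1, h2, lintegral_prod _ hm.aemeasurable]
  refine lintegral_congr fun w => ?_
  have hm2 : Measurable (fun r : Set.Ioi (0:ℝ) => F (r.1 • w.1)) := by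
    apply hF.comp
    fun_prop
  rw [Measure.volumeIoiPow, lintegral_withDensity_eq_lintegral_mul _ (by fun_prop) hm2]
  simp only [Pi.mul_apply]
  rw [lintegral_subtype_comap measurableSet_Ioi
    (fun r : ℝ => ENNReal.ofReal (r ^ (n - 1)) * F (r • w.1))]
  have himg : (fun t : ℝ => R * Real.exp t) '' Set.univ = Set.Ioi 0 := by
    ext r
    simp only [Set.image_univ, Set.mem_range, Set.mem_Ioi]
    constructor
    · rintro ⟨t, rfl⟩
      positivity
    · intro hr
      refine ⟨Real.log (r / R), ?_⟩
      rw [Real.exp_log (by positivity)]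
      field_simp
  rw [← himg, lintegral_image_eq_lintegral_abs_deriv_mul (f' := fun t => R * Real.exp t)
    MeasurableSet.univ (fun t _ => ((Real.hasDerivAt_exp t).const_mul R).hasDerivWithinAt)
    (by
      intro a _ b _ h
      simpa [hR.ne'] using h), Measure.restrict_univ]
  refine lintegral_congr fun t => ?_
  have ht : 0 < R * Real.exp t := by positivity
  rw [← mul_assoc, abs_of_pos ht, ← ENNReal.ofReal_mul ht.le, ← pow_succ', Nat.sub_add_cancel hn]

lemma scale1d (g : ℝ → ENNReal) (hg : Measurable g) (s : ℝ) (hs : 0 < s) :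
    ∫⁻ t, g (s * t) = ENNReal.ofReal s⁻¹ * ∫⁻ t, g t := by
  rw [← lintegral_map hg (measurable_const_mul s), Real.map_volume_mul_left hs.ne',
    lintegral_smul_measure, abs_of_pos (inv_pos.2 hs), smul_eq_mul]

lemma lint_rpow (b : ℝ) (hb : -1 < b) :
    ∫⁻ s in Set.Ioc (0:ℝ) 1, ENNReal.ofReal (s ^ b) = ENNReal.ofReal (1 / (b + 1)) := by
  rw [← ofReal_integral_eq_lintegral_ofReal]
  · rw [← intervalIntegral.integral_of_le zero_le_one, integral_rpow (Or.inl hb)]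
    rw [Real.one_rpow, Real.zero_rpow (by linarith), sub_zero]
  · exact (intervalIntegral.intervalIntegrable_rpow' hb).1
  · filter_upwards [ae_restrict_mem measurableSet_Ioc] with s hs
    exact Real.rpow_nonneg hs.1.le _

lemma hardy_pointwise (p : ℝ) (hp : 1 < p) (h h' : ℝ → ℝ) (hd : ∀ t, HasDerivAt h (h' t) t)
    (hc : Continuous h') (t : ℝ) :
    ENNReal.ofReal ((|h t - h 0| / |t|) ^ p) ≤
      ENNReal.ofReal ((p / (p - 1)) ^ (p - 1)) *
      ∫⁻ s in Set.Ioc (0:ℝ) 1, ENNReal.ofReal (s ^ ((p - 1) / p)) *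
        ENNReal.ofReal (|h' (s * t)| ^ p) := by
  have hp0 : 0 < p := by linarith
  have hp1 : 0 < p - 1 := by linarith
  rcases eq_or_ne t 0 with rfl | ht
  · simp [Real.zero_rpow hp0.ne']
  have hq : p.HolderConjugate (p / (p - 1)) := Real.HolderConjugate.conjExponent hp
  set q := p / (p - 1) with hqdef
  have hq0 : 0 < q := by positivity
  -- fundamental theorem of calculus
  have ftc : ∫ s in (0:ℝ)..1, t * h' (s * t) = h t - h 0 := by
    have := intervalIntegral.integral_eq_sub_of_hasDerivAt (a := 0) (b := 1)
      (f := fun s => h (s * t)) (f' := fun s => t * h' (s * t))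
      (fun s _ => by
        have := (hd (s * t)).comp s ((hasDerivAt_id s).mul_const t)
        simpa [mul_comm, Function.comp_def] using this)
      (Continuous.intervalIntegrable (by fun_prop) _ _)
    simpa using this
  have hle : |h t - h 0| / |t| ≤ ∫ s in (0:ℝ)..1, |h' (s * t)| := by
    rw [div_le_iff₀ (abs_pos.2 ht), ← ftc, intervalIntegral.integral_const_mul, abs_mul, mul_comm]
    gcongr
    exact intervalIntegral.abs_integral_le_integral_abs zero_le_one
  have hle2 : ENNReal.ofReal (|h t - h 0| / |t|) ≤
      ∫⁻ s in Set.Ioc (0:ℝ) 1, ENNReal.ofReal |h' (s * t)| := by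
    rw [← ofReal_integral_eq_lintegral_ofReal, ← intervalIntegral.integral_of_le zero_le_one]
    · exact ENNReal.ofReal_le_ofReal hle
    · exact (Continuous.intervalIntegrable (by fun_prop) _ _).1
    · exact Filter.Eventually.of_forall fun s => abs_nonneg _
  set a : ℝ := (p - 1) / p ^ 2 with ha
  let A : ℝ → ENNReal := fun s => ENNReal.ofReal (s ^ a * |h' (s * t)|)
  let B : ℝ → ENNReal := fun s => ENNReal.ofReal (s ^ (-a))
  have hAm : Measurable A := by
    have := hc.measurable
    fun_prop
  have hBm : Measurable B := by fun_prop
  have hAB : ∫⁻ s in Set.Ioc (0:ℝ) 1, ENNReal.ofReal |h' (s * t)| =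
      ∫⁻ s in Set.Ioc (0:ℝ) 1, (A * B) s := by
    refine setLIntegral_congr_fun measurableSet_Ioc fun s hs => ?_
    have hs0 : 0 < s := hs.1
    simp only [A, B, Pi.mul_apply]
    rw [← ENNReal.ofReal_mul (by positivity), mul_right_comm, ← Real.rpow_add hs0]
    simp
  have hold := ENNReal.lintegral_mul_le_Lp_mul_Lq (volume.restrict (Set.Ioc (0:ℝ) 1)) hq
    hAm.aemeasurable hBm.aemeasurable
  have hAp : ∫⁻ s in Set.Ioc (0:ℝ) 1, A s ^ p = ∫⁻ s in Set.Ioc (0:ℝ) 1,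
      ENNReal.ofReal (s ^ ((p - 1) / p)) * ENNReal.ofReal (|h' (s * t)| ^ p) := by
    refine setLIntegral_congr_fun measurableSet_Ioc fun s hs => ?_
    have hs0 : 0 < s := hs.1
    simp only [A]
    rw [ENNReal.ofReal_rpow_of_nonneg (by positivity) hp0.le, ← ENNReal.ofReal_mul (by positivity),
      Real.mul_rpow (by positivity) (abs_nonneg _), ← Real.rpow_mul hs0.le]
    congr 3
    rw [ha]; field_simp
  have hBq : ∫⁻ s in Set.Ioc (0:ℝ) 1, B s ^ q = ENNReal.ofReal q := by
    have e : ∫⁻ s in Set.Ioc (0:ℝ) 1, B s ^ q =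
        ∫⁻ s in Set.Ioc (0:ℝ) 1, ENNReal.ofReal (s ^ (-(1 / p))) := by
      refine setLIntegral_congr_fun measurableSet_Ioc fun s hs => ?_
      have hs0 : 0 < s := hs.1
      simp only [B]
      rw [ENNReal.ofReal_rpow_of_nonneg (by positivity) hq0.le, ← Real.rpow_mul hs0.le]
      congr 2
      rw [ha, hqdef]; field_simp
    have hlt : 1 / p < 1 := by rw [div_lt_one hp0]; exact hp
    rw [e, lint_rpow _ (by linarith)]
    congr 1
    have : -(1 / p) + 1 = (p - 1) / p := by field_simp; ring
    rw [this, hqdef, one_div_div]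
  rw [← ENNReal.ofReal_rpow_of_nonneg (by positivity) hp0.le]
  calc ENNReal.ofReal (|h t - h 0| / |t|) ^ p
      ≤ ((∫⁻ s in Set.Ioc (0:ℝ) 1, A s ^ p) ^ (1 / p) *
          (∫⁻ s in Set.Ioc (0:ℝ) 1, B s ^ q) ^ (1 / q)) ^ p :=
        ENNReal.rpow_le_rpow ((hle2.trans_eq hAB).trans hold) hp0.le
    _ = _ := by
        rw [ENNReal.mul_rpow_of_nonneg _ _ hp0.le, ← ENNReal.rpow_mul, ← ENNReal.rpow_mul, hAp, hBq,
          one_div_mul_cancel hp0.ne', ENNReal.rpow_one, mul_comm,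
          ← ENNReal.ofReal_rpow_of_nonneg hq0.le hp1.le]
        congr 2
        rw [hqdef]; field_simp

lemma hardy1d (p : ℝ) (hp : 1 < p) (h h' : ℝ → ℝ) (hd : ∀ t, HasDerivAt h (h' t) t)
    (hc : Continuous h') :
    ∫⁻ t, ENNReal.ofReal ((|h t - h 0| / |t|) ^ p) ≤
      ENNReal.ofReal ((p / (p - 1)) ^ p) * ∫⁻ t, ENNReal.ofReal (|h' t| ^ p) := by
  have hp0 : 0 < p := by linarith
  have hp1 : 0 < p - 1 := by linarith
  have hm := hc.measurable
  calc _ ≤ ∫⁻ t, ENNReal.ofReal ((p / (p - 1)) ^ (p - 1)) *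
      ∫⁻ s in Set.Ioc (0:ℝ) 1, ENNReal.ofReal (s ^ ((p - 1) / p)) *
        ENNReal.ofReal (|h' (s * t)| ^ p) :=
        lintegral_mono fun t => hardy_pointwise p hp h h' hd hc t
    _ = ENNReal.ofReal ((p / (p - 1)) ^ (p - 1)) * ∫⁻ s in Set.Ioc (0:ℝ) 1, ∫⁻ t,
        ENNReal.ofReal (s ^ ((p - 1) / p)) * ENNReal.ofReal (|h' (s * t)| ^ p) := by
        rw [lintegral_const_mul' _ _ ENNReal.ofReal_ne_top, lintegral_lintegral_swap]
        refine Measurable.aemeasurable ?_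
        fun_prop
    _ = ENNReal.ofReal ((p / (p - 1)) ^ (p - 1)) * ∫⁻ s in Set.Ioc (0:ℝ) 1,
        ENNReal.ofReal (s ^ (-(1 / p))) * ∫⁻ t, ENNReal.ofReal (|h' t| ^ p) := by
        congr 1
        refine setLIntegral_congr_fun measurableSet_Ioc fun s hs => ?_
        have hs0 : 0 < s := hs.1
        rw [lintegral_const_mul' _ _ ENNReal.ofReal_ne_top,
          scale1d (fun t => ENNReal.ofReal (|h' t| ^ p)) (by fun_prop) s hs0, ← mul_assoc,
          ← ENNReal.ofReal_mul (by positivity), ← Real.rpow_neg_one, ← Real.rpow_add hs0]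
        congr 3
        field_simp; ring
    _ = _ := by
        have hlt : 1 / p < 1 := by rw [div_lt_one hp0]; exact hp
        rw [lintegral_mul_const _ (by fun_prop), lint_rpow _ (by linarith), ← mul_assoc,
          ← ENNReal.ofReal_mul (by positivity)]
        congr 2
        have : -(1 / p) + 1 = (p - 1) / p := by field_simp; ring
        rw [this, one_div_div]
        nth_rewrite 2 [← Real.rpow_one (p / (p - 1))]
        rw [← Real.rpow_add (by positivity)]
        congr 1; ring

theorem stmt_11 (n : ℕ) (hn : 1 ≤ n) (p R : ℝ) (hp : 1 < p) (hR : 0 < R)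
    (f : EuclideanSpace ℝ (Fin n) → ℝ) (hf : ContDiff ℝ (⊤ : ℕ∞) f) (hsupp : HasCompactSupport f)
    (h0 : ∃ ε > (0 : ℝ), ∀ x : EuclideanSpace ℝ (Fin n), ‖x‖ < ε → f x = 0) :
    (∫ x : EuclideanSpace ℝ (Fin n),
        (|f x - f ((R / ‖x‖) • x)| /
          (‖x‖ ^ ((n : ℝ) / p) * |Real.log (R / ‖x‖)|)) ^ p) ^ (1 / p) ≤
      (p / (p - 1)) *
        (∫ x : EuclideanSpace ℝ (Fin n),
          (|fderiv ℝ f x (‖x‖⁻¹ • x)| / ‖x‖ ^ (((n : ℝ) - p) / p)) ^ p) ^ (1 / p) := by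
  have hp0 : 0 < p := by linarith
  have hp1 : 0 < p - 1 := by linarith
  have hfc : Continuous f := hf.continuous
  have hfd : Differentiable ℝ f := hf.differentiable (by simp)
  have hdc : Continuous (fderiv ℝ f) := hf.continuous_fderiv (by simp)
  set L : EuclideanSpace ℝ (Fin n) → ℝ := fun x => (|f x - f ((R / ‖x‖) • x)| /
          (‖x‖ ^ ((n : ℝ) / p) * |Real.log (R / ‖x‖)|)) ^ p with hL
  set G : EuclideanSpace ℝ (Fin n) → ℝ := fun x =>
    (|fderiv ℝ f x (‖x‖⁻¹ • x)| / ‖x‖ ^ (((n : ℝ) - p) / p)) ^ p with hG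
  have hLm : Measurable L := by
    have := hfc.measurable
    have h2 : Measurable (fun x : EuclideanSpace ℝ (Fin n) => (R / ‖x‖) • x) := by fun_prop
    have h3 := this.comp h2
    simp only [Function.comp_def] at h3
    fun_prop
  have hGc : Continuous G := by
    rw [continuous_iff_continuousAt]
    intro x
    rcases eq_or_ne x 0 with rfl | hx
    · obtain ⟨ε, hε, h0⟩ := h0
      have : G =ᶠ[nhds 0] fun _ => 0 := by
        filter_upwards [Metric.ball_mem_nhds (0 : EuclideanSpace ℝ (Fin n)) hε] with y hy
        have hy' : f =ᶠ[nhds y] fun _ => 0 := by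
          filter_upwards [Metric.isOpen_ball.mem_nhds hy] with z hz
          exact h0 z (by simpa using hz)
        simp [hG, hy'.fderiv_eq, Real.zero_rpow hp0.ne']
      exact continuousAt_const.congr this.symm
    · have hx' : ‖x‖ ≠ 0 := norm_ne_zero_iff.2 hx
      have h1 : ContinuousAt (fun y : EuclideanSpace ℝ (Fin n) => ‖y‖) x := by fun_prop
      have h2 : ContinuousAt (fun y => fderiv ℝ f y (‖y‖⁻¹ • y)) x :=
        hdc.continuousAt.clm_apply ((h1.inv₀ hx').smul continuousAt_id)
      refine ContinuousAt.rpow_const (h2.abs.div (h1.rpow_const (Or.inl hx')) ?_) (Or.inr hp0.le)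
      exact (Real.rpow_pos_of_pos (norm_pos_iff.2 hx) _).ne'
  have hGs : HasCompactSupport G := by
    refine (hsupp.fderiv ℝ).mono ?_
    intro x hx
    contrapose! hx
    have hx' : fderiv ℝ f x = 0 := by simpa using hx
    simp [hG, hx', Real.zero_rpow hp0.ne']
  have hGi : Integrable G := hGc.integrable_of_hasCompactSupport hGs
  have hL0 : ∀ x, 0 ≤ L x := fun x => by positivity
  have hG0 : ∀ x, 0 ≤ G x := fun x => by positivity
  have key : ∫⁻ x, ENNReal.ofReal (L x) ≤
      ENNReal.ofReal ((p / (p - 1)) ^ p) * ∫⁻ x, ENNReal.ofReal (G x) := by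
    rw [polar_exp n hn R hR _ hLm.ennreal_ofReal,
      polar_exp n hn R hR _ hGc.measurable.ennreal_ofReal,
      ← lintegral_const_mul' _ _ ENNReal.ofReal_ne_top]
    refine lintegral_mono fun w => ?_
    have hw : ‖w.1‖ = 1 := by simp
    have hrn : ∀ t : ℝ, ‖(R * Real.exp t) • w.1‖ = R * Real.exp t := fun t => by
      rw [norm_smul, hw, mul_one, Real.norm_eq_abs, abs_of_pos (by positivity)]
    have := hardy1d p hp (fun t => f ((R * Real.exp t) • w.1))
      (fun t => fderiv ℝ f ((R * Real.exp t) • w.1) ((R * Real.exp t) • w.1))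
      (fun t => by
        have := ((hfd ((R * Real.exp t) • w.1)).hasFDerivAt).comp_hasDerivAt t
          (((Real.hasDerivAt_exp t).const_mul R).smul_const w.1)
        exact this)
      (by fun_prop)
    refine le_trans (le_of_eq ?_) (this.trans (le_of_eq ?_))
    · refine lintegral_congr fun t => ?_
      have hr : 0 < R * Real.exp t := by positivity
      rw [← ENNReal.ofReal_mul (by positivity)]
      congr 1
      simp only [hL, hrn]
      have e1 : (R / (R * Real.exp t)) • (R * Real.exp t) • w.1 = (R * Real.exp 0) • w.1 := by
        rw [smul_smul]; congr 1; simp; field_simp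
      have e2 : Real.log (R / (R * Real.exp t)) = - t := by
        rw [div_mul_cancel_left₀ hR.ne', ← Real.exp_neg, Real.log_exp]
      rw [e1, e2, abs_neg, mul_comm (_ ^ ((n:ℝ) / p)), ← div_div,
        Real.div_rpow (by positivity) (by positivity) p, ← Real.rpow_mul hr.le,
        div_mul_cancel₀ _ hp0.ne', Real.rpow_natCast]
      field_simp
    · congr 1
      refine lintegral_congr fun t => ?_
      have hr : 0 < R * Real.exp t := by positivity
      rw [← ENNReal.ofReal_mul (by positivity)]
      congr 1
      simp only [hG, hrn]
      rw [inv_smul_smul₀ hr.ne', map_smul, smul_eq_mul, abs_mul, abs_of_pos hr,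
        Real.div_rpow (by positivity) (by positivity) p, ← Real.rpow_mul hr.le,
        div_mul_cancel₀ _ hp0.ne', Real.rpow_sub hr, Real.rpow_natCast,
        Real.mul_rpow hr.le (abs_nonneg _)]
      field_simp
  have main : ∫ x, L x ≤ (p / (p - 1)) ^ p * ∫ x, G x := by
    have hGI : 0 ≤ ∫ x, G x := integral_nonneg hG0
    rw [integral_eq_lintegral_of_nonneg_ae (Filter.Eventually.of_forall hL0)
      hLm.aestronglyMeasurable]
    refine ENNReal.toReal_le_of_le_ofReal (by positivity) ?_
    rw [ENNReal.ofReal_mul (by positivity),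
      ofReal_integral_eq_lintegral_ofReal hGi (Filter.Eventually.of_forall hG0)]
    exact key
  have hGI : 0 ≤ ∫ x, G x := integral_nonneg hG0
  calc (∫ x, L x) ^ (1 / p) ≤ ((p / (p - 1)) ^ p * ∫ x, G x) ^ (1 / p) :=
        Real.rpow_le_rpow (integral_nonneg hL0) main (by positivity)
    _ = _ := by
        rw [Real.mul_rpow (by positivity) hGI, ← Real.rpow_mul (by positivity),
          mul_one_div_cancel hp0.ne', Real.rpow_one]
end

section
/- Let n ≥ 1, a, b > 0, 1 < p < ∞, α, β ∈ ℝ with αβ > 0 and pm ≤ n − p. Then for every f ∈ C_0^∞(ℝ^n \ {0}), ((n − pm − p)/p) · ‖(a + b|x|^α)^{β/p} f / |x|^{m+1}‖_{L^p(ℝ^n)} ≤ ‖(a + b|x|^α)^{β/p} ∇f / |x|^m‖_{L^p(ℝ^n)}. -/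
open Real MeasureTheory

section Helpers

lemma hardy_cont {E : Type*} [NormedAddCommGroup E] (g : E → ℝ)
    (h1 : ∀ x, x ≠ 0 → ContinuousAt g x) (h2 : g =ᶠ[nhds 0] fun _ => 0) : Continuous g := by
  rw [continuous_iff_continuousAt]
  intro x
  by_cases hx : x = 0
  · subst hx
    exact (continuousAt_const (y := (0:ℝ))).congr h2.symm
  · exact h1 x hx

lemma hardy_deriv (a b p α β c r : ℝ) (ha : 0 < a) (hb : 0 < b) (hp : 1 < p) (hr : 0 < r)
    (φ : ℝ → ℝ) (d : ℝ) (hφ : HasDerivAt φ d 1) :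
    HasDerivAt (fun t : ℝ => (a + b * (t * r) ^ α) ^ β * (t * r) ^ (-c) * |φ t| ^ p)
      ((α * β * b * r ^ α * (a + b * r ^ α) ^ (β - 1) * r ^ (-c)
        - c * ((a + b * r ^ α) ^ β * r ^ (-c))) * |φ 1| ^ p
        + (a + b * r ^ α) ^ β * r ^ (-c) * (p * |φ 1| ^ (p - 2) * φ 1 * d)) 1 := by
  have hA : 0 < a + b * r ^ α := by positivity
  have e1 : HasDerivAt (fun t : ℝ => t * r) r 1 := by
    simpa using (hasDerivAt_id (1:ℝ)).mul_const r
  have e2 := e1.rpow_const (p := α) (Or.inl (by simpa using hr.ne'))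
  have e3 := e1.rpow_const (p := -c) (Or.inl (by simpa using hr.ne'))
  have e4 := ((e2.const_mul b).const_add a).rpow_const (p := β)
    (Or.inl (by simpa using hA.ne'))
  have e5 := (hasDerivAt_abs_rpow (φ 1) hp).comp 1 hφ
  have e6 := (e4.mul e3).mul e5
  refine e6.congr_deriv ?_
  have k1 : r * r ^ (α - 1) = r ^ α := by
    rw [Real.rpow_sub_one hr.ne']; field_simp
  have k2 : r * r ^ (-c - 1) = r ^ (-c) := by
    rw [Real.rpow_sub_one hr.ne']; field_simp
  simp only [Pi.mul_apply, Function.comp, one_mul]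
  rw [← k1, ← k2]
  ring

lemma hardy_hpow (A F r p β m : ℝ) (hA : 0 ≤ A) (hF : 0 ≤ F) (hr : 0 ≤ r) (hp : 1 < p) :
    (A ^ (β / p) * F / r ^ (m + 1)) ^ p = A ^ β * r ^ (-(p * m + p)) * F ^ p := by
  rw [Real.div_rpow (by positivity) (by positivity), Real.mul_rpow (by positivity) hF,
    ← Real.rpow_mul hA, ← Real.rpow_mul hr, Real.rpow_neg hr]
  rw [div_mul_cancel₀ _ (by linarith : p ≠ 0), show (m + 1) * p = p * m + p by ring]
  ring

lemma hardy_uv (A F G r p β m : ℝ) (hA : 0 < A) (hF : 0 ≤ F) (hr : 0 < r) (hp : 1 < p) :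
    (A ^ (β / p) * F / r ^ (m + 1)) ^ (p - 1) * (A ^ (β / p) * G / r ^ m)
      = A ^ β * r ^ (-(p * m + p)) * (F ^ (p - 1) * (G * r)) := by
  have hp0 : p ≠ 0 := by linarith
  rw [Real.div_rpow (by positivity) (by positivity), Real.mul_rpow (by positivity) hF,
    ← Real.rpow_mul hA.le, ← Real.rpow_mul hr.le]
  have k1 : A ^ β = A ^ (β / p * (p - 1)) * A ^ (β / p) := by
    rw [← Real.rpow_add hA]; congr 1; field_simp; ring
  have k2 : r ^ ((m + 1) * (p - 1)) * r ^ m * r ^ (-(p * m + p)) * r = 1 := by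
    rw [← Real.rpow_add hr, ← Real.rpow_add hr, ← Real.rpow_add_one hr.ne']
    rw [show (m + 1) * (p - 1) + m + -(p * m + p) + 1 = 0 by ring, Real.rpow_zero]
  have h1 := (Real.rpow_pos_of_pos hr ((m + 1) * (p - 1))).ne'
  have h2 := (Real.rpow_pos_of_pos hr m).ne'
  rw [k1, div_mul_div_comm, div_eq_iff (by positivity)]
  linear_combination (-(A ^ (β / p * (p - 1)) * A ^ (β / p) * F ^ (p - 1) * G)) * k2

end Helpers

theorem stmt_12 (n : ℕ) (hn : 1 ≤ n) (a b p α β m : ℝ) (ha : 0 < a) (hb : 0 < b)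
    (hp : 1 < p) (hαβ : 0 < α * β) (hm : p * m ≤ (n : ℝ) - p)
    (f : EuclideanSpace ℝ (Fin n) → ℝ) (hf : ContDiff ℝ (⊤ : ℕ∞) f) (hsupp : HasCompactSupport f)
    (h0 : ∃ ε > (0 : ℝ), ∀ x : EuclideanSpace ℝ (Fin n), ‖x‖ < ε → f x = 0) :
    (((n : ℝ) - p * m - p) / p) *
        (∫ x : EuclideanSpace ℝ (Fin n),
          ((a + b * ‖x‖ ^ α) ^ (β / p) * |f x| / ‖x‖ ^ (m + 1)) ^ p) ^ (1 / p) ≤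
      (∫ x : EuclideanSpace ℝ (Fin n),
        ((a + b * ‖x‖ ^ α) ^ (β / p) * ‖fderiv ℝ f x‖ / ‖x‖ ^ m) ^ p) ^ (1 / p) := by
  have hp0 : 0 < p := by linarith
  set u : EuclideanSpace ℝ (Fin n) → ℝ :=
    fun x => (a + b * ‖x‖ ^ α) ^ (β / p) * |f x| / ‖x‖ ^ (m + 1) with hu
  set v : EuclideanSpace ℝ (Fin n) → ℝ :=
    fun x => (a + b * ‖x‖ ^ α) ^ (β / p) * ‖fderiv ℝ f x‖ / ‖x‖ ^ m with hv
  change (((n : ℝ) - p * m - p) / p) * (∫ x, u x ^ p) ^ (1 / p) ≤ (∫ x, v x ^ p) ^ (1 / p)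
  have hA : ∀ x : EuclideanSpace ℝ (Fin n), 0 < a + b * ‖x‖ ^ α := fun x => by positivity
  have hf0 : f =ᶠ[nhds 0] fun _ => 0 := by
    obtain ⟨ε, hε, h⟩ := h0
    filter_upwards [Metric.ball_mem_nhds 0 hε] with x hx
    exact h x (by simpa using hx)
  have hdf0 : fderiv ℝ f =ᶠ[nhds 0] fun _ => 0 := by
    filter_upwards [hf0.eventuallyEq_nhds] with x hx
    rw [hx.fderiv_eq]; simp
  have hunn : ∀ x, 0 ≤ u x := fun x => by have := hA x; positivity
  have hvnn : ∀ x, 0 ≤ v x := fun x => by have := hA x; positivity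
  have hcA : ∀ (q : ℝ) (x : EuclideanSpace ℝ (Fin n)), x ≠ 0 →
      ContinuousAt (fun x : EuclideanSpace ℝ (Fin n) => (a + b * ‖x‖ ^ α) ^ q) x := by
    intro q x hx
    have : ContinuousAt (fun x : EuclideanSpace ℝ (Fin n) => ‖x‖ ^ α) x :=
      continuous_norm.continuousAt.rpow_const (Or.inl (norm_ne_zero_iff.2 hx))
    exact ((this.const_mul b).const_add a).rpow_const (Or.inl (hA x).ne')
  have hcr : ∀ (q : ℝ) (x : EuclideanSpace ℝ (Fin n)), x ≠ 0 →
      ContinuousAt (fun x : EuclideanSpace ℝ (Fin n) => ‖x‖ ^ q) x := fun q x hx =>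
      continuous_norm.continuousAt.rpow_const (Or.inl (norm_ne_zero_iff.2 hx))
  have hrne : ∀ (q : ℝ) (x : EuclideanSpace ℝ (Fin n)), x ≠ 0 → ‖x‖ ^ q ≠ 0 := fun q x hx =>
    (Real.rpow_pos_of_pos (norm_pos_iff.2 hx) q).ne'
  have hcdf : Continuous (fderiv ℝ f) := hf.continuous_fderiv (by simp)
  have hcu : Continuous u := by
    apply hardy_cont
    · intro x hx
      exact ((hcA _ x hx).mul hf.continuous.abs.continuousAt).div (hcr _ x hx) (hrne _ x hx)
    · filter_upwards [hf0] with x hx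
      simp [hu, hx]
  have hcv : Continuous v := by
    apply hardy_cont
    · intro x hx
      exact ((hcA _ x hx).mul hcdf.norm.continuousAt).div (hcr _ x hx) (hrne _ x hx)
    · filter_upwards [hdf0] with x hx
      simp [hv, hx]
  have hsu : HasCompactSupport u := hsupp.mono (by
    intro x hx hfx; apply hx; simp [hu, hfx])
  have hsv : HasCompactSupport v := (hsupp.fderiv ℝ).mono (by
    intro x hx hfx; apply hx; simp [hv, hfx])
  set h : EuclideanSpace ℝ (Fin n) → ℝ :=
    fun x => (a + b * ‖x‖ ^ α) ^ β * ‖x‖ ^ (-(p * m + p)) * |f x| ^ p with hh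
  have huh : ∀ x, u x ^ p = h x := fun x =>
    hardy_hpow _ _ _ _ _ _ (hA x).le (abs_nonneg _) (norm_nonneg _) hp
  have hhC : ContDiff ℝ 1 h := by
    rw [contDiff_iff_contDiffAt]
    intro x
    by_cases hx : x = 0
    · subst hx
      refine (contDiffAt_const (c := (0:ℝ))).congr_of_eventuallyEq ?_
      filter_upwards [hf0] with x hx
      simp [hh, hx, Real.zero_rpow hp0.ne']
    · have hn1 : ContDiffAt ℝ 1 (fun x : EuclideanSpace ℝ (Fin n) => ‖x‖) x :=
        contDiffAt_norm ℝ hx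
      have hxn := norm_ne_zero_iff.2 hx
      have h1 := (contDiffAt_const (c := a)).add
        ((contDiffAt_const (c := b)).mul (hn1.rpow_const_of_ne (p := α) hxn))
      have h3 : ContDiff ℝ 1 (fun x => ‖f x‖ ^ p) :=
        (hf.of_le (by exact_mod_cast le_top)).norm_rpow hp
      exact ((h1.rpow_const_of_ne (hA x).ne').mul
        (hn1.rpow_const_of_ne hxn)).mul h3.contDiffAt
  have hsh : HasCompactSupport h := hsupp.mono (by
    intro x hx hfx; apply hx; simp [hh, hfx, Real.zero_rpow hp0.ne'])
  have hcdh : Continuous (fderiv ℝ h) := hhC.continuous_fderiv (by simp)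
  have hint : Integrable h := hhC.continuous.integrable_of_hasCompactSupport hsh
  have hparts : ∀ i : Fin n, ∫ x, fderiv ℝ h x (EuclideanSpace.single i 1) * x i = - ∫ x, h x := by
    intro i
    have hL : ∀ x, fderiv ℝ (fun x : EuclideanSpace ℝ (Fin n) => x i) x
        (EuclideanSpace.single i 1) = 1 := by
      intro x
      have : fderiv ℝ (fun x : EuclideanSpace ℝ (Fin n) => x i) x
         = EuclideanSpace.proj i := 
          (EuclideanSpace.proj i : EuclideanSpace ℝ (Fin n) →L[ℝ] ℝ).hasFDerivAt.fderiv
      rw [this]; simp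
    have key := integral_mul_fderiv_eq_neg_fderiv_mul_of_integrable (μ := volume)
      (f := h) (g := fun x : EuclideanSpace ℝ (Fin n) => x i) (v := EuclideanSpace.single i 1)
      ?_ ?_ ?_ (fun x _ => hhC.differentiable (by simp) x) (fun x _ => by fun_prop)
    · simp only [hL, mul_one] at key
      linarith
    · refine Continuous.integrable_of_hasCompactSupport (by fun_prop) ?_
      exact HasCompactSupport.mul_right ((hsh.fderiv_apply ℝ _))
    · simpa only [hL, mul_one] using hint
    · refine Continuous.integrable_of_hasCompactSupport ?_ hsh.mul_right
      exact hhC.continuous.mul (by fun_prop)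
  have hsum : ∫ x, fderiv ℝ h x x = - (n * ∫ x, h x) := by
    have e : ∀ x, fderiv ℝ h x x = ∑ i, fderiv ℝ h x (EuclideanSpace.single i 1) * x i := by
      intro x
      have e2 := congrArg (fderiv ℝ h x) ((EuclideanSpace.basisFun (Fin n) ℝ).sum_repr x)
      rw [← e2]
      simp [mul_comm]
    simp_rw [e]
    rw [integral_finsetSum]
    · simp [hparts]
    · intro i _
      refine Continuous.integrable_of_hasCompactSupport (by fun_prop) ?_
      exact HasCompactSupport.mul_right ((hsh.fderiv_apply ℝ _))
  have hpt : ∀ x, -(p * m + p) * h x - p * (u x ^ (p - 1) * v x) ≤ fderiv ℝ h x x := by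
    intro x
    by_cases hx : x = 0
    · subst hx
      have hfz : f 0 = 0 := hf0.self_of_nhds
      have hdz : fderiv ℝ f 0 = 0 := hdf0.self_of_nhds
      simp [hh, hv, hfz, hdz, Real.zero_rpow hp0.ne']
    · have hr : 0 < ‖x‖ := norm_pos_iff.2 hx
      have l1 : HasDerivAt (fun t : ℝ => t • x) x 1 := by
        simpa using (hasDerivAt_id (1:ℝ)).smul_const x
      have l2 : HasDerivAt (fun t : ℝ => f (t • x)) (fderiv ℝ f x x) 1 := by
        have := (hf.differentiable (by simp) ((1:ℝ) • x)).hasFDerivAt.comp_hasDerivAt 1 l1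
        rw [one_smul] at this
        exact this
      have l3 : HasDerivAt (fun t : ℝ => h (t • x)) (fderiv ℝ h x x) 1 := by
        have := (hhC.differentiable (by simp) ((1:ℝ) • x)).hasFDerivAt.comp_hasDerivAt 1 l1
        rw [one_smul] at this
        exact this
      have l4 := hardy_deriv a b p α β (p * m + p) ‖x‖ ha hb hp hr _ _ l2
      have l5 : (fun t : ℝ => h (t • x)) =ᶠ[nhds 1] (fun t : ℝ => (a + b * (t * ‖x‖) ^ α) ^ β *
          (t * ‖x‖) ^ (-(p * m + p)) * |f (t • x)| ^ p) := by
        filter_upwards [lt_mem_nhds (zero_lt_one' ℝ)] with t ht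
        simp only [hh, norm_smul, Real.norm_eq_abs, abs_of_pos ht]
      rw [l3.unique (l4.congr_of_eventuallyEq l5), hu, hv]
      simp only [one_smul]
      rw [hardy_uv _ _ _ _ _ _ _ (hA x) (abs_nonneg _) hr hp, hh]
      have hW : 0 ≤ (a + b * ‖x‖ ^ α) ^ β * ‖x‖ ^ (-(p * m + p)) := by
        have := hA x; positivity
      have t1 : 0 ≤ α * β * b * ‖x‖ ^ α * (a + b * ‖x‖ ^ α) ^ (β - 1) * ‖x‖ ^ (-(p * m + p))
          * |f x| ^ p := by have := hA x; positivity
      have t2 : -(|f x| ^ (p - 1) * (‖fderiv ℝ f x‖ * ‖x‖)) ≤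
          |f x| ^ (p - 2) * f x * fderiv ℝ f x x := by
        refine (abs_le.1 ?_).1
        rw [abs_mul, abs_mul, abs_of_nonneg (by positivity : 0 ≤ |f x| ^ (p - 2))]
        have : |f x| ^ (p - 2) * |f x| = |f x| ^ (p - 1) := by
          by_cases hz : f x = 0
          · simp [hz, Real.zero_rpow (by linarith : p - 1 ≠ 0)]
          · rw [← Real.rpow_add_one (abs_ne_zero.2 hz)]; congr 1; ring
        rw [this]
        gcongr
        exact (fderiv ℝ f x).le_opNorm x
      have t3 := mul_le_mul_of_nonneg_left t2 (mul_nonneg hp0.le hW)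
      simp only
      nlinarith [t1, t3]
  have hcuv : Continuous fun x => u x ^ (p - 1) * v x :=
    (hcu.rpow_const (fun x => Or.inr (by linarith))).mul hcv
  have hiuv : Integrable fun x => u x ^ (p - 1) * v x :=
    hcuv.integrable_of_hasCompactSupport hsv.mul_left
  have hidh : Integrable fun x => fderiv ℝ h x x := by
    refine Continuous.integrable_of_hasCompactSupport (by fun_prop) ?_
    refine (hsh.fderiv ℝ).mono ?_
    intro x hx hfx; apply hx; simp [hfx]
  have hI := integral_mono ((hint.const_mul (-(p * m + p))).sub (hiuv.const_mul p)) hidh hpt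
  simp only [Pi.sub_apply] at hI
  rw [integral_sub (hint.const_mul _) (hiuv.const_mul _), integral_const_mul,
    integral_const_mul, hsum] at hI
  have hpq : (p / (p - 1)).HolderConjugate p := (Real.HolderConjugate.conjExponent hp).symm
  have hH := integral_mul_le_Lp_mul_Lq_of_nonneg (μ := (volume : Measure (EuclideanSpace ℝ (Fin n))))
    hpq (f := fun x => u x ^ (p - 1)) (g := v)
    (Filter.Eventually.of_forall fun x => Real.rpow_nonneg (hunn x) _)
    (Filter.Eventually.of_forall hvnn)
    ((hcu.rpow_const (fun x => Or.inr (by linarith))).memLp_of_hasCompactSupport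
      (hsu.mono (by
        intro x hx hfx; apply hx; 
        simp only [hfx]; exact Real.zero_rpow (by linarith))))
    (hcv.memLp_of_hasCompactSupport hsv)
  have hpw : ∀ x, (u x ^ (p - 1)) ^ (p / (p - 1)) = h x := by
    intro x
    rw [← Real.rpow_mul (hunn x), mul_div_cancel₀ _ (by linarith : p - 1 ≠ 0), huh]
  simp only [hpw] at hH
  simp only [huh]
  have hhnn : 0 ≤ ∫ x, h x := integral_nonneg fun x => by
    simp only [← huh]; exact Real.rpow_nonneg (hunn x) _
  have hB : 0 ≤ (∫ x, v x ^ p) ^ (1 / p) :=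
    Real.rpow_nonneg (integral_nonneg fun x => Real.rpow_nonneg (hvnn x) _) _
  rcases hhnn.eq_or_lt with hz | hpos
  · rw [← hz, Real.zero_rpow (by positivity)]; simpa using hB
  · have hS : 0 < (∫ x, h x) ^ (1 / (p / (p - 1))) := Real.rpow_pos_of_pos hpos _
    have hsplit : ∫ x, h x = (∫ x, h x) ^ (1 / (p / (p - 1))) * (∫ x, h x) ^ (1 / p) := by
      rw [← Real.rpow_add hpos]
      have : 1 / (p / (p - 1)) + 1 / p = 1 := by
        have : p - 1 ≠ 0 := by linarith
        field_simp; ring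
      rw [this, Real.rpow_one]
    have hfin : (n - p * m - p) * ∫ x, h x ≤ p * ∫ x, u x ^ (p - 1) * v x := by linarith
    generalize (∫ x, u x ^ (p - 1) * v x) = J at *
    generalize (∫ x, v x ^ p) ^ (1 / p) = B at *
    rw [hsplit] at hfin
    generalize (∫ x, h x) ^ (1 / (p / (p - 1))) = S at *
    generalize (∫ x, h x) ^ (1 / p) = T at *
    rw [div_mul_eq_mul_div, div_le_iff₀ hp0]
    refine le_of_mul_le_mul_left ?_ hS
    nlinarith [mul_le_mul_of_nonneg_left hH hp0.le]
end

section
/- Let n ≥ 1, a, b > 0, 1 < p < ∞, α, β ∈ ℝ with αβ < 0 and pm − αβ ≤ n − p. Then for every f ∈ C_0^∞(ℝ^n \ {0}), ((n − pm + αβ − p)/p) · ‖(a + b|x|^α)^{β/p} f / |x|^{m+1}‖_{L^p(ℝ^n)} ≤ ‖(a + b|x|^α)^{β/p} ∇f / |x|^m‖_{L^p(ℝ^n)}. -/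
open Real MeasureTheory

theorem aux_div {n : ℕ} (g : EuclideanSpace ℝ (Fin n) → ℝ) (hg : ContDiff ℝ 1 g)
    (hc : HasCompactSupport g) :
    ∫ x, ((n : ℝ) * g x + fderiv ℝ g x x) = 0 := by
  have hfd : Continuous (fderiv ℝ g) := hg.continuous_fderiv one_ne_zero
  have hcf : HasCompactSupport (fderiv ℝ g) := hc.fderiv ℝ
  have hcfv : ∀ v, HasCompactSupport (fun x => fderiv ℝ g x v) := fun v =>
    hcf.comp_left (g := fun L : EuclideanSpace ℝ (Fin n) →L[ℝ] ℝ => L v) rfl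
  have hproj : ∀ i : Fin n, Continuous (fun x : EuclideanSpace ℝ (Fin n) => x i) := fun i =>
    (EuclideanSpace.proj (𝕜 := ℝ) i).continuous
  have hint : ∀ i : Fin n, Integrable (fun x : EuclideanSpace ℝ (Fin n) =>
      x i * fderiv ℝ g x (EuclideanSpace.single i 1)) := fun i => by
    refine Continuous.integrable_of_hasCompactSupport ?_ (hcfv _).mul_left
    exact (hproj i).mul (hfd.clm_apply continuous_const)
  have hgi : Integrable g := hg.continuous.integrable_of_hasCompactSupport hc
  have hi : ∀ i : Fin n, ∫ x : EuclideanSpace ℝ (Fin n),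
      x i * fderiv ℝ g x (EuclideanSpace.single i 1) = - ∫ x, g x := by
    intro i
    have hd : ∀ x : EuclideanSpace ℝ (Fin n),
        fderiv ℝ (fun y : EuclideanSpace ℝ (Fin n) => y i) x (EuclideanSpace.single i 1) = 1 := by
      intro x
      have : HasFDerivAt (fun y : EuclideanSpace ℝ (Fin n) => y i)
        (EuclideanSpace.proj (𝕜 := ℝ) i) x := (EuclideanSpace.proj (𝕜 := ℝ) i).hasFDerivAt
      rw [this.fderiv]; simp
    have := integral_mul_fderiv_eq_neg_fderiv_mul_of_integrable (μ := volume) (𝕜 := ℝ)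
      (f := fun y : EuclideanSpace ℝ (Fin n) => y i) (g := g) (v := EuclideanSpace.single i 1)
      (by simpa only [hd, one_mul] using hgi) (hint i)
      (((hproj i).mul hg.continuous).integrable_of_hasCompactSupport hc.mul_left)
      (fun x _ => (EuclideanSpace.proj (𝕜 := ℝ) i).differentiableAt)
      (fun x _ => hg.differentiable one_ne_zero x)
    simpa only [hd, one_mul] using this
  have hsum : ∀ x : EuclideanSpace ℝ (Fin n),
      fderiv ℝ g x x = ∑ i, x i * fderiv ℝ g x (EuclideanSpace.single i 1) := by
    intro x
    conv_lhs => rw [← (EuclideanSpace.basisFun (Fin n) ℝ).sum_repr x]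
    rw [map_sum (fderiv ℝ g _)]
    simp
    have hx : ∑ i, x i • (EuclideanSpace.single i 1 : EuclideanSpace ℝ (Fin n)) = x := by
      simpa using (EuclideanSpace.basisFun (Fin n) ℝ).sum_repr x
    rw [hx]
  simp_rw [hsum]
  rw [integral_add (hgi.const_mul _) (integrable_finsetSum _ fun i _ => hint i),
    integral_finsetSum _ (fun i _ => hint i), integral_const_mul]
  simp [hi]

theorem aux_ray {n : ℕ} (a b p α β m : ℝ) (ha : 0 < a) (hb : 0 < b) (hp : 1 < p)
    (f g : EuclideanSpace ℝ (Fin n) → ℝ) (hf : Differentiable ℝ f)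
    (hgdef : ∀ x, g x = (a + b * ‖x‖ ^ α) ^ β * ‖x‖ ^ (-(p * m + p)) * |f x| ^ p)
    (x : EuclideanSpace ℝ (Fin n)) (hx : x ≠ 0) (hg : DifferentiableAt ℝ g x) :
    fderiv ℝ g x x = g x * (α * β * (b * ‖x‖ ^ α / (a + b * ‖x‖ ^ α)) - (p * m + p))
      + (a + b * ‖x‖ ^ α) ^ β * ‖x‖ ^ (-(p * m + p)) * (p * |f x| ^ (p - 2) * f x * fderiv ℝ f x x) := by
  have hr : 0 < ‖x‖ := norm_pos_iff.2 hx
  have hS : 0 < a + b * ‖x‖ ^ α := by positivity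
  have hline : HasDerivAt (fun t : ℝ => t • x) x 1 := by
    simpa using (hasDerivAt_id (1 : ℝ)).smul_const x
  have h1 : HasDerivAt (fun t : ℝ => g (t • x)) (fderiv ℝ g x x) 1 := by
    have : HasFDerivAt g (fderiv ℝ g x) ((1 : ℝ) • x) := by simpa using hg.hasFDerivAt
    exact this.comp_hasDerivAt (1 : ℝ) hline
  have h2 : HasDerivAt (fun t : ℝ => f (t • x)) (fderiv ℝ f x x) 1 := by
    have : HasFDerivAt f (fderiv ℝ f x) ((1 : ℝ) • x) := by simpa using (hf x).hasFDerivAt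
    exact this.comp_hasDerivAt (1 : ℝ) hline
  have h3 : HasDerivAt (fun t : ℝ => |f (t • x)| ^ p)
      (p * |f x| ^ (p - 2) * f x * fderiv ℝ f x x) 1 := by
    have := hasDerivAt_abs_rpow (f ((1 : ℝ) • x)) hp
    have := this.comp (1 : ℝ) h2
    simp only [one_smul] at this
    exact this
  have h4 : HasDerivAt (fun t : ℝ => t * ‖x‖) ‖x‖ 1 := by
    simpa using (hasDerivAt_id (1 : ℝ)).mul_const ‖x‖
  have h5 := h4.rpow_const (p := α) (Or.inl (by simpa using hr.ne'))
  have h6 := h4.rpow_const (p := -(p * m + p)) (Or.inl (by simpa using hr.ne'))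
  have h7 := ((h5.const_mul b).const_add a).rpow_const (p := β)
    (Or.inl (by simpa using hS.ne'))
  have h8 := (h7.mul h6).mul h3
  have h9 : (fun t : ℝ => g (t • x)) =ᶠ[nhds 1] (((fun t : ℝ => (a + b * (t * ‖x‖) ^ α) ^ β) *
      fun t : ℝ => (t * ‖x‖) ^ (-(p * m + p))) * fun t : ℝ => |f (t • x)| ^ p) := by
    filter_upwards [lt_mem_nhds (zero_lt_one (α := ℝ))] with t ht
    simp [hgdef, norm_smul, abs_of_pos ht]
  have h10 := h1.unique (h8.congr_of_eventuallyEq h9)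
  rw [h10, hgdef]
  simp only [Pi.mul_apply, one_mul, one_smul]
  rw [rpow_sub_one hS.ne', rpow_sub_one hr.ne', rpow_sub_one hr.ne']
  field_simp
  ring

theorem aux_cont_s13 {n : ℕ} (h : EuclideanSpace ℝ (Fin n) → ℝ) {ε : ℝ} (hε : 0 < ε)
    (h0 : ∀ x, ‖x‖ < ε → h x = 0) (hc : ∀ x, x ≠ 0 → ContinuousAt h x) : Continuous h := by
  rw [continuous_iff_continuousAt]
  intro x
  by_cases hx : x = 0
  · subst hx
    have : h =ᶠ[nhds 0] fun _ => 0 := by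
      filter_upwards [Metric.ball_mem_nhds _ hε] with y hy
      exact h0 y (by simpa using hy)
    exact continuousAt_const.congr this.symm
  · exact hc x hx



theorem stmt_13 (n : ℕ) (hn : 1 ≤ n) (a b p α β m : ℝ) (ha : 0 < a) (hb : 0 < b)
    (hp : 1 < p) (hαβ : α * β < 0) (hm : p * m - α * β ≤ (n : ℝ) - p)
    (f : EuclideanSpace ℝ (Fin n) → ℝ) (hf : ContDiff ℝ (⊤ : ℕ∞) f) (hsupp : HasCompactSupport f)
    (h0 : ∃ ε > (0 : ℝ), ∀ x : EuclideanSpace ℝ (Fin n), ‖x‖ < ε → f x = 0) :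
    (((n : ℝ) - p * m + α * β - p) / p) *
        (∫ x : EuclideanSpace ℝ (Fin n),
          ((a + b * ‖x‖ ^ α) ^ (β / p) * |f x| / ‖x‖ ^ (m + 1)) ^ p) ^ (1 / p) ≤
      (∫ x : EuclideanSpace ℝ (Fin n),
        ((a + b * ‖x‖ ^ α) ^ (β / p) * ‖fderiv ℝ f x‖ / ‖x‖ ^ m) ^ p) ^ (1 / p) := by
  obtain ⟨ε, hε, h0⟩ := h0
  have hp0 : 0 < p := by linarith
  have hfd : Differentiable ℝ f := hf.differentiable (by simp)
  have hfc : Continuous f := hf.continuous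
  have hf' : Continuous (fderiv ℝ f) := hf.continuous_fderiv (by simp)
  have h0' : ∀ x : EuclideanSpace ℝ (Fin n), ‖x‖ < ε → fderiv ℝ f x = 0 := by
    intro x hx
    have : f =ᶠ[nhds x] fun _ => 0 := by
      filter_upwards [Metric.isOpen_ball.mem_nhds (show x ∈ Metric.ball 0 ε by simpa using hx)]
        with y hy
      exact h0 y (by simpa using hy)
    rw [this.fderiv_eq]; simp
  set u : EuclideanSpace ℝ (Fin n) → ℝ := fun x =>
    (a + b * ‖x‖ ^ α) ^ (β / p) * |f x| / ‖x‖ ^ (m + 1) with hu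
  set v : EuclideanSpace ℝ (Fin n) → ℝ := fun x =>
    (a + b * ‖x‖ ^ α) ^ (β / p) * ‖fderiv ℝ f x‖ / ‖x‖ ^ m with hv
  set g : EuclideanSpace ℝ (Fin n) → ℝ := fun x =>
    (a + b * ‖x‖ ^ α) ^ β * ‖x‖ ^ (-(p * m + p)) * |f x| ^ p with hgd
  have hSpos : ∀ x : EuclideanSpace ℝ (Fin n), 0 < a + b * ‖x‖ ^ α := fun x => by positivity
  have hu0 : ∀ x, 0 ≤ u x := fun x => by
    have := hSpos x
    simp only [hu]; positivity
  have hv0 : ∀ x, 0 ≤ v x := fun x => by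
    have := hSpos x
    simp only [hv]; positivity
  have huz : ∀ x, f x = 0 → u x = 0 := fun x hx => by simp [hu, hx]
  have hvz : ∀ x, fderiv ℝ f x = 0 → v x = 0 := fun x hx => by simp [hv, hx]
  have hgz : ∀ x, f x = 0 → g x = 0 := fun x hx => by simp [hgd, hx, hp0.ne']
  have hf00 : f 0 = 0 := h0 0 (by simpa using hε)
  have hnc : ∀ (x : EuclideanSpace ℝ (Fin n)) (c : ℝ), x ≠ 0 →
      ContinuousAt (fun y : EuclideanSpace ℝ (Fin n) => ‖y‖ ^ c) x := fun x c hx =>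
    continuous_norm.continuousAt.rpow_const (Or.inl (norm_ne_zero_iff.2 hx))
  have hSc : ∀ (x : EuclideanSpace ℝ (Fin n)) (c : ℝ), x ≠ 0 →
      ContinuousAt (fun y : EuclideanSpace ℝ (Fin n) => (a + b * ‖y‖ ^ α) ^ c) x := fun x c hx =>
    (continuousAt_const.add (continuousAt_const.mul (hnc x α hx))).rpow_const
      (Or.inl (hSpos x).ne')
  have hpos : ∀ (x : EuclideanSpace ℝ (Fin n)) (c : ℝ), x ≠ 0 → ‖x‖ ^ c ≠ 0 := fun x c hx =>
    (rpow_pos_of_pos (norm_pos_iff.2 hx) c).ne'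
  have huc : Continuous u := aux_cont_s13 u hε (fun x hx => huz x (h0 x hx)) fun x hx =>
    ((hSc x _ hx).mul hfc.abs.continuousAt).div (hnc x _ hx) (hpos x _ hx)
  have hvc : Continuous v := aux_cont_s13 v hε (fun x hx => hvz x (h0' x hx)) fun x hx =>
    ((hSc x _ hx).mul hf'.norm.continuousAt).div (hnc x _ hx) (hpos x _ hx)
  have hus : HasCompactSupport u := hsupp.mono fun x hx hfx => hx (huz x hfx)
  have hvs : HasCompactSupport v := (hsupp.fderiv ℝ).mono fun x hx hfx => hx (hvz x hfx)
  have hgs : HasCompactSupport g := hsupp.mono fun x hx hfx => hx (hgz x hfx)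
  have hgC : ContDiff ℝ 1 g := by
    rw [contDiff_iff_contDiffAt]
    intro x
    by_cases hx : x = 0
    · subst hx
      have : g =ᶠ[nhds 0] fun _ => 0 := by
        filter_upwards [Metric.ball_mem_nhds _ hε] with y hy
        exact hgz y (h0 y (by simpa using hy))
      exact contDiffAt_const.congr_of_eventuallyEq this
    · have hn1 : ContDiffAt ℝ 1 (fun y : EuclideanSpace ℝ (Fin n) => ‖y‖) x := contDiffAt_norm ℝ hx
      have hx' := norm_ne_zero_iff.2 hx
      refine ContDiffAt.mul (ContDiffAt.mul ?_ (hn1.rpow_const_of_ne hx')) ?_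
      · exact (contDiffAt_const.add (contDiffAt_const.mul
          (hn1.rpow_const_of_ne hx'))).rpow_const_of_ne (hSpos x).ne'
      · exact ((hf.of_le (by exact_mod_cast le_top)).norm_rpow hp).contDiffAt
  have hug : ∀ x, u x ^ p = g x := by
    intro x
    by_cases hx : x = 0
    · subst hx; rw [huz 0 hf00, hgz 0 hf00, zero_rpow hp0.ne']
    · have hr : 0 < ‖x‖ := norm_pos_iff.2 hx
      have hS := hSpos x
      simp only [hu, hgd]
      rw [div_rpow (by positivity) (by positivity), mul_rpow (by positivity) (by positivity),
        ← rpow_mul hS.le, ← rpow_mul hr.le, rpow_neg hr.le, div_mul_cancel₀ _ hp0.ne',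
        show (m + 1) * p = p * m + p by ring]
      field_simp
  have hpt : ∀ x, ((n : ℝ) - p * m + α * β - p) * u x ^ p - p * (v x * u x ^ (p - 1)) ≤
      (n : ℝ) * g x + fderiv ℝ g x x := by
    intro x
    by_cases hx : x = 0
    · subst hx
      have hp1 : p - 1 ≠ 0 := by linarith
      rw [huz 0 hf00, hgz 0 hf00, zero_rpow hp0.ne', zero_rpow hp1]; simp
    · have hr : 0 < ‖x‖ := norm_pos_iff.2 hx
      have hS := hSpos x
      rw [aux_ray a b p α β m ha hb hp f g hfd (fun _ => rfl) x hx
        (hgC.differentiable one_ne_zero x), hug]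
      set W := (a + b * ‖x‖ ^ α) ^ β * ‖x‖ ^ (-(p * m + p)) with hW
      have hW0 : 0 ≤ W := by positivity
      have hg0 : 0 ≤ g x := by rw [← hug]; exact rpow_nonneg (hu0 x) _
      have hth : b * ‖x‖ ^ α / (a + b * ‖x‖ ^ α) ≤ 1 := by
        rw [div_le_one hS]; linarith
      have h1 : α * β ≤ α * β * (b * ‖x‖ ^ α / (a + b * ‖x‖ ^ α)) := by nlinarith
      have h2 := mul_le_mul_of_nonneg_left h1 hg0
      have huv : v x * u x ^ (p - 1) = W * (|f x| ^ (p - 1) * (‖fderiv ℝ f x‖ * ‖x‖)) := by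
        simp only [hu, hv, hW]
        rw [div_rpow (by positivity) (by positivity), mul_rpow (by positivity) (by positivity),
          ← rpow_mul hS.le, ← rpow_mul hr.le]
        have e1 : (a + b * ‖x‖ ^ α) ^ β =
            (a + b * ‖x‖ ^ α) ^ (β / p) * (a + b * ‖x‖ ^ α) ^ (β / p * (p - 1)) := by
          rw [← rpow_add hS]; congr 1; field_simp; ring
        have e2 : ‖x‖ ^ (-(p * m + p)) * ‖x‖ = (‖x‖ ^ m)⁻¹ * (‖x‖ ^ ((m + 1) * (p - 1)))⁻¹ := by
          rw [← rpow_neg hr.le, ← rpow_neg hr.le, ← rpow_add hr, ← rpow_add_one hr.ne']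
          congr 1; ring
        rw [e1]
        calc _ = (a + b * ‖x‖ ^ α) ^ (β / p) * (a + b * ‖x‖ ^ α) ^ (β / p * (p - 1)) *
              |f x| ^ (p - 1) * ‖fderiv ℝ f x‖ *
              ((‖x‖ ^ m)⁻¹ * (‖x‖ ^ ((m + 1) * (p - 1)))⁻¹) := by
                rw [div_eq_mul_inv, div_eq_mul_inv]; ring
          _ = _ := by rw [← e2]; ring
      have h3 : -(|f x| ^ (p - 1) * (‖fderiv ℝ f x‖ * ‖x‖)) ≤
          |f x| ^ (p - 2) * f x * fderiv ℝ f x x := by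
        apply neg_le_of_abs_le
        have e3 : |f x| ^ (p - 2) * |f x| = |f x| ^ (p - 1) := by
          by_cases hfx : f x = 0
          · rw [hfx, abs_zero, zero_rpow (by linarith : p - 1 ≠ 0), mul_zero]
          · rw [← rpow_add_one (abs_ne_zero.2 hfx)]; congr 1; ring
        rw [abs_mul, abs_mul, abs_of_nonneg (rpow_nonneg (abs_nonneg _) _), e3]
        exact mul_le_mul_of_nonneg_left ((fderiv ℝ f x).le_opNorm x)
          (rpow_nonneg (abs_nonneg _) _)
      rw [huv]
      have h4 := mul_le_mul_of_nonneg_left h3 (mul_nonneg hp0.le hW0)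
      linarith
  have hcp : Continuous fun x => u x ^ (p - 1) :=
    huc.rpow_const fun x => Or.inr (by linarith)
  have hcps : HasCompactSupport fun x => u x ^ (p - 1) :=
    hus.comp_left (g := fun t : ℝ => t ^ (p - 1)) (zero_rpow (by linarith))
  have hI1 : Integrable fun x => u x ^ p := by
    simp_rw [hug]; exact hgC.continuous.integrable_of_hasCompactSupport hgs
  have hI2 : Integrable fun x => v x * u x ^ (p - 1) :=
    (hvc.mul hcp).integrable_of_hasCompactSupport hcps.mul_left
  have hI3 : Integrable fun x => (n : ℝ) * g x + fderiv ℝ g x x := by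
    refine Integrable.add ((hgC.continuous.integrable_of_hasCompactSupport hgs).const_mul _) ?_
    refine Continuous.integrable_of_hasCompactSupport
      ((hgC.continuous_fderiv one_ne_zero).clm_apply continuous_id) ?_
    exact (hgs.fderiv ℝ).mono fun x hx hfx => hx (by simp [hfx])
  have hmain := integral_mono ((hI1.const_mul _).sub (hI2.const_mul p)) hI3 hpt
  rw [aux_div g hgC hgs] at hmain
  simp only [Pi.sub_apply] at hmain
  rw [integral_sub (hI1.const_mul _) (hI2.const_mul p), integral_const_mul,
    integral_const_mul] at hmain
  have hpq : p.HolderConjugate (p / (p - 1)) := Real.HolderConjugate.conjExponent hp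
  have hH := integral_mul_le_Lp_mul_Lq_of_nonneg (μ := volume) hpq
    (Filter.Eventually.of_forall hv0)
    (Filter.Eventually.of_forall fun x => rpow_nonneg (hu0 x) (p - 1))
    (hvc.memLp_of_hasCompactSupport hvs) (hcp.memLp_of_hasCompactSupport hcps)
  have hpow : ∀ x, (u x ^ (p - 1)) ^ (p / (p - 1)) = u x ^ p := fun x => by
    rw [← rpow_mul (hu0 x), mul_div_cancel₀ _ (by linarith : p - 1 ≠ 0)]
  simp_rw [hpow] at hH
  change _ * (∫ x, u x ^ p) ^ (1 / p) ≤ (∫ x, v x ^ p) ^ (1 / p)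
  have hA0 : 0 ≤ ∫ x, u x ^ p := integral_nonneg fun x => rpow_nonneg (hu0 x) p
  have hB0 : 0 ≤ ∫ x, v x ^ p := integral_nonneg fun x => rpow_nonneg (hv0 x) p
  generalize (∫ x, u x ^ p) = A at *
  generalize (∫ x, v x ^ p) = B at *
  rcases hA0.eq_or_lt with hA | hA
  · rw [← hA, zero_rpow (by positivity), mul_zero]; positivity
  · have e : A ^ (1 / p) * A ^ (1 / (p / (p - 1))) = A := by
      rw [← rpow_add hA]
      have : 1 / p + 1 / (p / (p - 1)) = 1 := by
        have : p - 1 ≠ 0 := by linarith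
        field_simp; ring
      rw [this, rpow_one]
    have hq : 0 < A ^ (1 / (p / (p - 1))) := rpow_pos_of_pos hA _
    refine le_of_mul_le_mul_right ?_ hq
    rw [mul_assoc, e, div_mul_eq_mul_div, div_le_iff₀ hp0]
    nlinarith
end
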